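/- Let φ_1,…,φ_m ∈ ℚ(X) be non-zero multiplicatively independent rational functions that are moreover multiplicatively independent modulo constants. Then there are effectively computable constants c_1, c_2, c_3 depending only on the φ_i such that for all integers K, L ≥ 1 there is a positive integer T with log T ≤ c_1·(KL)^{m+1} such that for every prime p > c_2, the number of α ∈ \overline{𝔽}_p satisfying two linearly independent multiplicative relations ∏ φ_i(α)^{k_i} = ∏ φ_i(α)^{ℓ_i} = 1 with max|k_i| ≤ K, max|ℓ_i| ≤ L is at most v_p(T) + c_3. -/

import Mathlib

open Polynomial

/-- The set `𝒜_φ(p, K, L)` of elements `α ∈ 𝔽̄_p` (not a zero or pole of any reduced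
`φᵢ = fᵢ/gᵢ`) such that the values `φᵢ(α)` satisfy two linearly independent multiplicative
relations with exponents bounded by `K` and `L` respectively. -/
def depSet (m : ℕ) (f g : Fin m → Polynomial ℤ) (K L : ℕ) (p : ℕ) [Fact p.Prime] :
    Set (AlgebraicClosure (ZMod p)) :=
  {α : AlgebraicClosure (ZMod p) |
    (∀ i, Polynomial.eval₂ (Int.castRingHom (AlgebraicClosure (ZMod p))) α (f i) ≠ 0 ∧
      Polynomial.eval₂ (Int.castRingHom (AlgebraicClosure (ZMod p))) α (g i) ≠ 0) ∧
    ∃ k l : Fin m → ℤ, LinearIndependent ℤ ![k, l] ∧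
      (∀ i, |k i| ≤ (K : ℤ)) ∧ (∀ i, |l i| ≤ (L : ℤ)) ∧
      (∏ i, (Polynomial.eval₂ (Int.castRingHom (AlgebraicClosure (ZMod p))) α (f i) /
        Polynomial.eval₂ (Int.castRingHom (AlgebraicClosure (ZMod p))) α (g i)) ^ (k i)) = 1 ∧
      (∏ i, (Polynomial.eval₂ (Int.castRingHom (AlgebraicClosure (ZMod p))) α (f i) /
        Polynomial.eval₂ (Int.castRingHom (AlgebraicClosure (ZMod p))) α (g i)) ^ (l i)) = 1}

section PartBase

open Polynomial

namespace BMZ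

/-- Evaluation of integer polynomials. -/
noncomputable def ev {F : Type*} [Field F] (α : F) : ℤ[X] →+* F :=
  eval₂RingHom (Int.castRingHom F) α

lemma ev_apply {F : Type*} [Field F] (α : F) (P : ℤ[X]) :
    ev α P = eval₂ (Int.castRingHom F) α P := rfl

lemma ev_C {F : Type*} [Field F] (α : F) (c : ℤ) : ev α (C c) = (c : F) := by
  simp [ev]

lemma ev_map {F G : Type*} [Field F] [Field G] (σ : F →+* G) (α : F) (P : ℤ[X]) :
    σ (ev α P) = ev (σ α) P := by
  rw [ev_apply, ev_apply, hom_eval₂]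
  congr 1
  exact RingHom.ext_int _ _

/-- No zeros or poles. -/
def Good {m : ℕ} (f g : Fin m → ℤ[X]) {F : Type*} [Field F] (α : F) : Prop :=
  ∀ i, ev α (f i) ≠ 0 ∧ ev α (g i) ≠ 0

/-- The value of `φ^k` at `α`. -/
noncomputable def val {m : ℕ} (f g : Fin m → ℤ[X]) {F : Type*} [Field F] (α : F) (k : Fin m → ℤ) : F :=
  ∏ i, (ev α (f i) / ev α (g i)) ^ (k i)

lemma val_map {m : ℕ} (f g : Fin m → ℤ[X]) {F G : Type*} [Field F] [Field G] (σ : F →+* G)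
    (α : F) (k : Fin m → ℤ) : σ (val f g α k) = val f g (σ α) k := by
  simp [val, map_prod, map_zpow₀, map_div₀, ev_map]

lemma Good.map {m : ℕ} {f g : Fin m → ℤ[X]} {F G : Type*} [Field F] [Field G] (σ : F →+* G)
    {α : F} (h : Good f g α) : Good f g (σ α) := by
  intro i
  rw [← ev_map, ← ev_map]
  exact ⟨by simpa using (h i).1, by simpa using (h i).2⟩

/-- Factorization data. -/
structure Data (m : ℕ) (f g : Fin m → ℤ[X]) where
  s : ℕ
  q : Fin s → ℤ[X]
  deg_pos : ∀ j, 0 < (q j).natDegree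
  sep : ∀ j, ((q j).map (Int.castRingHom ℂ)).Separable
  bez : ∀ j l, j ≠ l → ∃ R : ℤ, R ≠ 0 ∧ ∃ A B : ℤ[X], A * q j + B * q l = C R
  c : Fin m → ℤ
  c' : Fin m → ℤ
  c_ne : ∀ i, c i ≠ 0
  c'_ne : ∀ i, c' i ≠ 0
  u : Fin m → Fin s → ℕ
  w : Fin m → Fin s → ℕ
  hf : ∀ i, f i = C (c i) * ∏ j, q j ^ u i j
  hg : ∀ i, g i = C (c' i) * ∏ j, q j ^ w i j
  used : ∀ j, ∃ i, q j ∣ f i ∨ q j ∣ g i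
  inj : ∀ k : Fin m → ℤ, (∀ j, ∑ i, k i * ((u i j : ℤ) - w i j) = 0) → k = 0

/-- exponents -/
def Data.e {m : ℕ} {f g : Fin m → ℤ[X]} (D : Data m f g) (k : Fin m → ℤ) (j : Fin D.s) : ℤ :=
  ∑ i, k i * ((D.u i j : ℤ) - D.w i j)

lemma bezout_of_irreducible {a b : ℤ[X]} (ha : Irreducible a) (hb : Irreducible b)
    (hda : 0 < a.natDegree) (hdb : 0 < b.natDegree) (hab : ¬ Associated a b) :
    ∃ R : ℤ, R ≠ 0 ∧ ∃ A B : ℤ[X], A * a + B * b = C R := by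
  have pa := ha.isPrimitive hda.ne'
  have pb := hb.isPrimitive hdb.ne'
  have ia := (IsPrimitive.Int.irreducible_iff_irreducible_map_cast pa).1 ha
  have ib := (IsPrimitive.Int.irreducible_iff_irreducible_map_cast pb).1 hb
  have hco : IsCoprime (a.map (Int.castRingHom ℚ)) (b.map (Int.castRingHom ℚ)) := by
    rw [ia.coprime_iff_not_dvd]
    intro h
    have h1 : a ∣ b := (IsPrimitive.Int.dvd_iff_map_cast_dvd_map_cast a b pa).2 h
    exact hab (ha.associated_of_dvd hb h1)
  obtain ⟨A, B, hAB⟩ := hco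
  obtain ⟨r, hr, hA⟩ := IsLocalization.integerNormalization_spec (nonZeroDivisors ℤ) A
  obtain ⟨t, ht, hB⟩ := IsLocalization.integerNormalization_spec (nonZeroDivisors ℤ) B
  have hr0 := nonZeroDivisors.ne_zero hr
  have ht0 := nonZeroDivisors.ne_zero ht
  refine ⟨r * t, mul_ne_zero hr0 ht0, C t * IsLocalization.integerNormalization (nonZeroDivisors ℤ) A,
    C r * IsLocalization.integerNormalization (nonZeroDivisors ℤ) B, ?_⟩
  apply Polynomial.map_injective (Int.castRingHom ℚ) Int.cast_injective
  have hA' : map (Int.castRingHom ℚ) (IsLocalization.integerNormalization (nonZeroDivisors ℤ) A)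
      = C (r:ℚ) * A := by
    rw [show Int.castRingHom ℚ = algebraMap ℤ ℚ from rfl, hA]; simp [zsmul_eq_mul]
  have hB' : map (Int.castRingHom ℚ) (IsLocalization.integerNormalization (nonZeroDivisors ℤ) B)
      = C (t:ℚ) * B := by
    rw [show Int.castRingHom ℚ = algebraMap ℤ ℚ from rfl, hB]; simp [zsmul_eq_mul]
  simp only [Polynomial.map_add, Polynomial.map_mul, hA', hB', map_C, map_mul]
  simp only [eq_intCast, map_intCast]
  linear_combination (r * t : ℚ[X]) * hAB

lemma zpow_sum {F : Type*} [Field F] {a : F} (ha : a ≠ 0) {ι : Type*} (t : Finset ι) (x : ι → ℤ) :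
    a ^ (∑ i ∈ t, x i) = ∏ i ∈ t, a ^ x i := by
  classical
  induction t using Finset.induction_on with
  | empty => simp
  | insert i t hi ih => rw [Finset.sum_insert hi, Finset.prod_insert hi, zpow_add₀ ha, ih]

lemma multiset_factor {s : ℕ} (q : Fin s → ℤ[X]) (M : Multiset ℤ[X])
    (hM : ∀ x ∈ M, (x ≠ 0 ∧ x.natDegree = 0) ∨ ∃ j, x = q j) :
    ∃ c : ℤ, c ≠ 0 ∧ ∃ u : Fin s → ℕ, M.prod = C c * ∏ j, q j ^ u j := by
  classical
  induction M using Multiset.induction_on with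
  | empty => exact ⟨1, one_ne_zero, 0, by simp⟩
  | cons x M ih =>
    obtain ⟨c, hc, u, h⟩ := ih (fun y hy => hM y (Multiset.mem_cons_of_mem hy))
    rcases hM x (Multiset.mem_cons_self x M) with ⟨h0, hd⟩ | ⟨j, rfl⟩
    · rw [natDegree_eq_zero] at hd
      obtain ⟨a, rfl⟩ := hd
      refine ⟨a * c, mul_ne_zero (by simpa using h0) hc, u, ?_⟩
      rw [Multiset.prod_cons, h, C_mul, mul_assoc]
    · refine ⟨c, hc, u + Pi.single j 1, ?_⟩
      rw [Multiset.prod_cons, h]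
      simp only [Pi.add_apply, pow_add, Finset.prod_mul_distrib]
      have : ∏ x, q x ^ (Pi.single j 1 : Fin s → ℕ) x = q j := by
        rw [Finset.prod_eq_single j] <;> simp +contextual
      rw [this]; ring

lemma exists_data (m : ℕ) (f g : Fin m → ℤ[X])
    (hf : ∀ i, f i ≠ 0) (hg : ∀ i, g i ≠ 0)
    (hindepc : ∀ k : Fin m → ℤ,
      (∃ q : ℚ, q ≠ 0 ∧
        (∏ i, (algebraMap (Polynomial ℚ) (RatFunc ℚ) ((f i).map (Int.castRingHom ℚ)) /
          algebraMap (Polynomial ℚ) (RatFunc ℚ) ((g i).map (Int.castRingHom ℚ))) ^ (k i)) =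
        RatFunc.C q) → k = 0) : Nonempty (Data m f g) := by
  classical
  let NF := UniqueFactorizationMonoid.normalizedFactors (α := ℤ[X])
  let Q : Finset ℤ[X] := (Finset.univ.biUnion fun i => (NF (f i) + NF (g i)).toFinset).filter
    (fun x => 0 < x.natDegree)
  let q : Fin Q.card → ℤ[X] := fun j => (Q.equivFin.symm j : ℤ[X])
  have hqQ : ∀ j, q j ∈ Q := fun j => (Q.equivFin.symm j).2
  have hqinj : Function.Injective q := Subtype.val_injective.comp Q.equivFin.symm.injective
  have hsurj : ∀ x ∈ Q, ∃ j, x = q j := fun x hx => ⟨Q.equivFin ⟨x, hx⟩, by simp [q]⟩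
  have hdeg : ∀ j, 0 < (q j).natDegree := fun j => (Finset.mem_filter.1 (hqQ j)).2
  have hused : ∀ j, ∃ i, q j ∣ f i ∨ q j ∣ g i := by
    intro j
    have := (Finset.mem_filter.1 (hqQ j)).1
    simp only [Finset.mem_biUnion, Finset.mem_univ, true_and, Multiset.mem_toFinset,
      Multiset.mem_add] at this
    obtain ⟨i, h | h⟩ := this
    exacts [⟨i, Or.inl (UniqueFactorizationMonoid.dvd_of_mem_normalizedFactors h)⟩,
      ⟨i, Or.inr (UniqueFactorizationMonoid.dvd_of_mem_normalizedFactors h)⟩]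
  have hmem : ∀ j, ∃ P : ℤ[X], q j ∈ NF P := by
    intro j
    have := (Finset.mem_filter.1 (hqQ j)).1
    simp only [Finset.mem_biUnion, Finset.mem_univ, true_and, Multiset.mem_toFinset,
      Multiset.mem_add] at this
    obtain ⟨i, h | h⟩ := this
    exacts [⟨_, h⟩, ⟨_, h⟩]
  have hirr : ∀ j, Irreducible (q j) := fun j => by
    obtain ⟨P, hP⟩ := hmem j
    exact UniqueFactorizationMonoid.irreducible_of_normalized_factor _ hP
  have hnorm : ∀ j, normalize (q j) = q j := fun j => by
    obtain ⟨P, hP⟩ := hmem j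
    exact UniqueFactorizationMonoid.normalize_normalized_factor _ hP
  have key : ∀ P : ℤ[X], P ≠ 0 → (∀ x ∈ NF P, 0 < x.natDegree → x ∈ Q) →
      ∃ c : ℤ, c ≠ 0 ∧ ∃ u : Fin Q.card → ℕ, P = C c * ∏ j, q j ^ u j := by
    intro P hP h
    obtain ⟨c, hc, u, hu⟩ := multiset_factor q (NF P) (by
      intro x hx
      rcases Nat.eq_zero_or_pos x.natDegree with h0 | h0
      · exact Or.inl ⟨(UniqueFactorizationMonoid.irreducible_of_normalized_factor _ hx).ne_zero, h0⟩
      · exact Or.inr (hsurj x (h x hx h0)))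
    obtain ⟨ε, hε⟩ := UniqueFactorizationMonoid.prod_normalizedFactors hP
    obtain ⟨a, ha, hae⟩ := Polynomial.isUnit_iff.1 ε.isUnit
    refine ⟨c * a, mul_ne_zero hc ha.ne_zero, u, ?_⟩
    rw [← hε, ← hae]
    change (NF P).prod = _ at hu
    rw [hu, C_mul]; ring
  have hF : ∀ i, ∃ c : ℤ, c ≠ 0 ∧ ∃ u : Fin Q.card → ℕ, f i = C c * ∏ j, q j ^ u j := by
    intro i
    refine key _ (hf i) (fun x hx h0 => Finset.mem_filter.2 ⟨?_, h0⟩)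
    simp only [Finset.mem_biUnion, Finset.mem_univ, true_and, Multiset.mem_toFinset,
      Multiset.mem_add]
    exact ⟨i, Or.inl hx⟩
  have hG : ∀ i, ∃ c : ℤ, c ≠ 0 ∧ ∃ u : Fin Q.card → ℕ, g i = C c * ∏ j, q j ^ u j := by
    intro i
    refine key _ (hg i) (fun x hx h0 => Finset.mem_filter.2 ⟨?_, h0⟩)
    simp only [Finset.mem_biUnion, Finset.mem_univ, true_and, Multiset.mem_toFinset,
      Multiset.mem_add]
    exact ⟨i, Or.inr hx⟩
  choose c hc u hu using hF
  choose c' hc' w hw using hG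
  refine ⟨{ s := Q.card, q := q, deg_pos := hdeg, sep := ?_, bez := ?_, c := c, c' := c', c_ne := hc, c'_ne := hc', u := u, w := w, hf := hu, hg := hw, used := hused, inj := ?_ }⟩
  · intro j
    have pa := (hirr j).isPrimitive (hdeg j).ne'
    have ia := (IsPrimitive.Int.irreducible_iff_irreducible_map_cast pa).1 (hirr j)
    have := ia.separable.map (f := algebraMap ℚ ℂ)
    rw [Polynomial.map_map, show (algebraMap ℚ ℂ).comp (Int.castRingHom ℚ) = Int.castRingHom ℂ from
      RingHom.ext_int _ _] at this
    exact this
  · intro j l hjl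
    refine bezout_of_irreducible (hirr j) (hirr l) (hdeg j) (hdeg l) (fun h => hjl (hqinj ?_))
    rw [← hnorm j, ← hnorm l]
    exact normalize_eq_normalize_iff_associated.2 h
  · intro k hk
    apply hindepc
    refine ⟨∏ i, ((c i : ℚ) / c' i) ^ k i, ?_, ?_⟩
    · exact Finset.prod_ne_zero_iff.2 fun i _ => zpow_ne_zero _ (div_ne_zero (by simpa using hc i) (by simpa using hc' i))
    · let θ : ℤ[X] →+* RatFunc ℚ := (algebraMap (Polynomial ℚ) (RatFunc ℚ)).comp (mapRingHom (Int.castRingHom ℚ))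
      have hθ0 : ∀ P : ℤ[X], P ≠ 0 → θ P ≠ 0 := by
        intro P hP
        simp only [θ, RingHom.comp_apply, coe_mapRingHom]
        have : P.map (Int.castRingHom ℚ) ≠ 0 :=
          (Polynomial.map_ne_zero_iff Int.cast_injective).2 hP
        exact (map_ne_zero_iff _ (RatFunc.algebraMap_injective ℚ)).2 this
      have hq0 : ∀ j, θ (q j) ≠ 0 := fun j => hθ0 _ (hirr j).ne_zero
      have hθC : ∀ a : ℤ, θ (C a) = RatFunc.C (a : ℚ) := by
        intro a
        simp [θ]
      have hterm : ∀ i, θ (f i) / θ (g i) = RatFunc.C ((c i : ℚ) / c' i) * ∏ j, θ (q j) ^ ((u i j : ℤ) - w i j) := by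
        intro i
        rw [hu i, hw i]
        simp only [map_mul, map_prod, map_pow, hθC, map_div₀]
        rw [mul_div_mul_comm, ← Finset.prod_div_distrib]
        congr 1
        refine Finset.prod_congr rfl fun j _ => ?_
        rw [zpow_sub₀ (hq0 j)]; simp
      change ∏ i, (θ (f i) / θ (g i)) ^ k i = _
      simp only [hterm, mul_zpow, Finset.prod_mul_distrib, map_prod, map_zpow₀]
      convert mul_one _
      simp only [← Finset.prod_zpow, ← zpow_mul]
      rw [Finset.prod_comm]
      refine Finset.prod_eq_one fun j _ => ?_
      rw [← Finset.prod_const_one (s := Finset.univ (α := Fin m))]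
      have : ∏ i, θ (q j) ^ (((u i j : ℤ) - w i j) * k i) = θ (q j) ^ (∑ i, k i * ((u i j : ℤ) - w i j)) := by
        rw [zpow_sum (hq0 j)]; simp [mul_comm]
      rw [this, hk j]; simp

variable {m : ℕ} {f g : Fin m → ℤ[X]}

lemma Data.q_ne (D : Data m f g) (j : Fin D.s) : D.q j ≠ 0 := fun h => by
  have := D.deg_pos j; simp [h] at this

lemma Data.q_ev_ne (D : Data m f g) {F : Type*} [Field F] {α : F} (h : Good f g α) (j : Fin D.s) :
    ev α (D.q j) ≠ 0 := by
  intro h0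
  obtain ⟨i, ⟨P, hP⟩ | ⟨P, hP⟩⟩ := D.used j
  · exact (h i).1 (by rw [hP, map_mul, h0, zero_mul])
  · exact (h i).2 (by rw [hP, map_mul, h0, zero_mul])

lemma Data.val_eq (D : Data m f g) {F : Type*} [Field F] {α : F} (hq : ∀ j, ev α (D.q j) ≠ 0)
    (k : Fin m → ℤ) : val f g α k =
      (∏ i, ((D.c i : F) / D.c' i) ^ k i) * ∏ j, ev α (D.q j) ^ (D.e k j) := by
  have hterm : ∀ i, ev α (f i) / ev α (g i) =
      ((D.c i : F) / D.c' i) * ∏ j, ev α (D.q j) ^ ((D.u i j : ℤ) - D.w i j) := by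
    intro i
    rw [D.hf i, D.hg i]
    simp only [map_mul, map_prod, map_pow, ev_C]
    rw [mul_div_mul_comm, ← Finset.prod_div_distrib]
    congr 1
    refine Finset.prod_congr rfl fun j _ => ?_
    rw [zpow_sub₀ (hq j)]; simp
  simp only [val, hterm, mul_zpow, Finset.prod_mul_distrib]
  congr 1
  simp only [← Finset.prod_zpow, ← zpow_mul]
  rw [Finset.prod_comm]
  refine Finset.prod_congr rfl fun j _ => ?_
  rw [Data.e, zpow_sum (hq j)]
  simp [mul_comm]

lemma Data.e_ne (D : Data m f g) {k : Fin m → ℤ} (hk : k ≠ 0) : ∃ j, D.e k j ≠ 0 := by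
  by_contra h
  push Not at h
  exact hk (D.inj k h)

lemma Data.linIndep (D : Data m f g) (F : Type*) [Field F] [CharZero F] :
    LinearIndependent F (fun i : Fin m => fun j : Fin D.s => (((D.u i j : ℤ) - D.w i j : ℤ) : F)) := by
  have h0 : LinearIndependent ℤ (fun i : Fin m => fun j : Fin D.s => ((D.u i j : ℤ) - D.w i j : ℤ)) := by
    rw [Fintype.linearIndependent_iff]
    intro k hk
    have := D.inj k (fun j => by
      have := congrFun hk j
      simpa [Finset.sum_apply] using this)
    simp [this]
  have := (linearIndependent_algebraMap_comp_iff (R := ℤ) (S := F)).2 h0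
  exact this

lemma Data.bound (D : Data m f g) : ∃ C : ℕ, ∀ k : Fin m → ℤ, k ≠ 0 →
    ∃ j, D.e k j ≠ 0 ∧ (∀ i, |k i| ≤ C * |D.e k j|) ∧ ∀ l, |D.e k l| ≤ |D.e k j| := by
  have h1 := D.linIndep ℚ
  have h2 : Function.Injective (Fintype.linearCombination ℚ (fun i : Fin m => fun j : Fin D.s => (((D.u i j : ℤ) - D.w i j : ℤ) : ℚ))) := by
    exact h1.fintypeLinearCombination_injective
  obtain ⟨G, hG⟩ := LinearMap.exists_leftInverse_of_injective _ (LinearMap.ker_eq_bot.2 h2)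
  let S : ℚ := ∑ i, ∑ j, |G (Pi.single j 1) i|
  refine ⟨⌈S⌉₊, fun k hk => ?_⟩
  obtain ⟨j1, hj1⟩ := D.e_ne hk
  obtain ⟨j, -, hj⟩ := Finset.exists_max_image Finset.univ (fun j => |D.e k j|) ⟨j1, Finset.mem_univ _⟩
  refine ⟨j, ?_, ?_, fun l => hj l (Finset.mem_univ _)⟩
  · intro h
    have := hj j1 (Finset.mem_univ _)
    rw [h, abs_zero] at this
    exact hj1 (abs_nonpos_iff.1 this)
  · intro i
    have e1 : (fun i => (k i : ℚ)) = G (fun j => (D.e k j : ℚ)) := by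
      have := LinearMap.congr_fun hG (fun i => (k i : ℚ))
      simp only [LinearMap.comp_apply, LinearMap.id_apply] at this
      rw [← this]
      congr 1
      ext j
      simp [Fintype.linearCombination_apply, Data.e]
    have e2 : (k i : ℚ) = ∑ l, (D.e k l : ℚ) * G (Pi.single l 1) i := by
      have := congrFun e1 i
      rw [this, LinearMap.pi_apply_eq_sum_univ G]
      simp [Finset.sum_apply]
      refine Finset.sum_congr rfl fun l _ => ?_
      have : (fun j => if l = j then (1:ℚ) else 0) = Pi.single l 1 := by
        ext x
        simp [Pi.single_apply, eq_comm]
      rw [this]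
    have e3 : |(k i : ℚ)| ≤ S * |(D.e k j : ℚ)| := by
      rw [e2]
      refine (Finset.abs_sum_le_sum_abs _ _).trans ?_
      calc ∑ l, |(D.e k l : ℚ) * G (Pi.single l 1) i| ≤ ∑ l, |(D.e k j : ℚ)| * |G (Pi.single l 1) i| := by
            refine Finset.sum_le_sum fun l _ => ?_
            rw [abs_mul]
            exact mul_le_mul_of_nonneg_right (by exact_mod_cast hj l (Finset.mem_univ _)) (abs_nonneg _)
        _ = (∑ l, |G (Pi.single l 1) i|) * |(D.e k j : ℚ)| := by rw [← Finset.mul_sum, mul_comm]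
        _ ≤ S * |(D.e k j : ℚ)| := by
            gcongr
            exact Finset.single_le_sum (f := fun i => ∑ j, |G (Pi.single j 1) i|)
              (fun i _ => Finset.sum_nonneg fun j _ => abs_nonneg _) (Finset.mem_univ i)
    have e4 : |(k i : ℚ)| ≤ (⌈S⌉₊ : ℚ) * |(D.e k j : ℚ)| := e3.trans (by gcongr; exact Nat.le_ceil S)
    exact_mod_cast e4

end BMZ

end PartBase

section PartHeightA

open Polynomial

namespace BMZ
open Height AdmissibleAbsValues

section
variable {K : Type} [Field K] [NumberField K]

lemma finite_support_posLog (x : K) :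
    (Function.support fun v : nonarchAbsVal (K := K) => Real.posLog (v.val x)).Finite := by
  by_cases hx : x = 0
  · simp [hx]
  · refine (hasFiniteMulSupport hx).subset ?_
    intro v hv
    simp only [Function.mem_support, Function.mem_mulSupport] at *
    intro h; rw [h] at hv; simp at hv

lemma finsum_le_logHeight (x : K) :
    ∑ᶠ v : nonarchAbsVal (K := K), Real.posLog (v.val x) ≤ logHeight₁ x := by
  rw [Height.logHeight₁_eq]
  have : 0 ≤ (archAbsVal.map fun v : AbsoluteValue K ℝ ↦ Real.posLog (v x)).sum :=
    Multiset.sum_nonneg (by simp only [Multiset.mem_map]; rintro _ ⟨v, _, rfl⟩; exact Real.posLog_nonneg)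
  linarith

lemma compare (x y z : K) (A C C' : ℝ) (hC' : 0 ≤ C')
    (h1 : ∀ v ∈ archAbsVal (K := K), Real.posLog (v x) ≤ A + C * Real.posLog (v y))
    (h2 : ∀ v ∈ nonarchAbsVal (K := K), Real.posLog (v x) ≤ C * Real.posLog (v y) + C' * Real.posLog (v z)) :
    logHeight₁ x ≤ A * Module.finrank ℚ K + C * logHeight₁ y + C' * logHeight₁ z := by
  have e1 : (archAbsVal.map fun v : AbsoluteValue K ℝ ↦ Real.posLog (v x)).sum ≤
      A * Module.finrank ℚ K + C * (archAbsVal.map fun v : AbsoluteValue K ℝ ↦ Real.posLog (v y)).sum := by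
    calc _ ≤ (archAbsVal.map fun v : AbsoluteValue K ℝ ↦ (A + C * Real.posLog (v y))).sum :=
          Multiset.sum_map_le_sum_map _ _ h1
      _ = _ := by
          rw [Multiset.sum_map_add, Multiset.sum_map_mul_left]
          rw [← NumberField.totalWeight_eq_finrank K]
          simp [totalWeight, mul_comm]
  have e2 : ∑ᶠ v : nonarchAbsVal (K := K), Real.posLog (v.val x) ≤
      C * ∑ᶠ v : nonarchAbsVal (K := K), Real.posLog (v.val y) +
      C' * ∑ᶠ v : nonarchAbsVal (K := K), Real.posLog (v.val z) := by
    rw [mul_finsum, mul_finsum, ← finsum_add_distrib]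
    · refine finsum_le_finsum' (finite_support_posLog x) ?_ (fun v => h2 _ v.2)
      refine ((finite_support_posLog y).union (finite_support_posLog z)).subset ?_
      intro v hv
      simp only [Function.mem_support, Set.mem_union] at *
      by_contra h
      push Not at h
      simp [h.1, h.2] at hv
    · refine (finite_support_posLog y).subset ?_
      intro v hv
      simp only [Function.mem_support] at *
      exact fun h => hv (by simp [h])
    · refine (finite_support_posLog z).subset ?_
      intro v hv
      simp only [Function.mem_support] at *
      exact fun h => hv (by simp [h])
  have e3 := mul_le_mul_of_nonneg_left (finsum_le_logHeight z) hC'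
  rw [Height.logHeight₁_eq x, Height.logHeight₁_eq y]
  linarith

lemma arch_exists {v : AbsoluteValue K ℝ} (hv : v ∈ archAbsVal (K := K)) :
    ∃ φ : K →+* ℂ, ∀ x, v x = ‖φ x‖ := by
  have := NumberField.mem_multisetInfinitePlace.1 hv
  obtain ⟨φ, hφ⟩ := this
  exact ⟨φ, fun x => by rw [← hφ]; rfl⟩

lemma nonarch_int_le {v : AbsoluteValue K ℝ} (hv : v ∈ nonarchAbsVal (K := K)) (n : ℤ) : v (n : K) ≤ 1 := by
  exact (AdmissibleAbsValues.isNonarchimedean v hv).apply_intCast_le_one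

lemma logHeight_int (W : ℤ) (hW : W ≠ 0) :
    logHeight₁ (W : K) ≤ Real.log |(W:ℝ)| * Module.finrank ℚ K := by
  have := compare (K := K) (W : K) 0 0 (Real.log |(W:ℝ)|) 0 0 le_rfl ?_ ?_
  · simpa using this
  · intro v hv
    obtain ⟨φ, h⟩ := arch_exists hv
    simp only [h, map_intCast, Complex.norm_intCast]
    rw [Real.posLog_eq_log]
    · simp
    · rw [abs_abs]; exact_mod_cast Int.one_le_abs hW
  · intro v hv
    simp only [map_zero, zero_mul, add_zero]
    rw [Real.posLog_eq_zero_iff (v _) |>.2]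
    rw [abs_of_nonneg (v.nonneg _)]
    exact nonarch_int_le hv W

/-- per-place bounds: nonarchimedean -/
lemma nonarch_poly_le {v : AbsoluteValue K ℝ} (hv : v ∈ nonarchAbsVal (K := K)) (P : ℤ[X]) (α : K) :
    Real.posLog (v (ev α P)) ≤ P.natDegree * Real.posLog (v α) := by
  have key : v (ev α P) ≤ (max 1 (v α)) ^ P.natDegree := by
    rw [ev_apply, eval₂_eq_sum_range]
    obtain ⟨i, hi, hle⟩ := (AdmissibleAbsValues.isNonarchimedean v hv).finset_image_add_of_nonempty
      (fun i => (Int.castRingHom K) (P.coeff i) * α ^ i) (t := Finset.range (P.natDegree + 1)) ⟨0, by simp⟩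
    refine hle.trans ?_
    rw [map_mul, map_pow]
    calc _ ≤ 1 * (max 1 (v α)) ^ i := by
          gcongr
          · exact nonarch_int_le hv _
          · exact le_max_right _ _
      _ ≤ _ := by
          rw [one_mul]
          exact pow_le_pow_right₀ (le_max_left _ _) (by simp at hi; omega)
  rw [Real.posLog_eq_log_max_one (v.nonneg _), Real.posLog_eq_log_max_one (v.nonneg _), ← Real.log_pow]
  exact Real.log_le_log (by positivity) (max_le (one_le_pow₀ (le_max_left _ _)) key)

lemma nonarch_le_poly {v : AbsoluteValue K ℝ} (hv : v ∈ nonarchAbsVal (K := K)) (P : ℤ[X])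
    (hP : 0 < P.natDegree) (α : K) :
    Real.posLog (v α) ≤ Real.posLog (v (ev α P)) + Real.posLog (v ((P.leadingCoeff : K)⁻¹)) := by
  set a : K := (P.leadingCoeff : K) with ha
  have ha0 : a ≠ 0 := by
    rw [ha]; simp only [ne_eq, Int.cast_eq_zero, leadingCoeff_eq_zero]
    rintro rfl; simp at hP
  have hva : 0 < v a := v.pos ha0
  have hva1 : v a ≤ 1 := nonarch_int_le hv _
  by_cases h : v α * v a ≤ 1
  · have : Real.posLog (v α) ≤ Real.posLog (v (a⁻¹)) := by
      apply Real.posLog_le_posLog (v.nonneg _)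
      rw [map_inv₀]
      exact (le_inv_mul_iff₀ hva).2 (by linarith) |>.trans_eq (mul_one _)
    have := @Real.posLog_nonneg (v (ev α P))
    linarith
  · push Not at h
    have hα : 1 < v α := by nlinarith [v.nonneg α]
    have key : v (ev α P) = v a * v α ^ P.natDegree := by
      rw [ev_apply, eval₂_eq_sum_range, Finset.sum_range_succ]
      have : v ((Int.castRingHom K) (P.coeff P.natDegree) * α ^ P.natDegree) = v a * v α ^ P.natDegree := by
        rw [map_mul, map_pow]; rfl
      rw [← this]
      apply (AdmissibleAbsValues.isNonarchimedean v hv).add_eq_right_of_lt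
      rw [this]
      obtain ⟨i, hi, hle⟩ := (AdmissibleAbsValues.isNonarchimedean v hv).finset_image_add_of_nonempty
        (fun i => (Int.castRingHom K) (P.coeff i) * α ^ i) (t := Finset.range (P.natDegree)) ⟨0, by simpa using hP⟩
      refine hle.trans_lt ?_
      rw [map_mul, map_pow]
      calc _ ≤ 1 * v α ^ i := by
            gcongr
            exact nonarch_int_le hv _
        _ ≤ v α ^ (P.natDegree - 1) := by
            rw [one_mul]
            exact pow_le_pow_right₀ hα.le (by simp at hi; omega)
        _ < v α ^ (P.natDegree - 1) * (v α * v a) := by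
            have : 0 < v α ^ (P.natDegree - 1) := by positivity
            nlinarith
        _ = v a * (v α ^ (P.natDegree - 1) * v α) := by ring
        _ = _ := by rw [← pow_succ, Nat.sub_add_cancel hP]
    have h3 : v α ≤ v (ev α P) * v (a⁻¹) := by
      rw [key, map_inv₀]
      have : v a * v α ^ P.natDegree * (v a)⁻¹ = v α ^ P.natDegree := by field_simp
      rw [this]
      exact le_self_pow₀ hα.le hP.ne'
    refine (Real.posLog_le_posLog (v.nonneg _) h3).trans Real.posLog_mul

noncomputable def len (P : ℤ[X]) : ℝ := ∑ i ∈ Finset.range (P.natDegree + 1), |(P.coeff i : ℝ)|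

lemma len_nonneg (P : ℤ[X]) : 0 ≤ len P := Finset.sum_nonneg fun _ _ => abs_nonneg _

lemma complex_poly_le (P : ℤ[X]) (z : ℂ) : ‖ev z P‖ ≤ len P * (max 1 ‖z‖) ^ P.natDegree := by
  rw [ev_apply, eval₂_eq_sum_range, len, Finset.sum_mul]
  refine norm_sum_le_of_le _ fun i hi => ?_
  rw [norm_mul, norm_pow]
  have : ‖(Int.castRingHom ℂ) (P.coeff i)‖ = |(P.coeff i : ℝ)| := by simp
  rw [this]
  refine mul_le_mul_of_nonneg_left ?_ (abs_nonneg _)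
  calc ‖z‖ ^ i ≤ (max 1 ‖z‖) ^ i := by gcongr; exact le_max_right _ _
    _ ≤ _ := pow_le_pow_right₀ (le_max_left _ _) (by simp at hi; omega)

lemma complex_posLog_poly_le (P : ℤ[X]) (z : ℂ) :
    Real.posLog ‖ev z P‖ ≤ Real.log (1 + len P) + P.natDegree * Real.posLog ‖z‖ := by
  have h := complex_poly_le P z
  have hl := len_nonneg P
  rw [Real.posLog_eq_log_max_one (norm_nonneg _), Real.posLog_eq_log_max_one (norm_nonneg _), ← Real.log_pow,
    ← Real.log_mul (by positivity) (by positivity)]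
  have h1 : 1 ≤ (max 1 ‖z‖) ^ P.natDegree := one_le_pow₀ (le_max_left _ _)
  refine Real.log_le_log (by positivity) (max_le ?_ ?_)
  · nlinarith
  · nlinarith

lemma complex_le_poly (P : ℤ[X]) (hP : 0 < P.natDegree) (z : ℂ) :
    Real.posLog ‖z‖ ≤ Real.log (1 + len P) + Real.posLog ‖ev z P‖ := by
  have hl := len_nonneg P
  have key : ‖z‖ ≤ (1 + len P) * max 1 ‖ev z P‖ := by
    by_cases hz : ‖z‖ ≤ 1 + len P
    · have := le_max_left 1 ‖ev z P‖
      nlinarith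
    push Not at hz
    have hz1 : 1 ≤ ‖z‖ := by linarith
    have e : ev z P = ∑ i ∈ Finset.range P.natDegree, (P.coeff i : ℂ) * z ^ i + (P.leadingCoeff : ℂ) * z ^ P.natDegree := by
      rw [ev_apply, eval₂_eq_sum_range, Finset.sum_range_succ]; rfl
    have e1 : ‖∑ i ∈ Finset.range P.natDegree, (P.coeff i : ℂ) * z ^ i‖ ≤
        (∑ i ∈ Finset.range P.natDegree, |(P.coeff i : ℝ)|) * ‖z‖ ^ (P.natDegree - 1) := by
      rw [Finset.sum_mul]
      refine norm_sum_le_of_le _ fun i hi => ?_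
      rw [norm_mul, norm_pow, Complex.norm_intCast]
      refine mul_le_mul_of_nonneg_left ?_ (abs_nonneg _)
      exact pow_le_pow_right₀ hz1 (by simp at hi; omega)
    have e2 : (∑ i ∈ Finset.range P.natDegree, |(P.coeff i : ℝ)|) + |(P.leadingCoeff : ℝ)| = len P := by
      rw [len, Finset.sum_range_succ]; rfl
    have e3 : (1:ℝ) ≤ |(P.leadingCoeff : ℝ)| := by
      have : P.leadingCoeff ≠ 0 := by
        rw [Ne, leadingCoeff_eq_zero]; rintro rfl; simp at hP
      exact_mod_cast Int.one_le_abs this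
    have e4 : ‖(P.leadingCoeff : ℂ) * z ^ P.natDegree‖ = |(P.leadingCoeff : ℝ)| * (‖z‖ ^ (P.natDegree - 1) * ‖z‖) := by
      rw [norm_mul, norm_pow, Complex.norm_intCast, ← pow_succ, Nat.sub_add_cancel hP]
    have e5 : ‖(P.leadingCoeff : ℂ) * z ^ P.natDegree‖ ≤ ‖ev z P‖ + ‖∑ i ∈ Finset.range P.natDegree, (P.coeff i : ℂ) * z ^ i‖ := by
      have : (P.leadingCoeff : ℂ) * z ^ P.natDegree = ev z P - ∑ i ∈ Finset.range P.natDegree, (P.coeff i : ℂ) * z ^ i := by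
        rw [e]; ring
      rw [this]; exact norm_sub_le _ _
    set t := ‖z‖ ^ (P.natDegree - 1)
    have ht : 1 ≤ t := one_le_pow₀ hz1
    set S := ∑ i ∈ Finset.range P.natDegree, |(P.coeff i : ℝ)|
    have hS : 0 ≤ S := Finset.sum_nonneg fun _ _ => abs_nonneg _
    have e6 : ‖z‖ * t ≤ ‖ev z P‖ + S * t := by
      have : t * ‖z‖ ≤ |(P.leadingCoeff : ℝ)| * (t * ‖z‖) := le_mul_of_one_le_left (by positivity) e3
      linarith
    have e7 : ‖z‖ ≤ ‖ev z P‖ + S := by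
      have : (‖z‖ - S) * 1 ≤ (‖z‖ - S) * t := mul_le_mul_of_nonneg_left ht (by linarith)
      linarith
    have m1 := le_max_left 1 ‖ev z P‖
    have m2 := le_max_right 1 ‖ev z P‖
    nlinarith
  rw [Real.posLog_eq_log_max_one (norm_nonneg _), Real.posLog_eq_log_max_one (norm_nonneg _),
    ← Real.log_mul (by positivity) (by positivity)]
  refine Real.log_le_log (by positivity) (max_le ?_ key)
  have := le_max_left 1 ‖ev z P‖
  nlinarith

end

end BMZ

end PartHeightA

section PartHeightB

open Polynomial

namespace BMZ
open Height AdmissibleAbsValues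

variable {m : ℕ} {f g : Fin m → ℤ[X]}

lemma core (D : Data m f g) {K : Type} [Field K] [NumberField K] (C : ℕ) (k : Fin m → ℤ) (j0 : Fin D.s)
    (he : 0 < D.e k j0) (hk : ∀ i, |k i| ≤ C * |D.e k j0|) (hl : ∀ l, |D.e k l| ≤ |D.e k j0|)
    (v : AbsoluteValue K ℝ) (α : K) (hq : ∀ j, ev α (D.q j) ≠ 0) (hval : val f g α k = 1) (y : ℝ)
    (hc : ∀ i, |Real.log (v (D.c i : K))| ≤ y) (hc' : ∀ i, |Real.log (v (D.c' i : K))| ≤ y) (hy : 0 ≤ y)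
    (ht : v (ev α (D.q j0)) ≤ 1 → ∀ l, l ≠ j0 → Real.log (v (ev α (D.q l))) ≤ y ∧
      (- y ≤ Real.log (v (ev α (D.q j0))) ∨ - y ≤ Real.log (v (ev α (D.q l))))) :
    Real.posLog (v (ev α (D.q j0))⁻¹) ≤ (2 * m * C + D.s + 1) * y := by
  classical
  have ht0 : 0 < v (ev α (D.q j0)) := v.pos (hq j0)
  have hR : 0 ≤ (2 * m * C + D.s + 1) * y := by positivity
  rw [map_inv₀, Real.posLog, Real.log_inv]
  refine max_le hR ?_
  by_cases h1 : 1 < v (ev α (D.q j0))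
  · have := Real.log_pos h1
    linarith
  push Not at h1
  have ht := ht h1
  have hM : (0:ℝ) ≤ (2 * m * C + D.s) * y := by positivity
  by_cases h2 : - y ≤ Real.log (v (ev α (D.q j0)))
  · nlinarith
  have h3 : ∀ l, l ≠ j0 → |Real.log (v (ev α (D.q l)))| ≤ y := fun l hl => by
    obtain ⟨a, b⟩ := ht l hl
    rw [abs_le]; exact ⟨b.resolve_left h2, a⟩
  have hcK : ∀ i, v (D.c i : K) ≠ 0 := fun i => by simpa using D.c_ne i
  have hcK' : ∀ i, v (D.c' i : K) ≠ 0 := fun i => by simpa using D.c'_ne i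
  have id1 : (∑ i, (k i : ℝ) * (Real.log (v (D.c i : K)) - Real.log (v (D.c' i : K)))) +
      ∑ j, (D.e k j : ℝ) * Real.log (v (ev α (D.q j))) = 0 := by
    have := congrArg (fun x => Real.log (v x)) (D.val_eq hq k)
    simp only [hval, map_one, Real.log_one, map_mul, map_prod, map_zpow₀, map_div₀] at this
    rw [Real.log_mul, Real.log_prod, Real.log_prod] at this
    · rw [this]
      congr 1
      · refine Finset.sum_congr rfl fun i _ => ?_
        rw [Real.log_zpow, Real.log_div (hcK i) (hcK' i)]
      · refine Finset.sum_congr rfl fun i _ => ?_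
        rw [Real.log_zpow]
    · exact fun j _ => zpow_ne_zero _ (by simpa using hq j)
    · exact fun j _ => zpow_ne_zero _ (div_ne_zero (hcK j) (hcK' j))
    · exact Finset.prod_ne_zero_iff.2 fun j _ => zpow_ne_zero _ (div_ne_zero (hcK j) (hcK' j))
    · exact Finset.prod_ne_zero_iff.2 fun j _ => zpow_ne_zero _ (by simpa using hq j)
  rw [← Finset.add_sum_erase _ _ (Finset.mem_univ j0)] at id1
  set E : ℝ := (D.e k j0 : ℝ) with hE
  have hEpos : 0 < E := Int.cast_pos.2 he
  have absE : |(D.e k j0 : ℝ)| = E := abs_of_pos hEpos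
  have b1 : |∑ i, (k i : ℝ) * (Real.log (v (D.c i : K)) - Real.log (v (D.c' i : K)))| ≤ (m : ℝ) * ((C * E) * (2 * y)) := by
    refine (Finset.abs_sum_le_sum_abs _ _).trans ?_
    refine (Finset.sum_le_card_nsmul _ _ ((C * E) * (2 * y)) fun i _ => ?_).trans_eq (by simp)
    rw [abs_mul]
    have e1 : |(k i : ℝ)| ≤ C * E := by rw [← absE]; exact_mod_cast hk i
    have e2 : |Real.log (v (D.c i : K)) - Real.log (v (D.c' i : K))| ≤ 2 * y := by
      refine (abs_sub _ _).trans ?_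
      linarith [hc i, hc' i]
    gcongr
  have b2 : |∑ j ∈ Finset.univ.erase j0, (D.e k j : ℝ) * Real.log (v (ev α (D.q j)))| ≤ (D.s : ℝ) * (E * y) := by
    refine (Finset.abs_sum_le_sum_abs _ _).trans ?_
    refine (Finset.sum_le_card_nsmul _ _ (E * y) fun i hi => ?_).trans ?_
    · rw [abs_mul]
      have e1 : |(D.e k i : ℝ)| ≤ E := by rw [← absE]; exact_mod_cast hl i
      have := h3 i (Finset.ne_of_mem_erase hi)
      gcongr
    · rw [nsmul_eq_mul]
      refine mul_le_mul_of_nonneg_right ?_ (by positivity)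
      have := Finset.card_le_univ (Finset.univ.erase j0)
      simp only [Fintype.card_fin] at this
      exact_mod_cast this
  have b3 : E * (- Real.log (v (ev α (D.q j0)))) ≤ E * ((2 * m * C + D.s) * y) := by
    have := abs_le.1 b1
    have := abs_le.1 b2
    nlinarith
  have := le_of_mul_le_mul_left b3 hEpos
  linarith

end BMZ

end PartHeightB

section PartHeightC

open Polynomial

namespace BMZ
open Height AdmissibleAbsValues

variable {m : ℕ} {f g : Fin m → ℤ[X]}

lemma nonarch_dvd {K : Type} [Field K] [NumberField K] {v : AbsoluteValue K ℝ}
    (hv : v ∈ nonarchAbsVal (K := K)) {b W : ℤ} (hW : W ≠ 0) (hb : b ∣ W) :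
    -Real.posLog (v (W : K)⁻¹) ≤ Real.log (v (b : K)) ∧ |Real.log (v (b : K))| ≤ Real.posLog (v (W : K)⁻¹) ∧
      Real.posLog (v (b : K)⁻¹) ≤ Real.posLog (v (W : K)⁻¹) := by
  obtain ⟨c, rfl⟩ := hb
  have hb0 : (b : K) ≠ 0 := by
    simp only [ne_eq, Int.cast_eq_zero]; rintro rfl; simp at hW
  have hc0 : (c : K) ≠ 0 := by
    simp only [ne_eq, Int.cast_eq_zero]; rintro rfl; simp at hW
  have h1 : v (b : K)⁻¹ ≤ v ((b * c : ℤ) : K)⁻¹ := by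
    have : (b : K)⁻¹ = (c : K) * ((b * c : ℤ) : K)⁻¹ := by push_cast; field_simp
    rw [this, map_mul]
    exact mul_le_of_le_one_left (v.nonneg _) (nonarch_int_le hv c)
  have h2 := Real.posLog_le_posLog (v.nonneg _) h1
  have h3 : Real.log (v (b : K)) ≤ 0 := Real.log_nonpos (v.nonneg _) (nonarch_int_le hv b)
  have h4 : - Real.log (v (b : K)) ≤ Real.posLog (v (b : K)⁻¹) := by
    rw [map_inv₀, Real.posLog, Real.log_inv]; exact le_max_right _ _
  refine ⟨by linarith, ?_, h2⟩
  rw [abs_of_nonpos h3]; linarith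

lemma posLog_exp {x y : ℝ} (hx : 0 ≤ x) (h : Real.posLog x ≤ y) : x ≤ Real.exp y := by
  rcases hx.eq_or_lt with rfl | hx
  · positivity
  · rw [← Real.log_le_iff_le_exp hx]
    exact (le_max_right _ _).trans h

lemma log_le_posLog (x : ℝ) : Real.log x ≤ Real.posLog x := le_max_right _ _

theorem heightA (D : Data m f g) : ∃ B : ℝ, 0 ≤ B ∧ ∀ (K : Type) [Field K] [NumberField K] (α : K),
    Good f g α → ∀ k : Fin m → ℤ, k ≠ 0 → val f g α k = 1 → logHeight₁ α ≤ B * Module.finrank ℚ K := by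
  classical
  obtain ⟨C0, hC0⟩ := D.bound
  have hbez : ∀ j l, ∃ R : ℤ, R ≠ 0 ∧ ∃ A B : ℤ[X], j ≠ l → A * D.q j + B * D.q l = C R := by
    intro j l
    by_cases h : j = l
    · exact ⟨1, one_ne_zero, 0, 0, fun h' => absurd h h'⟩
    · obtain ⟨R, h1, A, B, h2⟩ := D.bez j l h
      exact ⟨R, h1, A, B, fun _ => h2⟩
  choose R hR A B hAB using hbez
  obtain ⟨W, hW, hWq, hWR, hWc, hWc'⟩ : ∃ W : ℤ, W ≠ 0 ∧ (∀ j, (D.q j).leadingCoeff ∣ W) ∧ (∀ j l, R j l ∣ W) ∧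
      (∀ i, D.c i ∣ W) ∧ (∀ i, D.c' i ∣ W) := by
    refine ⟨(∏ j, (D.q j).leadingCoeff) * (∏ j, ∏ l, R j l) * (∏ i, D.c i) * ∏ i, D.c' i, ?_, ?_, ?_, ?_, ?_⟩
    · refine mul_ne_zero (mul_ne_zero (mul_ne_zero ?_ ?_) ?_) ?_
      · exact Finset.prod_ne_zero_iff.2 fun j _ => leadingCoeff_ne_zero.2 (D.q_ne j)
      · exact Finset.prod_ne_zero_iff.2 fun j _ => Finset.prod_ne_zero_iff.2 fun l _ => hR j l
      · exact Finset.prod_ne_zero_iff.2 fun j _ => D.c_ne j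
      · exact Finset.prod_ne_zero_iff.2 fun j _ => D.c'_ne j
    · intro j
      exact (((Finset.dvd_prod_of_mem _ (Finset.mem_univ j)).mul_right _).mul_right _).mul_right _
    · intro j l
      exact ((((Finset.dvd_prod_of_mem _ (Finset.mem_univ l)).trans (Finset.dvd_prod_of_mem (fun j => ∏ l, R j l) (Finset.mem_univ j))).mul_left _).mul_right _).mul_right _
    · intro j
      exact ((Finset.dvd_prod_of_mem _ (Finset.mem_univ j)).mul_left _).mul_right _
    · intro j
      exact (Finset.dvd_prod_of_mem _ (Finset.mem_univ j)).mul_left _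
  let ι := Fin D.s ⊕ ((Fin D.s × Fin D.s) ⊕ (Fin D.s × Fin D.s))
  let P : ι → ℤ[X] := Sum.elim D.q (Sum.elim (fun x => A x.1 x.2) (fun x => B x.1 x.2))
  obtain ⟨N, hN⟩ : ∃ N : ℕ, ∀ i, (P i).natDegree ≤ N := by
    obtain ⟨N, hN⟩ := (Set.finite_range fun i => (P i).natDegree).bddAbove
    exact ⟨N, fun i => hN ⟨i, rfl⟩⟩
  obtain ⟨Λ, hΛ⟩ : ∃ Λ : ℝ, ∀ i, Real.log (1 + len (P i)) ≤ Λ := by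
    obtain ⟨N, hN⟩ := (Set.finite_range fun i => Real.log (1 + len (P i))).bddAbove
    exact ⟨N, fun i => hN ⟨i, rfl⟩⟩
  by_cases hs : Nonempty (Fin D.s)
  swap
  · refine ⟨0, le_rfl, fun K _ _ α _ k hk _ => ?_⟩
    obtain ⟨j, _⟩ := D.e_ne hk
    exact absurd ⟨j⟩ hs
  have hΛ0 : 0 ≤ Λ := by
    obtain ⟨j⟩ := hs
    refine le_trans ?_ (hΛ (Sum.inl j))
    exact Real.log_nonneg (by have := len_nonneg (P (Sum.inl j)); linarith)
  set w0 : ℝ := Real.log |(W : ℝ)| with hw0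
  have hw0p : 0 ≤ w0 := Real.log_nonneg (by exact_mod_cast Int.one_le_abs hW)
  set Y : ℝ := (N + 1) * Λ + Real.log 2 + w0 with hY
  have hlog2 : 0 < Real.log 2 := Real.log_pos (by norm_num)
  have hYp : 0 ≤ Y := by positivity
  set M : ℝ := 2 * m * C0 + D.s + 1 with hM
  have hMp : 0 ≤ M := by positivity
  refine ⟨Λ + (M * Y + M * (N + 1) * w0) + w0, by positivity, ?_⟩
  intro K _ _ α hα k hk hval
  have hq := fun j => D.q_ev_ne hα j
  -- wlog
  obtain ⟨k, j0, he, hk, hl, hval⟩ : ∃ (k : Fin m → ℤ) (j0 : Fin D.s), 0 < D.e k j0 ∧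
      (∀ i, |k i| ≤ C0 * |D.e k j0|) ∧ (∀ l, |D.e k l| ≤ |D.e k j0|) ∧ val f g α k = 1 := by
    obtain ⟨j0, h1, h2, h3⟩ := hC0 k hk
    rcases lt_or_gt_of_ne h1 with h | h
    · have hneg : ∀ j, D.e (-k) j = - D.e k j := fun j => by simp [Data.e]
      refine ⟨-k, j0, by rw [hneg]; omega, ?_, ?_, ?_⟩
      · intro i; rw [hneg, abs_neg]; simpa using h2 i
      · intro l; rw [hneg, hneg, abs_neg, abs_neg]; exact h3 l
      · have : val f g α (-k) = (val f g α k)⁻¹ := by simp [val]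
        rw [this, hval, inv_one]
    · exact ⟨k, j0, h, h2, h3, hval⟩
  have hR' : ∀ l, l ≠ j0 → ((R j0 l : ℤ) : K) = ev α (A j0 l) * ev α (D.q j0) + ev α (B j0 l) * ev α (D.q l) := by
    intro l hl
    rw [← map_mul, ← map_mul, ← map_add, hAB j0 l hl.symm, ev_C]
  -- nonarch
  have hna : ∀ v ∈ nonarchAbsVal (K := K), Real.posLog (v (ev α (D.q j0))⁻¹) ≤
      M * ((N + 1) * Real.posLog (v (W : K)⁻¹)) := by
    intro v hv
    set w := Real.posLog (v (W : K)⁻¹) with hw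
    have hwp : 0 ≤ w := Real.posLog_nonneg
    have hN1 : w ≤ (N + 1) * w := by nlinarith [show (0:ℝ) ≤ N from Nat.cast_nonneg N]
    refine core D C0 k j0 he hk hl v α hq hval _ (fun i => (nonarch_dvd hv hW (hWc i)).2.1.trans hN1)
      (fun i => (nonarch_dvd hv hW (hWc' i)).2.1.trans hN1) (by positivity) ?_
    intro ht
    have hα1 : Real.posLog (v α) ≤ w := by
      have h1 := nonarch_le_poly hv (D.q j0) (D.deg_pos j0) α
      have h2 := (nonarch_dvd hv hW (hWq j0)).2.2
      have h3 : Real.posLog (v (ev α (D.q j0))) = 0 := by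
        rw [Real.posLog_eq_zero_iff, abs_of_nonneg (v.nonneg _)]; exact ht
      linarith
    have hP : ∀ i, Real.posLog (v (ev α (P i))) ≤ N * w := fun i => by
      refine (nonarch_poly_le hv (P i) α).trans ?_
      have : ((P i).natDegree : ℝ) ≤ N := by exact_mod_cast hN i
      have := @Real.posLog_nonneg (v α)
      gcongr
    intro l hl
    refine ⟨(log_le_posLog _).trans ((hP (Sum.inl l)).trans (by nlinarith)), ?_⟩
    by_contra hcon
    push Not at hcon
    obtain ⟨g1, g2⟩ := hcon
    rw [Real.log_lt_iff_lt_exp (v.pos (hq _))] at g1 g2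
    have r1 : Real.exp (-w) ≤ v (R j0 l : K) := by
      have := (nonarch_dvd hv hW (hWR j0 l)).1
      rwa [Real.le_log_iff_exp_le (v.pos (by simpa using hR j0 l))] at this
    have key : ∀ x y : K, Real.posLog (v x) ≤ N * w → v y < Real.exp (-((N + 1) * w)) → v (x * y) < Real.exp (-w) := by
      intro x y hx hy
      rw [map_mul]
      calc v x * v y ≤ Real.exp (N * w) * v y := by gcongr; exact posLog_exp (v.nonneg _) hx
        _ < Real.exp (N * w) * Real.exp (-((N + 1) * w)) := by gcongr
        _ = Real.exp (-w) := by rw [← Real.exp_add]; ring_nf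
    have r2 := key _ _ (hP (Sum.inr (Sum.inl (j0, l)))) g1
    have r3 := key _ _ (hP (Sum.inr (Sum.inr (j0, l)))) g2
    have r4 := AdmissibleAbsValues.isNonarchimedean v hv (ev α (A j0 l) * ev α (D.q j0)) (ev α (B j0 l) * ev α (D.q l))
    rw [← hR' l hl] at r4
    have := r4.trans_lt (max_lt r2 r3)
    linarith
  have har : ∀ v ∈ archAbsVal (K := K), Real.posLog (v (ev α (D.q j0))⁻¹) ≤ M * Y := by
    intro v hv
    obtain ⟨φ, hφ⟩ := arch_exists hv
    have hintegral : ∀ b : ℤ, b ∣ W → b ≠ 0 → |Real.log (v (b : K))| ≤ Y := by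
      intro b hb hb0
      rw [hφ, map_intCast, Complex.norm_intCast]
      have e1 : (1:ℝ) ≤ |(b : ℝ)| := by exact_mod_cast Int.one_le_abs hb0
      rw [abs_of_nonneg (Real.log_nonneg e1)]
      have e2 : Real.log |(b:ℝ)| ≤ w0 := by
        apply Real.log_le_log (by linarith)
        have : |b| ≤ |W| := Int.le_of_dvd (abs_pos.2 hW) ((abs_dvd_abs _ _).2 hb)
        exact_mod_cast this
      have : 0 ≤ (N + 1) * Λ := by positivity
      linarith
    refine core D C0 k j0 he hk hl v α hq hval _ (fun i => hintegral _ (hWc i) (D.c_ne i))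
      (fun i => hintegral _ (hWc' i) (D.c'_ne i)) hYp ?_
    intro ht
    have hev : ∀ p : ℤ[X], v (ev α p) = ‖ev (φ α) p‖ := fun p => by rw [hφ, ev_map]
    have hα1 : Real.posLog ‖φ α‖ ≤ Λ := by
      have h1 := complex_le_poly (D.q j0) (D.deg_pos j0) (φ α)
      have h2 := hΛ (Sum.inl j0)
      simp only [P, Sum.elim_inl] at h2
      have h3 : Real.posLog ‖ev (φ α) (D.q j0)‖ = 0 := by
        rw [← hev, Real.posLog_eq_zero_iff, abs_of_nonneg (v.nonneg _)]; exact ht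
      linarith
    have hP : ∀ i, Real.posLog (v (ev α (P i))) ≤ (N + 1) * Λ := fun i => by
      rw [hev]
      refine (complex_posLog_poly_le (P i) (φ α)).trans ?_
      have h1 : ((P i).natDegree : ℝ) ≤ N := by exact_mod_cast hN i
      have h2 := @Real.posLog_nonneg ‖φ α‖
      have h3 : ((P i).natDegree : ℝ) * Real.posLog ‖φ α‖ ≤ N * Λ := by gcongr
      linarith [hΛ i]
    intro l hl
    refine ⟨(log_le_posLog _).trans ((hP (Sum.inl l)).trans (by linarith)), ?_⟩
    by_contra hcon
    push Not at hcon
    obtain ⟨g1, g2⟩ := hcon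
    rw [Real.log_lt_iff_lt_exp (v.pos (hq _))] at g1 g2
    have r1 : 1 ≤ v (R j0 l : K) := by
      rw [hφ, map_intCast, Complex.norm_intCast]
      exact_mod_cast Int.one_le_abs (hR j0 l)
    have key : ∀ x y : K, Real.posLog (v x) ≤ (N + 1) * Λ → v y < Real.exp (-Y) → v (x * y) < 1 / 2 := by
      intro x y hx hy
      rw [map_mul]
      calc v x * v y ≤ Real.exp ((N + 1) * Λ) * v y := by gcongr; exact posLog_exp (v.nonneg _) hx
        _ < Real.exp ((N + 1) * Λ) * Real.exp (-Y) := by gcongr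
        _ = Real.exp (- Real.log 2 - w0) := by rw [← Real.exp_add, hY]; ring_nf
        _ ≤ Real.exp (- Real.log 2) := by gcongr; linarith
        _ = 1 / 2 := by rw [Real.exp_neg, Real.exp_log (by norm_num)]; norm_num
    have r2 := key _ _ (hP (Sum.inr (Sum.inl (j0, l)))) g1
    have r3 := key _ _ (hP (Sum.inr (Sum.inr (j0, l)))) g2
    have r4 := v.add_le (ev α (A j0 l) * ev α (D.q j0)) (ev α (B j0 l) * ev α (D.q l))
    rw [← hR' l hl] at r4
    simp only [P, Sum.elim_inl, Sum.elim_inr] at r2 r3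
    linarith
  have hWh : logHeight₁ (W : K)⁻¹ ≤ w0 * Module.finrank ℚ K := by
    rw [logHeight₁_inv]; exact logHeight_int W hW
  have c1 := compare (K := K) (ev α (D.q j0))⁻¹ 0 (W : K)⁻¹ (M * Y) 0 (M * (N + 1)) (by positivity)
    (fun v hv => by simpa using har v hv) (fun v hv => by simpa [mul_assoc] using hna v hv)
  rw [logHeight₁_inv] at c1
  have c2 := compare (K := K) α (ev α (D.q j0)) (W : K)⁻¹ Λ 1 1 zero_le_one (fun v hv => by
      obtain ⟨φ, hφ⟩ := arch_exists hv
      rw [hφ, hφ, ev_map, one_mul]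
      refine (complex_le_poly (D.q j0) (D.deg_pos j0) (φ α)).trans ?_
      have h2 := hΛ (Sum.inl j0)
      simp only [P, Sum.elim_inl] at h2
      linarith) (fun v hv => by
      rw [one_mul, one_mul]
      refine (nonarch_le_poly hv (D.q j0) (D.deg_pos j0) α).trans ?_
      have h2 := (nonarch_dvd hv hW (hWq j0)).2.2
      linarith)
  have c3 : M * (N + 1) * logHeight₁ (W : K)⁻¹ ≤ M * (N + 1) * (w0 * Module.finrank ℚ K) :=
    mul_le_mul_of_nonneg_left hWh (by positivity)
  linarith

end BMZ

end PartHeightC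

section PartKron

open Polynomial

namespace BMZ
open Height AdmissibleAbsValues

lemma heightPoly {K : Type} [Field K] [NumberField K] (P : ℤ[X]) (α : K) :
    logHeight₁ (ev α P) ≤ Real.log (1 + len P) * Module.finrank ℚ K + P.natDegree * logHeight₁ α := by
  have := compare (K := K) (ev α P) α 0 (Real.log (1 + len P)) P.natDegree 0 le_rfl (fun v hv => by
      obtain ⟨φ, hφ⟩ := arch_exists hv
      rw [hφ, hφ, ev_map]
      exact complex_posLog_poly_le P (φ α)) (fun v hv => by
      simpa using nonarch_poly_le hv P α)
  simpa using this

lemma kron_sets {ι : Type*} [Fintype ι] (x : ι → ℂ) (hx : ∀ i, x i ≠ 0) (p : ℕ)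
    (h : ∀ n, 1 ≤ n → n ≤ 2 * Fintype.card ι + 1 → ∑ i, x i ^ (p * n) = ∑ i, x i ^ n) (i : ι) :
    ∃ j, x i ^ p = x j := by
  classical
  by_contra hcon
  push Not at hcon
  set R := Finset.univ.image x
  set Rp := Finset.univ.image (fun i => x i ^ p)
  set T : ℂ[X] := X * ((∏ r ∈ R, (X - C r)) * ∏ s ∈ Rp.erase (x i ^ p), (X - C s)) with hT
  have hdeg : T.natDegree ≤ 2 * Fintype.card ι + 1 := by
    rw [hT]
    refine natDegree_mul_le.trans ?_
    have h1 := natDegree_mul_le (p := ∏ r ∈ R, (X - C r)) (q := ∏ s ∈ Rp.erase (x i ^ p), (X - C s))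
    rw [natDegree_finsetProd_X_sub_C_eq_card, natDegree_finsetProd_X_sub_C_eq_card] at h1
    have h2 : R.card ≤ Fintype.card ι := Finset.card_image_le
    have h3 : (Rp.erase (x i ^ p)).card ≤ Fintype.card ι := (Finset.card_le_card (Finset.erase_subset _ _)).trans Finset.card_image_le
    have h4 : (X : ℂ[X]).natDegree ≤ 1 := natDegree_X_le
    omega
  have hT0 : T.coeff 0 = 0 := by rw [hT]; simp
  have hsum : ∀ z : ℂ, T.eval z = ∑ n ∈ Finset.range (2 * Fintype.card ι + 2), T.coeff n * z ^ n := fun z =>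
    eval_eq_sum_range' (by omega) z
  have e1 : ∑ j, T.eval (x j ^ p) = ∑ j, T.eval (x j) := by
    simp only [hsum]
    rw [Finset.sum_comm, Finset.sum_comm (s := Finset.univ)]
    refine Finset.sum_congr rfl fun n hn => ?_
    rw [← Finset.mul_sum, ← Finset.mul_sum]
    rcases Nat.eq_zero_or_pos n with rfl | h0
    · simp [hT0]
    · rw [← h n h0 (by simp at hn; omega)]
      simp only [pow_mul]
  have e2 : ∑ j, T.eval (x j) = 0 := by
    refine Finset.sum_eq_zero fun j _ => ?_
    have : (∏ r ∈ R, (X - C r)).eval (x j) = 0 := by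
      rw [eval_prod]
      exact Finset.prod_eq_zero (i := x j) (by simp [R]) (by simp)
    rw [hT, eval_mul, eval_mul, this]; ring
  have e3 : T.eval (x i ^ p) ≠ 0 := by
    rw [hT, eval_mul, eval_mul, eval_X, eval_prod, eval_prod]
    refine mul_ne_zero (pow_ne_zero _ (hx i)) (mul_ne_zero ?_ ?_)
    · refine Finset.prod_ne_zero_iff.2 fun r hr => ?_
      simp only [R, Finset.mem_image, Finset.mem_univ, true_and] at hr
      obtain ⟨j, rfl⟩ := hr
      simpa [sub_eq_zero] using hcon j
    · refine Finset.prod_ne_zero_iff.2 fun r hr => ?_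
      have := Finset.ne_of_mem_erase hr
      simpa [sub_eq_zero] using this.symm
  have e4 : ∑ j, T.eval (x j ^ p) = (Finset.univ.filter fun j => x j ^ p = x i ^ p).card * T.eval (x i ^ p) := by
    rw [← Finset.sum_filter_add_sum_filter_not Finset.univ (fun j => x j ^ p = x i ^ p)]
    rw [Finset.sum_congr rfl (g := fun _ => T.eval (x i ^ p)) (by
      intro j hj
      rw [(Finset.mem_filter.1 hj).2])]
    rw [Finset.sum_const, nsmul_eq_mul]
    rw [Finset.sum_eq_zero (s := Finset.univ.filter fun j => ¬ x j ^ p = x i ^ p), add_zero]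
    intro j hj
    have hj := (Finset.mem_filter.1 hj).2
    have : (∏ s ∈ Rp.erase (x i ^ p), (X - C s)).eval (x j ^ p) = 0 := by
      rw [eval_prod]
      exact Finset.prod_eq_zero (i := x j ^ p) (by simp [Rp, hj]) (by simp)
    rw [hT, eval_mul, eval_mul, this]; ring
  rw [e1, e2] at e4
  have : (Finset.univ.filter fun j => x j ^ p = x i ^ p).card ≠ 0 := by
    rw [Finset.card_ne_zero]; exact ⟨i, by simp⟩
  exact (mul_ne_zero (by exact_mod_cast this) e3) e4.symm

lemma pow_eq_one_of_closed {ι : Type*} [Finite ι] (x : ι → ℂ) (hx : ∀ i, x i ≠ 0) (p : ℕ) (hp : 1 < p)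
    (h : ∀ i, ∃ j, x i ^ p = x j) (i : ι) : ∃ w, 0 < w ∧ x i ^ w = 1 := by
  have h1 : ∀ n : ℕ, ∃ j, x i ^ (p ^ n) = x j := by
    intro n
    induction n with
    | zero => exact ⟨i, by simp⟩
    | succ n ih =>
      obtain ⟨j, hj⟩ := ih
      obtain ⟨l, hl⟩ := h j
      exact ⟨l, by rw [pow_succ, pow_mul, hj, hl]⟩
  choose s hs using h1
  obtain ⟨a, b, hab, hsab⟩ := Finite.exists_ne_map_eq_of_infinite s
  have key : ∀ a b, a < b → s a = s b → ∃ w, 0 < w ∧ x i ^ w = 1 := by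
    intro a b hab hs'
    have h2 : x i ^ (p ^ a) = x i ^ (p ^ b) := by rw [hs, hs, hs']
    have h3 : p ^ a < p ^ b := Nat.pow_lt_pow_right hp hab
    refine ⟨p ^ b - p ^ a, by omega, ?_⟩
    have h4 : x i ^ (p ^ b - p ^ a) * x i ^ (p ^ a) = 1 * x i ^ (p ^ a) := by
      rw [← pow_add, Nat.sub_add_cancel h3.le, one_mul, h2]
    exact mul_right_cancel₀ (pow_ne_zero _ (hx i)) h4
  rcases lt_or_gt_of_ne hab with h | h
  · exact key a b h hsab
  · exact key b a h hsab.symm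

lemma totient_bound (n : ℕ) : n ≤ 2 * n.totient ^ 2 ∧ (Odd n → n ≤ n.totient ^ 2) := by
  induction n using Nat.recOnPosPrimePosCoprime with
  | zero => simp
  | one => simp
  | prime_pow p n hp hn =>
    rw [Nat.totient_prime_pow hp hn]
    obtain ⟨k, rfl⟩ : ∃ k, n = k + 1 := ⟨n - 1, by omega⟩
    simp only [Nat.add_sub_cancel]
    have hpk : 1 ≤ p ^ k := Nat.one_le_pow _ _ hp.pos
    have h3 : 3 ≤ p → p ^ (k+1) ≤ (p ^ k * (p - 1)) ^ 2 := by
      intro h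
      obtain ⟨r, rfl⟩ : ∃ r, p = r + 1 := ⟨p - 1, by omega⟩
      simp only [Nat.add_sub_cancel]
      have : r + 1 ≤ r ^ 2 := by nlinarith
      calc (r+1)^(k+1) = (r+1)^k * (r+1) := pow_succ _ _
        _ ≤ ((r+1)^k * (r+1)^k) * r^2 := Nat.mul_le_mul (by nlinarith) this
        _ = _ := by ring
    rcases Nat.lt_or_ge p 3 with h | h
    · have : p = 2 := by have := hp.two_le; omega
      subst this
      constructor
      · norm_num
        calc 2 ^ (k+1) = 2 * (2 ^ k * 1) := by ring
          _ ≤ 2 * (2 ^ k * 2 ^ k) := by gcongr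
          _ = _ := by ring
      · intro ho
        exact absurd ho (by simp [Nat.even_pow])
    · exact ⟨(h3 h).trans (by omega), fun _ => h3 h⟩
  | coprime a b ha hb hab iha ihb =>
    rw [Nat.totient_mul hab]
    constructor
    · by_cases ho : Odd a
      · calc a * b ≤ a.totient ^ 2 * (2 * b.totient ^ 2) := Nat.mul_le_mul (iha.2 ho) ihb.1
          _ = _ := by ring
      · have hob : Odd b := by
          by_contra hb'
          rw [Nat.not_odd_iff_even] at ho hb'
          have := Nat.dvd_gcd ho.two_dvd hb'.two_dvd
          rw [hab] at this; omega
        calc a * b ≤ (2 * a.totient ^ 2) * (b.totient ^ 2) := Nat.mul_le_mul iha.1 (ihb.2 hob)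
          _ = _ := by ring
    · intro ho
      rw [Nat.odd_mul] at ho
      calc a * b ≤ (a.totient ^ 2) * (b.totient ^ 2) := Nat.mul_le_mul (iha.2 ho.1) (ihb.2 ho.2)
          _ = _ := by ring

lemma trace_congr {K : Type} [Field K] [NumberField K] (y : NumberField.RingOfIntegers K) (p : ℕ) [Fact p.Prime] :
    (p : ℤ) ∣ Algebra.trace ℤ (NumberField.RingOfIntegers K) (y ^ p) - Algebra.trace ℤ (NumberField.RingOfIntegers K) y := by
  classical
  have b := NumberField.RingOfIntegers.basis K
  rw [← ZMod.intCast_eq_intCast_iff_dvd_sub, eq_comm]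
  rw [Algebra.trace_eq_matrix_trace b, Algebra.trace_eq_matrix_trace b, map_pow]
  set M := Algebra.leftMulMatrix b y
  have e : ∀ N : Matrix (Module.Free.ChooseBasisIndex ℤ (NumberField.RingOfIntegers K)) (Module.Free.ChooseBasisIndex ℤ (NumberField.RingOfIntegers K)) ℤ, ((N.trace : ℤ) : ZMod p) = (N.map (Int.castRingHom (ZMod p))).trace := by
    intro N; simp [Matrix.trace]
  rw [e, e]
  have : (M ^ p).map (Int.castRingHom (ZMod p)) = (M.map (Int.castRingHom (ZMod p))) ^ p := by
    exact map_pow (Int.castRingHom (ZMod p)).mapMatrix M p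
  rw [this, ZMod.trace_pow_card, ZMod.pow_card]

lemma norm_le_height {K : Type} [Field K] [NumberField K] (φ : K →+* ℂ) (y : K) :
    Real.posLog ‖φ y‖ ≤ logHeight₁ y := by
  rw [Height.logHeight₁_eq]
  have h1 : 0 ≤ ∑ᶠ v : nonarchAbsVal (K := K), Real.posLog (v.val y) := finsum_nonneg fun v => Real.posLog_nonneg
  have h2 : (NumberField.InfinitePlace.mk φ).val ∈ archAbsVal (K := K) :=
    NumberField.mem_multisetInfinitePlace.2 (NumberField.InfinitePlace.isInfinitePlace _)
  have h3 := Multiset.single_le_sum (s := archAbsVal.map fun v : AbsoluteValue K ℝ ↦ Real.posLog (v y))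
    (by simp only [Multiset.mem_map]; rintro _ ⟨v, _, rfl⟩; exact Real.posLog_nonneg) _
    (Multiset.mem_map_of_mem _ h2)
  have h4 : (NumberField.InfinitePlace.mk φ).val y = ‖φ y‖ := rfl
  rw [h4] at h3
  linarith

lemma kron {K : Type} [Field K] [NumberField K] (y : K) (hy : y ≠ 0)
    (h : logHeight₁ y ≤ 1 / (48 * (Module.finrank ℚ K : ℝ) ^ 2)) :
    ∃ w : ℕ, 0 < w ∧ w ≤ 2 * (Module.finrank ℚ K) ^ 2 ∧ y ^ w = 1 := by
  classical
  set d := Module.finrank ℚ K with hd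
  have hd1 : 1 ≤ d := Module.finrank_pos
  have hd1' : (1:ℝ) ≤ d := by exact_mod_cast hd1
  have hintegral : IsIntegral ℤ y := by
    obtain ⟨n, hn, hle, hi⟩ := NumberField.exists_nat_le_mulHeight₁ y
    have h1 : Real.log (mulHeight₁ y) < Real.log 2 := by
      rw [← logHeight₁_eq_log_mulHeight₁]
      refine h.trans_lt (lt_of_le_of_lt ?_ (lt_trans (by norm_num : (1:ℝ)/48 < 0.5) (lt_trans (by norm_num) Real.log_two_gt_d9)))
      apply one_div_le_one_div_of_le (by norm_num)
      nlinarith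
    have h2 := (Real.log_lt_log_iff (mulHeight₁_pos y) (by norm_num)).1 h1
    have h3 : (n : ℝ) < 2 := hle.trans_lt h2
    have h4 : n = 1 := by have : n < 2 := by exact_mod_cast h3
                          omega
    simpa [h4] using hi
  obtain ⟨Y, hY⟩ : ∃ Y : NumberField.RingOfIntegers K, (Y : K) = y := ⟨⟨y, hintegral⟩, rfl⟩
  obtain ⟨p, hp, hp1, hp2⟩ := Nat.exists_prime_lt_and_le_two_mul (4 * d) (by omega)
  have : Fact p.Prime := ⟨hp⟩
  have hnorm : ∀ (φ : K →+* ℂ) (n : ℕ), n ≤ 24 * d ^ 2 → ‖φ y‖ ^ n ≤ 2 := by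
    intro φ n hn
    have h0 : 0 < ‖φ y‖ := norm_pos_iff.2 (by simpa using hy)
    rw [← Real.log_le_log_iff (by positivity) (by norm_num), Real.log_pow]
    have h1 := (log_le_posLog _).trans ((norm_le_height φ y).trans h)
    have h2 : (n : ℝ) ≤ 24 * d ^ 2 := by exact_mod_cast hn
    calc (n : ℝ) * Real.log ‖φ y‖ ≤ n * (1 / (48 * (d : ℝ) ^ 2)) := by gcongr
      _ ≤ (24 * d ^ 2) * (1 / (48 * (d : ℝ) ^ 2)) := by gcongr
      _ = 0.5 := by field_simp; norm_num
      _ ≤ Real.log 2 := by linarith [Real.log_two_gt_d9]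
  have hcardσ : Fintype.card (K →ₐ[ℚ] ℂ) = d := AlgHom.card ℚ K ℂ
  let s : ℕ → ℤ := fun n => Algebra.trace ℤ (NumberField.RingOfIntegers K) (Y ^ n)
  have hs : ∀ n, ((s n : ℤ) : ℂ) = ∑ σ : K →ₐ[ℚ] ℂ, (σ y) ^ n := by
    intro n
    have h1 := trace_eq_sum_embeddings (K := ℚ) (L := K) ℂ (x := y ^ n)
    simp only [map_pow] at h1
    rw [← h1]
    have h2 := Algebra.coe_trace_int (K := K) (Y ^ n)
    simp only [map_pow, hY] at h2
    rw [← h2]; simp [s]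
  have hsn : ∀ n, n ≤ 24 * d ^ 2 → |((s n : ℤ) : ℝ)| ≤ d * 2 := by
    intro n hn
    have : |((s n : ℤ) : ℝ)| = ‖((s n : ℤ) : ℂ)‖ := by simp
    rw [this, hs]
    calc _ ≤ ∑ σ : K →ₐ[ℚ] ℂ, (2:ℝ) := norm_sum_le_of_le _ (fun σ _ => by
          rw [norm_pow]; exact hnorm σ.toRingHom n hn)
      _ = _ := by simp [hcardσ]
  have heq : ∀ n, 1 ≤ n → n ≤ 2 * d + 1 → s (p * n) = s n := by
    intro n hn1 hn2
    have h1 : (p : ℤ) ∣ s (p * n) - s n := by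
      have := trace_congr (Y ^ n) p
      rwa [← pow_mul, mul_comm n p] at this
    have b1 : p * n ≤ 24 * d ^ 2 := by
      calc p * n ≤ (2 * (4 * d)) * (2 * d + 1) := Nat.mul_le_mul hp2 hn2
        _ ≤ _ := by nlinarith
    have b2 : n ≤ 24 * d ^ 2 := by nlinarith
    have h2 : |s (p * n) - s n| < p := by
      have : (|((s (p * n) - s n : ℤ) : ℝ)|) < p := by
        push_cast
        refine (abs_sub _ _).trans_lt ?_
        have := hsn _ b1
        have := hsn _ b2
        have : (4 * d : ℝ) < p := by exact_mod_cast hp1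
        linarith
      exact_mod_cast this
    have := Int.eq_zero_of_abs_lt_dvd h1 h2
    omega
  have σ0 : K →ₐ[ℚ] ℂ := Classical.choice (by
    rw [← Fintype.card_pos_iff, hcardσ]; omega)
  obtain ⟨w, hw, hw1⟩ := pow_eq_one_of_closed (fun σ : K →ₐ[ℚ] ℂ => σ y) (fun σ => by simpa using hy) p hp.one_lt
    (kron_sets (fun σ : K →ₐ[ℚ] ℂ => σ y) (fun σ => by simpa using hy) p (by
      intro n hn1 hn2
      rw [hcardσ] at hn2
      rw [← hs, ← hs, heq n hn1 hn2])) σ0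
  have hyw : y ^ w = 1 := by
    apply σ0.injective
    simpa using hw1
  have hfin : IsOfFinOrder y := isOfFinOrder_iff_pow_eq_one.2 ⟨w, hw, hyw⟩
  refine ⟨orderOf y, hfin.orderOf_pos, ?_, pow_orderOf_eq_one y⟩
  have hprim := IsPrimitiveRoot.orderOf y
  have h1 := cyclotomic_eq_minpoly_rat hprim hfin.orderOf_pos
  have h2 : (orderOf y).totient ≤ d := by
    rw [← natDegree_cyclotomic (orderOf y) ℚ, h1]
    exact minpoly.natDegree_le y
  calc orderOf y ≤ 2 * (orderOf y).totient ^ 2 := (totient_bound _).1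
    _ ≤ _ := by gcongr

end BMZ

end PartKron

section PartRel

open Polynomial

namespace BMZ
open Height

lemma dirichlet (m : ℕ) (θ : Fin m → ℝ) (Q : ℕ) (hQ : 0 < Q) :
    ∃ (q : ℕ) (a : Fin m → ℤ), 0 < q ∧ q ≤ Q ^ m ∧ (∀ i, |q * θ i - a i| ≤ 1 / Q) ∧
      (∀ i, θ i = 1 → a i = q) ∧ (∀ i, θ i = 0 → a i = 0) := by
  have hQ' : (0:ℝ) < Q := by exact_mod_cast hQ
  let box : Fin (Q ^ m + 1) → (Fin m → Fin Q) := fun n i =>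
    ⟨⌊Q * Int.fract (n * θ i)⌋₊, by
      rw [Nat.floor_lt (by have := Int.fract_nonneg ((n:ℝ) * θ i); positivity)]
      have := Int.fract_lt_one ((n:ℝ) * θ i)
      nlinarith⟩
  obtain ⟨n1, n2, hne, heq⟩ := Fintype.exists_ne_map_eq_of_card_lt box (by simp)
  have key : ∀ n1 n2 : Fin (Q ^ m + 1), n1 < n2 → box n1 = box n2 → ∃ (q : ℕ) (a : Fin m → ℤ), 0 < q ∧ q ≤ Q ^ m ∧ (∀ i, |q * θ i - a i| ≤ 1 / Q) ∧
      (∀ i, θ i = 1 → a i = q) ∧ (∀ i, θ i = 0 → a i = 0) := by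
    intro n1 n2 hlt heq
    have hlt' : (n1 : ℕ) < n2 := hlt
    refine ⟨n2 - n1, fun i => ⌊n2 * θ i⌋ - ⌊n1 * θ i⌋, by omega, by have := n2.2; omega, ?_, ?_, ?_⟩
    · intro i
      have h1 : ⌊Q * Int.fract (n1 * θ i)⌋₊ = ⌊Q * Int.fract (n2 * θ i)⌋₊ := by
        have := congrFun heq i
        simpa [box] using this
      have f1 := Int.fract_nonneg ((n1:ℝ) * θ i)
      have f2 := Int.fract_nonneg ((n2:ℝ) * θ i)
      have g1 := Nat.floor_le (a := Q * Int.fract (n1 * θ i)) (by positivity)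
      have g2 := Nat.floor_le (a := Q * Int.fract (n2 * θ i)) (by positivity)
      have g3 := Nat.lt_floor_add_one (Q * Int.fract (n1 * θ i))
      have g4 := Nat.lt_floor_add_one (Q * Int.fract (n2 * θ i))
      rw [← h1] at g2 g4
      have e : ((n2 - n1 : ℕ) : ℝ) * θ i - ((⌊n2 * θ i⌋ - ⌊n1 * θ i⌋ : ℤ) : ℝ) =
          Int.fract (n2 * θ i) - Int.fract (n1 * θ i) := by
        rw [Nat.cast_sub hlt'.le]; push_cast
        rw [← Int.self_sub_floor, ← Int.self_sub_floor]; ring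
      rw [e, le_div_iff₀ hQ', abs_sub_comm]
      have e7 : |Int.fract (n1 * θ i) - Int.fract (n2 * θ i)| * Q = |Q * Int.fract (n1 * θ i) - Q * Int.fract (n2 * θ i)| := by
        rw [← mul_sub, abs_mul, abs_of_pos hQ', mul_comm]
      rw [e7, abs_le]
      constructor <;> linarith
    · intro i hi
      simp only [hi, mul_one, Int.floor_natCast]
      push_cast [Nat.cast_sub hlt'.le]; ring
    · intro i hi
      simp [hi]
  rcases lt_or_gt_of_ne hne with h | h
  · exact key _ _ h heq
  · exact key _ _ h heq.symm

lemma logHeight_prod_zpow {K : Type} [Field K] [NumberField K] {m : ℕ} (x : Fin m → K) (a : Fin m → ℤ) :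
    logHeight₁ (∏ i, x i ^ a i) ≤ ∑ i, |(a i : ℝ)| * logHeight₁ (x i) := by
  refine (logHeight₁_prod_le _ _).trans_eq ?_
  refine Finset.sum_congr rfl fun i _ => ?_
  rw [logHeight₁_zpow]
  congr 1
  simp

lemma small_rel {K : Type} [Field K] [NumberField K] {m : ℕ} (x : Fin m → K) (hx : ∀ i, x i ≠ 0) (B : ℕ) (hB : 0 < B)
    (hh : ∀ i, logHeight₁ (x i) ≤ B * Module.finrank ℚ K) (k : Fin m → ℤ) (i0 : Fin m) (hk0 : k i0 ≠ 0)
    (hk : ∀ i, |k i| ≤ |k i0|) (hrel : ∏ i, x i ^ k i = 1) :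
    ∃ a : Fin m → ℤ, a i0 ≠ 0 ∧ (∀ i, k i = 0 → a i = 0) ∧ (∏ i, x i ^ a i = 1) ∧
      ∀ i, |a i| ≤ 4 * (48 * m * B) ^ m * (Module.finrank ℚ K) ^ (3 * m + 2) := by
  set d := Module.finrank ℚ K with hd
  have hd1 : 1 ≤ d := Module.finrank_pos
  have hm : 0 < m := Fin.pos_iff_nonempty.2 ⟨i0⟩
  set Q := 48 * m * B * d ^ 3 with hQ
  have hQ0 : 0 < Q := by positivity
  have hk0' : (k i0 : ℝ) ≠ 0 := by exact_mod_cast hk0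
  obtain ⟨q, a, hq, hqQ, happ, h1, h0⟩ := dirichlet m (fun i => (k i : ℝ) / k i0) Q hQ0
  set y := ∏ i, x i ^ a i with hy
  have hy0 : y ≠ 0 := Finset.prod_ne_zero_iff.2 fun i _ => zpow_ne_zero _ (hx i)
  have hyk : y ^ k i0 = ∏ i, x i ^ (a i * k i0 - q * k i) := by
    have : ∏ i, x i ^ (a i * k i0 - q * k i) = (∏ i, x i ^ a i) ^ k i0 / (∏ i, x i ^ k i) ^ (q : ℤ) := by
      rw [← Finset.prod_zpow, ← Finset.prod_zpow, ← Finset.prod_div_distrib]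
      refine Finset.prod_congr rfl fun i _ => ?_
      rw [zpow_sub₀ (hx i), zpow_mul, mul_comm (q : ℤ), zpow_mul]
    rw [this, hrel]; simp [hy]
  have hdr : (0:ℝ) < d := by exact_mod_cast hd1
  have hht : logHeight₁ y ≤ 1 / (48 * (d : ℝ) ^ 2) := by
    have e1 : |(k i0 : ℝ)| * logHeight₁ y = logHeight₁ (y ^ k i0) := by
      rw [logHeight₁_zpow]; congr 1; simp
    have e2 : logHeight₁ (y ^ k i0) ≤ ∑ i : Fin m, (|(k i0 : ℝ)| * (1 / Q)) * (B * d) := by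
      rw [hyk]
      refine (logHeight_prod_zpow x _).trans (Finset.sum_le_sum fun i _ => ?_)
      have e3 : |((a i * k i0 - q * k i : ℤ) : ℝ)| ≤ |(k i0 : ℝ)| * (1 / Q) := by
        have := happ i
        have e4 : ((a i * k i0 - q * k i : ℤ) : ℝ) = - (k i0 * (q * (k i / k i0) - a i)) := by
          push_cast; field_simp; ring
        rw [e4, abs_neg, abs_mul]
        exact mul_le_mul_of_nonneg_left this (abs_nonneg _)
      have := zero_le_logHeight₁ (x i)
      exact mul_le_mul e3 (hh i) this (by positivity)
    rw [← e1] at e2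
    simp only [Finset.sum_const, Finset.card_univ, Fintype.card_fin, nsmul_eq_mul] at e2
    have e5 : |(k i0 : ℝ)| * logHeight₁ y ≤ |(k i0 : ℝ)| * (1 / (48 * (d : ℝ) ^ 2)) := by
      refine e2.trans_eq ?_
      rw [hQ]; push_cast
      have : (m:ℝ) ≠ 0 := by positivity
      have : (B:ℝ) ≠ 0 := by positivity
      field_simp
    exact le_of_mul_le_mul_left e5 (abs_pos.2 hk0')
  obtain ⟨w, hw, hw2, hw1⟩ := kron y hy0 hht
  refine ⟨fun i => w * a i, ?_, ?_, ?_, ?_⟩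
  · have := h1 i0 (div_self hk0')
    show (w : ℤ) * a i0 ≠ 0
    rw [this]
    positivity
  · intro i hi
    show (w : ℤ) * a i = 0
    rw [h0 i (by simp [hi])]; simp
  · rw [← hw1, hy, ← Finset.prod_pow]
    refine Finset.prod_congr rfl fun i _ => ?_
    show x i ^ ((w : ℤ) * a i) = _
    rw [mul_comm, zpow_mul, zpow_natCast]
  · intro i
    have e1 : |(a i : ℝ)| ≤ 2 * Q ^ m := by
      have e2 := happ i
      have e3 : |(q : ℝ) * (k i / k i0)| ≤ Q ^ m := by
        rw [abs_mul, abs_div]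
        have : |(k i : ℝ)| / |(k i0 : ℝ)| ≤ 1 := by
          rw [div_le_one (abs_pos.2 hk0')]
          exact_mod_cast hk i
        have h5 : |(q : ℝ)| ≤ Q ^ m := by rw [Nat.abs_cast]; exact_mod_cast hqQ
        calc _ ≤ (Q:ℝ) ^ m * 1 := by gcongr
          _ = _ := mul_one _
      have e4 : (1:ℝ) / Q ≤ Q ^ m := by
        have : (1:ℝ) ≤ Q := by exact_mod_cast hQ0
        calc (1:ℝ)/Q ≤ 1 := by rw [div_le_one (by linarith)]; exact this
          _ ≤ _ := one_le_pow₀ this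
      have e5 : (a i : ℝ) = (q : ℝ) * (k i / k i0) - (q * (k i / k i0) - a i) := by ring
      rw [e5]
      refine (abs_sub _ _).trans ?_
      linarith
    have e2 : |a i| ≤ 2 * (Q : ℤ) ^ m := by exact_mod_cast e1
    show |(w : ℤ) * a i| ≤ _
    rw [abs_mul, Nat.abs_cast]
    calc (w : ℤ) * |a i| ≤ (2 * d ^ 2 : ℕ) * (2 * (Q : ℤ) ^ m) := by
          gcongr
      _ = _ := by rw [hQ]; push_cast; ring

lemma two_rels {K : Type} [Field K] [NumberField K] {m : ℕ} (x : Fin m → K) (hx : ∀ i, x i ≠ 0) (B : ℕ) (hB : 0 < B)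
    (hh : ∀ i, logHeight₁ (x i) ≤ B * Module.finrank ℚ K) (k l : Fin m → ℤ) (hind : LinearIndependent ℤ ![k, l])
    (hk : ∏ i, x i ^ k i = 1) (hl : ∏ i, x i ^ l i = 1) :
    ∃ a b : Fin m → ℤ, LinearIndependent ℤ ![a, b] ∧ (∏ i, x i ^ a i = 1) ∧ (∏ i, x i ^ b i = 1) ∧
      (∀ i, |a i| ≤ 4 * (48 * m * B) ^ m * (Module.finrank ℚ K) ^ (3 * m + 2)) ∧
      (∀ i, |b i| ≤ 4 * (48 * m * B) ^ m * (Module.finrank ℚ K) ^ (3 * m + 2)) := by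
  rw [LinearIndependent.pair_iff] at hind
  have hmax : ∀ k : Fin m → ℤ, k ≠ 0 → ∃ i0, k i0 ≠ 0 ∧ ∀ i, |k i| ≤ |k i0| := by
    intro k hk
    obtain ⟨i1, hi1⟩ := Function.ne_iff.1 hk
    obtain ⟨i0, -, h⟩ := Finset.exists_max_image Finset.univ (fun i => |k i|) ⟨i1, Finset.mem_univ _⟩
    refine ⟨i0, fun h0 => ?_, fun i => h i (Finset.mem_univ _)⟩
    have := h i1 (Finset.mem_univ _)
    rw [h0, abs_zero] at this
    exact hi1 (abs_nonpos_iff.1 this)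
  have hk0 : k ≠ 0 := by
    rintro rfl
    have := (hind 1 0 (by simp)).1
    omega
  obtain ⟨i0, hi0, hki0⟩ := hmax k hk0
  have hl0 : k i0 • l - l i0 • k ≠ 0 := by
    intro h
    have := (hind (- l i0) (k i0) (by rw [← h]; simp only [neg_smul]; abel)).2
    exact hi0 this
  have hl1 : ∏ i, x i ^ (k i0 • l - l i0 • k) i = 1 := by
    have : ∏ i, x i ^ (k i0 • l - l i0 • k) i = (∏ i, x i ^ l i) ^ k i0 / (∏ i, x i ^ k i) ^ l i0 := by
      rw [← Finset.prod_zpow, ← Finset.prod_zpow, ← Finset.prod_div_distrib]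
      refine Finset.prod_congr rfl fun i _ => ?_
      simp only [Pi.sub_apply, Pi.smul_apply, smul_eq_mul]
      rw [zpow_sub₀ (hx i), mul_comm (k i0), zpow_mul, mul_comm (l i0), zpow_mul]
    rw [this, hk, hl]; simp
  obtain ⟨i1, hi1, hki1⟩ := hmax _ hl0
  obtain ⟨a, ha0, -, ha1, hab⟩ := small_rel x hx B hB hh k i0 hi0 hki0 hk
  obtain ⟨b, hb1, hb0, hb2, hbb⟩ := small_rel x hx B hB hh _ i1 hi1 hki1 hl1
  refine ⟨a, b, ?_, ha1, hb2, hab, hbb⟩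
  rw [LinearIndependent.pair_iff]
  intro s t hst
  have hb00 : b i0 = 0 := hb0 i0 (by simp [mul_comm])
  have e0 := congrFun hst i0
  simp [hb00, ha0] at e0
  have e1 := congrFun hst i1
  simp [e0, hb1] at e1
  exact ⟨e0, e1⟩

end BMZ

end PartRel

section PartAna

open Polynomial

namespace BMZ
open Metric

lemma factor_zeros (z0 : ℂ) (R : ℝ) (g : ℂ → ℂ) (hg : DifferentiableOn ℂ g (ball z0 R)) (S : Finset ℂ)
    (hS : ∀ s ∈ S, s ∈ ball z0 R) (h0 : ∀ s ∈ S, g s = 0) :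
    ∃ h : ℂ → ℂ, DifferentiableOn ℂ h (ball z0 R) ∧ ∀ z, g z = (∏ s ∈ S, (z - s)) * h z := by
  classical
  induction S using Finset.induction_on with
  | empty => exact ⟨g, hg, by simp⟩
  | insert s S hs ih =>
    obtain ⟨h, hh, hgh⟩ := ih (fun s hs => hS s (Finset.mem_insert_of_mem hs))
      (fun s hs => h0 s (Finset.mem_insert_of_mem hs))
    refine ⟨dslope h s, ?_, fun z => ?_⟩
    · rw [Complex.differentiableOn_dslope (isOpen_ball.mem_nhds (hS s (Finset.mem_insert_self _ _)))]
      exact hh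
    · have hs0 : h s = 0 := by
        have := h0 s (Finset.mem_insert_self _ _)
        rw [hgh s] at this
        rcases mul_eq_zero.1 this with h1 | h1
        · obtain ⟨t, ht, h2⟩ := Finset.prod_eq_zero_iff.1 h1
          rw [sub_eq_zero] at h2
          exact absurd (h2 ▸ ht) hs
        · exact h1
      rw [Finset.prod_insert hs, hgh z]
      have := sub_smul_dslope h s z
      rw [hs0, sub_zero, smul_eq_mul] at this
      rw [← this]; ring

lemma schwarz (z0 : ℂ) (r : ℝ) (hr : 0 < r) (g : ℂ → ℂ) (hg : DifferentiableOn ℂ g (ball z0 (8 * r))) (S : Finset ℂ)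
    (hS : ∀ s ∈ S, s ∈ closedBall z0 r) (h0 : ∀ s ∈ S, g s = 0) (M : ℝ)
    (hM : ∀ z ∈ closedBall z0 (4 * r), ‖g z‖ ≤ M) (z : ℂ) (hz : z ∈ closedBall z0 r) :
    ‖g z‖ ≤ (∏ s ∈ S, ‖z - s‖) * (M / (3 * r) ^ S.card) := by
  obtain ⟨h, hh, hgh⟩ := factor_zeros z0 (8 * r) g hg S
    (fun s hs => closedBall_subset_ball (by linarith) (hS s hs)) h0
  have hb : ‖h z‖ ≤ M / (3 * r) ^ S.card := by
    refine Complex.norm_le_of_forall_mem_frontier_norm_le (U := ball z0 (4 * r)) isBounded_ball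
      (DifferentiableOn.diffContOnCl ?_) ?_ ?_
    · rw [closure_ball _ (by linarith)]
      exact hh.mono (closedBall_subset_ball (by linarith))
    · intro w hw
      rw [frontier_ball _ (by linarith)] at hw
      have h1 : (3 * r) ^ S.card ≤ ‖∏ s ∈ S, (w - s)‖ := by
        rw [norm_prod, ← Finset.prod_const]
        refine Finset.prod_le_prod (fun _ _ => by positivity) fun s hs => ?_
        have h2 := hS s hs
        rw [mem_closedBall, dist_eq_norm] at h2
        rw [mem_sphere, dist_eq_norm] at hw
        have : w - z0 = (w - s) + (s - z0) := by ring
        have h3 := norm_add_le (w - s) (s - z0)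
        rw [← this] at h3
        linarith
      have h2 := hM w (sphere_subset_closedBall hw)
      rw [hgh w, norm_mul] at h2
      rw [le_div_iff₀ (by positivity)]
      nlinarith [norm_nonneg (h w)]
    · rw [closure_ball _ (by linarith)]
      exact closedBall_subset_closedBall (by linarith) hz
  rw [hgh z, norm_mul, norm_prod]
  gcongr

lemma zero_estimate (z0 : ℂ) (r : ℝ) (hr : 0 < r) (V : Submodule ℂ (ℂ → ℂ)) (hV : V.FG)
    (hd : ∀ g ∈ V, DifferentiableOn ℂ g (ball z0 (8 * r))) :
    ∃ n0 : ℕ, ∀ g ∈ V, (∃ z ∈ ball z0 (8 * r), g z ≠ 0) → ∀ S : Finset ℂ, (∀ s ∈ S, s ∈ closedBall z0 r) →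
      (∀ s ∈ S, g s = 0) → S.card ≤ n0 := by
  have hfin : FiniteDimensional ℂ V := Module.Finite.iff_fg.2 hV
  have hc : ∀ t < 8, ∀ g ∈ V, ContinuousOn g (closedBall z0 (t * r)) := fun t ht g hg =>
    (hd g hg).continuousOn.mono (closedBall_subset_ball (by nlinarith))
  let Φ : ∀ t < 8, V →ₗ[ℂ] C(closedBall z0 (t * r), ℂ) := fun t ht =>
    { toFun := fun g => ⟨_, (hc t ht g.1 g.2).domRestrict⟩
      map_add' := fun _ _ => rfl
      map_smul' := fun _ _ => rfl }
  have hΦ : ∀ t ht (g : V) (z : closedBall z0 (t * r)), Φ t ht g z = g.1 z := fun _ _ _ _ => rfl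
  have hinj : ∀ g : V, Φ 1 (by norm_num) g = 0 → ∀ z ∈ ball z0 (8 * r), g.1 z = 0 := by
    intro g hg z hz
    have han : AnalyticOnNhd ℂ g.1 (ball z0 (8 * r)) := (hd g.1 g.2).analyticOnNhd isOpen_ball
    refine han.eqOn_zero_of_preconnected_of_eventuallyEq_zero (convex_ball _ _).isPreconnected (mem_ball_self (by linarith)) ?_ hz
    filter_upwards [closedBall_mem_nhds z0 (by linarith : 0 < 1 * r)] with w hw
    exact DFunLike.congr_fun hg ⟨w, hw⟩
  obtain ⟨σ, hσ⟩ := (Φ 1 (by norm_num)).rangeRestrict.exists_rightInverse_of_surjective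
    (LinearMap.range_rangeRestrict _)
  let Ψ := (Φ 4 (by norm_num) ∘ₗ σ).toContinuousLinearMap
  have hΨ : ∀ g : V, ‖Φ 4 (by norm_num) g‖ ≤ ‖Ψ‖ * ‖Φ 1 (by norm_num) g‖ := by
    intro g
    have h1 := Ψ.le_opNorm ((Φ 1 (by norm_num)).rangeRestrict g)
    have h2 : Ψ ((Φ 1 (by norm_num)).rangeRestrict g) = Φ 4 (by norm_num) g := by
      show Φ 4 (by norm_num) (σ ((Φ 1 (by norm_num)).rangeRestrict g)) = _
      rw [← sub_eq_zero, ← map_sub]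
      have h3 : Φ 1 (by norm_num) (σ ((Φ 1 (by norm_num)).rangeRestrict g) - g) = 0 := by
        rw [map_sub, sub_eq_zero]
        have := LinearMap.congr_fun hσ ((Φ 1 (by norm_num)).rangeRestrict g)
        exact congrArg Subtype.val this
      ext z
      exact hinj _ h3 z.1 (closedBall_subset_ball (by linarith) z.2)
    rw [h2] at h1
    exact h1
  obtain ⟨n0, hn0⟩ := exists_pow_lt_of_lt_one (show (0:ℝ) < 1 / (‖Ψ‖ + 1) by positivity) (by norm_num : (2/3 : ℝ) < 1)
  refine ⟨n0, fun g hg ⟨z1, hz1, hne⟩ S hS h0 => ?_⟩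
  by_contra hcard
  push Not at hcard
  have hpos : 0 < ‖Φ 1 (by norm_num) ⟨g, hg⟩‖ := by
    rw [norm_pos_iff]
    intro h
    exact hne (hinj _ h z1 hz1)
  set M := ‖Φ 4 (by norm_num) ⟨g, hg⟩‖ with hMdef
  have hb : ‖Φ 1 (by norm_num) ⟨g, hg⟩‖ ≤ (2/3) ^ S.card * M := by
    rw [ContinuousMap.norm_le _ (by positivity)]
    rintro ⟨z, hz⟩
    rw [hΦ 1 (by norm_num)]
    rw [one_mul] at hz
    refine (schwarz z0 r hr g (hd g hg) S hS h0 M (fun w hw => (Φ 4 (by norm_num) ⟨g, hg⟩).norm_coe_le_norm ⟨w, hw⟩) z hz).trans ?_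
    have : ∏ s ∈ S, ‖z - s‖ ≤ (2 * r) ^ S.card := by
      rw [← Finset.prod_const]
      refine Finset.prod_le_prod (fun _ _ => norm_nonneg _) fun s hs => ?_
      rw [← dist_eq_norm]
      have := dist_triangle_right z s z0
      have h1 := hS s hs
      rw [mem_closedBall] at h1 hz
      linarith
    calc _ ≤ (2 * r) ^ S.card * (M / (3 * r) ^ S.card) := by gcongr
      _ = _ := by
        rw [mul_div_assoc', mul_div_right_comm, ← div_pow, mul_div_mul_right _ _ hr.ne']
  have h2 := hΨ ⟨g, hg⟩
  have h3 : (2/3 : ℝ) ^ S.card ≤ (2/3) ^ n0 := pow_le_pow_of_le_one (by norm_num) (by norm_num) hcard.le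
  have h4 : (2/3 : ℝ) ^ S.card * (‖Ψ‖ + 1) < 1 := by
    rw [lt_div_iff₀ (by positivity)] at hn0
    exact lt_of_le_of_lt (by gcongr) hn0
  have h5 : (2/3 : ℝ) ^ S.card * M ≤ (2/3 : ℝ) ^ S.card * (‖Ψ‖ * ‖Φ 1 (by norm_num) ⟨g, hg⟩‖) := by gcongr
  have h6 : (0:ℝ) < (2/3) ^ S.card := by positivity
  nlinarith

end BMZ

end PartAna

section PartAlg

open Polynomial

namespace BMZ
open Metric

/-- coefficientwise derivative -/
noncomputable def dz {σ : Type} (P : MvPolynomial σ ℂ[X]) : MvPolynomial σ ℂ[X] :=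
  ∑ s ∈ P.support, MvPolynomial.monomial s (derivative (P.coeff s))

lemma coeff_dz {σ : Type} (P : MvPolynomial σ ℂ[X]) (s : σ →₀ ℕ) :
    (dz P).coeff s = derivative (P.coeff s) := by
  classical
  rw [dz, MvPolynomial.coeff_sum]
  simp only [MvPolynomial.coeff_monomial]
  rw [Finset.sum_ite_eq']
  split_ifs with h
  · rfl
  · rw [MvPolynomial.notMem_support_iff.1 h]; simp

/-- the derivation -/
noncomputable def DD {σ : Type} [Fintype σ] (W : ℂ[X]) (A : σ → ℂ[X]) (P : MvPolynomial σ ℂ[X]) :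
    MvPolynomial σ ℂ[X] :=
  MvPolynomial.C W * dz P + ∑ i, MvPolynomial.C (A i) * MvPolynomial.pderiv i P

lemma coeff_DD {σ : Type} [Fintype σ] (W : ℂ[X]) (A : σ → ℂ[X]) (P : MvPolynomial σ ℂ[X]) (s : σ →₀ ℕ) :
    (DD W A P).coeff s = W * derivative (P.coeff s) +
      ∑ i, A i * (P.coeff (s + Finsupp.single i 1) * (s i + 1)) := by
  rw [DD, MvPolynomial.coeff_add, MvPolynomial.coeff_C_mul, coeff_dz, MvPolynomial.coeff_sum]
  congr 1
  refine Finset.sum_congr rfl fun i _ => ?_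
  rw [MvPolynomial.coeff_C_mul, MvPolynomial.coeff_pderiv]

lemma coprime_parts (p r : ℂ[X]) (hp : p ≠ 0) : ∃ d p1 r1 : ℂ[X], d ≠ 0 ∧ p1 ≠ 0 ∧ p = d * p1 ∧ r = d * r1 ∧ IsCoprime p1 r1 := by
  obtain ⟨p1, r1, h1, h2, hu⟩ := extract_gcd p r
  refine ⟨gcd p r, p1, r1, gcd_ne_zero_of_left hp, ?_, h1, h2, (gcd_isUnit_iff _ _).1 hu⟩
  rintro rfl
  exact hp (by rw [h1, mul_zero])

lemma const_of_wronskian (p r : ℂ[X]) (hp : p ≠ 0) (h : p * derivative r - derivative p * r = 0) :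
    ∃ c : ℂ, r = C c * p := by
  obtain ⟨d, p1, r1, hd, hp1, e1, e2, hc⟩ := coprime_parts p r hp
  have hw : wronskian p1 r1 = 0 := by
    have : d ^ 2 * wronskian p1 r1 = 0 := by
      rw [wronskian, ← h, e1, e2, derivative_mul, derivative_mul]; ring
    exact (mul_eq_zero.1 this).resolve_left (pow_ne_zero _ hd)
  obtain ⟨w1, w2⟩ := hc.wronskian_eq_zero_iff.1 hw
  have c1 := derivative_eq_zero.1 w1
  have c2 := derivative_eq_zero.1 w2
  rw [natDegree_eq_zero] at c1 c2
  obtain ⟨a, rfl⟩ := c1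
  obtain ⟨b, rfl⟩ := c2
  have ha : a ≠ 0 := by rintro rfl; simp at hp1
  refine ⟨b / a, ?_⟩
  rw [e1, e2]
  have : C b = C (b / a) * C a := by rw [← C_mul, div_mul_cancel₀ _ ha]
  rw [this]; ring

lemma pole_arg (W1 p r N : ℂ[X]) (β : ℂ) (hp : p ≠ 0) (hW : W1.eval β ≠ 0)
    (h : ((X - C β) * W1) * (p * derivative r - derivative p * r) = p ^ 2 * N) : N.eval β = 0 := by
  obtain ⟨d, p1, r1, hd, hp1, e1, e2, hc⟩ := coprime_parts p r hp
  have h' : ((X - C β) * W1) * (p1 * derivative r1 - derivative p1 * r1) = p1 ^ 2 * N := by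
    apply mul_left_cancel₀ (pow_ne_zero 2 hd)
    rw [e1, e2, derivative_mul, derivative_mul] at h
    linear_combination h
  obtain ⟨k, p2, hp2, e3⟩ : ∃ k p2, eval β p2 ≠ 0 ∧ p1 = (X - C β) ^ k * p2 := by
    obtain ⟨p2, h1, h2⟩ := exists_eq_pow_rootMultiplicity_mul_and_not_dvd p1 hp1 β
    exact ⟨_, p2, fun h => h2 (dvd_iff_isRoot.2 h), h1⟩
  rcases Nat.eq_zero_or_pos k with rfl | hk
  · have := congrArg (eval β) h'
    rw [e3] at this
    simp at this
    exact this.resolve_left hp2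
  · exfalso
    obtain ⟨k, rfl⟩ := Nat.exists_eq_succ_of_ne_zero hk.ne'
    have hr : r1.eval β ≠ 0 := by
      intro h0
      obtain ⟨a, b, hab⟩ := hc
      have := congrArg (eval β) hab
      rw [e3] at this
      simp [h0] at this
    have h2 : W1 * ((X - C β) * p2 * derivative r1 - ((k + 1 : ℕ) : ℂ[X]) * p2 * r1 - (X - C β) * derivative p2 * r1)
        = (X - C β) * ((X - C β) ^ k * p2 ^ 2 * N) := by
      have hne : (X - C β) ^ (k + 1) ≠ 0 := pow_ne_zero _ (X_sub_C_ne_zero β)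
      apply mul_left_cancel₀ hne
      rw [e3, derivative_mul, derivative_X_sub_C_pow, Nat.succ_eq_add_one, Nat.add_sub_cancel, map_natCast] at h'
      linear_combination h'
    have := congrArg (eval β) h2
    simp at this
    rcases this with h | h | h
    · exact hW h
    · rcases h with h | h
      · have : ((k:ℂ) + 1) ≠ 0 := by exact_mod_cast Nat.succ_ne_zero k
        exact this h
      · exact hp2 h
    · exact hr h

lemma stable_ideal {σ : Type} [Fintype σ] (W : ℂ[X]) (hW : W ≠ 0) (A : σ → ℂ[X]) (I : Ideal (MvPolynomial σ ℂ[X]))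
    (hI : ∀ P ∈ I, DD W A P ∈ I) (hC : ∀ p, MvPolynomial.C p ∈ I → p = 0)
    (hA : ∀ (c : σ → ℂ) (p r : ℂ[X]), p ≠ 0 → W * (p * derivative r - derivative p * r) = p ^ 2 * ∑ i, C (c i) * A i → c = 0) :
    ∀ P ∈ I, P = 0 := by
  classical
  by_contra hcon
  push Not at hcon
  have hex : ∃ n, ∃ P ∈ I, P ≠ 0 ∧ ∀ s ∈ P.support, s.degree ≤ n := by
    obtain ⟨P, hP, h0⟩ := hcon
    exact ⟨P.support.sup Finsupp.degree, P, hP, h0, fun s hs => Finset.le_sup hs⟩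
  set n := Nat.find hex with hn
  have hmin : ∀ P ∈ I, (∀ s ∈ P.support, s.degree < n) → P = 0 := by
    intro P hP hd
    by_contra h0
    rcases Nat.eq_zero_or_pos n with h | h
    · apply h0
      rw [← MvPolynomial.support_eq_empty, Finset.eq_empty_iff_forall_notMem]
      intro s hs
      have := hd s hs
      omega
    · exact Nat.find_min hex (m := n - 1) (by omega) ⟨P, hP, h0, fun s hs => by have := hd s hs; omega⟩
  have hex2 : ∃ k, ∃ P ∈ I, P ≠ 0 ∧ (∀ s ∈ P.support, s.degree ≤ n) ∧
      (P.support.filter (fun s => s.degree = n)).card = k := by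
    obtain ⟨P, h1, h2, h3⟩ := Nat.find_spec hex
    exact ⟨_, P, h1, h2, h3, rfl⟩
  obtain ⟨P, hP, hP0, hPn, hPk⟩ := Nat.find_spec hex2
  obtain ⟨s0, hs0, hs0n⟩ : ∃ s ∈ P.support, s.degree = n := by
    by_contra h
    push Not at h
    exact hP0 (hmin P hP fun s hs => lt_of_le_of_ne (hPn s hs) (h s hs))
  set p0 := P.coeff s0 with hp0
  have hp0' : p0 ≠ 0 := MvPolynomial.mem_support_iff.1 hs0
  have hcoef : ∀ s, (MvPolynomial.C p0 * DD W A P - MvPolynomial.C (W * derivative p0) * P).coeff s =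
      p0 * (W * derivative (P.coeff s) + ∑ i, A i * (P.coeff (s + Finsupp.single i 1) * (s i + 1))) -
        W * derivative p0 * P.coeff s := by
    intro s
    rw [MvPolynomial.coeff_sub, MvPolynomial.coeff_C_mul, MvPolynomial.coeff_C_mul, coeff_DD]
  have hbig : ∀ s, n < s.degree → P.coeff s = 0 := by
    intro s hs
    by_contra h
    have := hPn s (MvPolynomial.mem_support_iff.2 h)
    omega
  have hdeg : ∀ (s : σ →₀ ℕ) i, (s + Finsupp.single i 1).degree = s.degree + 1 := by
    intro s i
    rw [map_add, Finsupp.degree_single]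
  have hcoefn : ∀ s, n ≤ s.degree → (MvPolynomial.C p0 * DD W A P - MvPolynomial.C (W * derivative p0) * P).coeff s =
      W * (p0 * derivative (P.coeff s) - derivative p0 * P.coeff s) := by
    intro s hs
    rw [hcoef, Finset.sum_eq_zero]
    · ring
    · intro i _
      rw [hbig _ (by rw [hdeg]; omega)]; ring
  have hQ0 : MvPolynomial.C p0 * DD W A P - MvPolynomial.C (W * derivative p0) * P = 0 := by
    by_contra hne
    have hQI : MvPolynomial.C p0 * DD W A P - MvPolynomial.C (W * derivative p0) * P ∈ I :=
      I.sub_mem (I.mul_mem_left _ (hI P hP)) (I.mul_mem_left _ hP)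
    refine Nat.find_min hex2 (m := _) ?_ ⟨_, hQI, hne, ?_, rfl⟩
    · rw [← hPk]
      apply Finset.card_lt_card
      rw [Finset.ssubset_iff_of_subset]
      · refine ⟨s0, by simp [hs0n, hs0], ?_⟩
        rw [Finset.mem_filter, not_and_or]
        left
        rw [MvPolynomial.mem_support_iff, not_not, hcoefn s0 hs0n.ge]
        ring
      · intro s hs
        rw [Finset.mem_filter, MvPolynomial.mem_support_iff] at hs ⊢
        refine ⟨fun h => hs.1 ?_, hs.2⟩
        rw [hcoefn s hs.2.ge, h]; simp
    · intro s hs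
      by_contra h
      push Not at h
      rw [MvPolynomial.mem_support_iff, hcoefn s h.le, hbig s h] at hs
      simp at hs
  have htop : ∀ s, s.degree = n → ∃ c : ℂ, P.coeff s = C c * p0 := by
    intro s hs
    apply const_of_wronskian _ _ hp0'
    have := hcoefn s hs.ge
    rw [hQ0, MvPolynomial.coeff_zero] at this
    exact (mul_eq_zero.1 this.symm).resolve_left hW
  choose! c hc using htop
  by_cases hs00 : s0 = 0
  · have hn0 : n = 0 := by rw [← hs0n, hs00]; simp
    have : P = MvPolynomial.C p0 := by
      ext1 s
      rw [MvPolynomial.coeff_C]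
      split_ifs with h
      · rw [← h, hp0, hs00]
      · refine hbig s ?_
        rw [hn0, pos_iff_ne_zero, Ne, Finsupp.degree_eq_zero_iff]
        exact fun h' => h h'.symm
    rw [this] at hP
    exact hp0' (hC _ hP)
  · obtain ⟨i0, hi0⟩ := Finsupp.ne_iff.1 hs00
    rw [Finsupp.zero_apply] at hi0
    set t := s0 - Finsupp.single i0 1 with ht
    have hts : t + Finsupp.single i0 1 = s0 := by
      rw [ht]
      apply tsub_add_cancel_of_le
      rw [Finsupp.single_le_iff]; omega
    have htn : t.degree + 1 = n := by rw [← hdeg t i0, hts, hs0n]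
    have h1 := hcoef t
    rw [hQ0, MvPolynomial.coeff_zero] at h1
    have h2 := hA (fun i => -(c (t + Finsupp.single i 1) * (t i + 1))) p0 (P.coeff t) hp0' ?_
    · have h3 := congrFun h2 i0
      simp only [Pi.zero_apply, neg_eq_zero, mul_eq_zero] at h3
      rcases h3 with h3 | h3
      · rw [hts] at h3
        have h4 := hc s0 hs0n
        rw [h3] at h4
        simp at h4
        exact hp0' h4
      · have : ((t i0 : ℂ) + 1) ≠ 0 := by exact_mod_cast Nat.succ_ne_zero (t i0)
        exact this h3
    · have h5 : ∑ i, A i * (P.coeff (t + Finsupp.single i 1) * (t i + 1)) =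
          - (p0 * ∑ i, C (-(c (t + Finsupp.single i 1) * (t i + 1))) * A i) := by
        rw [Finset.mul_sum, ← Finset.sum_neg_distrib]
        refine Finset.sum_congr rfl fun i _ => ?_
        rw [hc _ (by rw [hdeg, htn])]
        simp only [C_neg, C_mul, C_add, C_1, map_natCast]
        ring
      rw [h5] at h1
      linear_combination -h1

end BMZ

end PartAlg

section PartAlg2

open Polynomial

namespace BMZ
open Metric

lemma dz_add {σ : Type} (P Q : MvPolynomial σ ℂ[X]) : dz (P + Q) = dz P + dz Q := by
  ext1 s; simp [coeff_dz]

lemma dz_mul_X {σ : Type} (P : MvPolynomial σ ℂ[X]) (i : σ) :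
    dz (P * MvPolynomial.X i) = dz P * MvPolynomial.X i := by
  classical
  ext1 s
  rw [coeff_dz, MvPolynomial.coeff_mul_X', MvPolynomial.coeff_mul_X']
  split_ifs
  · rw [coeff_dz]
  · simp

lemma dz_C {σ : Type} (p : ℂ[X]) : dz (MvPolynomial.C p : MvPolynomial σ ℂ[X]) = MvPolynomial.C (derivative p) := by
  classical
  ext1 s
  rw [coeff_dz, MvPolynomial.coeff_C, MvPolynomial.coeff_C]
  split_ifs <;> simp

/-- evaluation -/
noncomputable def th {σ : Type} (u : σ → ℂ → ℂ) (z : ℂ) : MvPolynomial σ ℂ[X] →+* ℂ :=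
  MvPolynomial.eval₂Hom (evalRingHom z) (fun i => u i z)

lemma th_C {σ : Type} (u : σ → ℂ → ℂ) (z : ℂ) (p : ℂ[X]) : th u z (MvPolynomial.C p) = p.eval z := by
  simp [th]

lemma th_X {σ : Type} (u : σ → ℂ → ℂ) (z : ℂ) (i : σ) : th u z (MvPolynomial.X i) = u i z := by
  simp [th]

lemma DD_mul_X {σ : Type} [Fintype σ] (W : ℂ[X]) (A : σ → ℂ[X]) (P : MvPolynomial σ ℂ[X]) (i : σ) :
    DD W A (P * MvPolynomial.X i) = DD W A P * MvPolynomial.X i + P * MvPolynomial.C (A i) := by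
  classical
  have e : ∀ j, MvPolynomial.C (A j) * MvPolynomial.pderiv j (P * MvPolynomial.X i) =
      MvPolynomial.C (A j) * MvPolynomial.pderiv j P * MvPolynomial.X i + if i = j then P * MvPolynomial.C (A i) else 0 := by
    intro j
    rw [MvPolynomial.pderiv_mul, MvPolynomial.pderiv_X, Pi.single_apply]
    split_ifs with h
    · subst h; ring
    · ring
  rw [DD, DD, dz_mul_X, Finset.sum_congr rfl (fun j _ => e j), Finset.sum_add_distrib, ← Finset.sum_mul,
    Finset.sum_ite_eq, if_pos (Finset.mem_univ _)]
  ring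

lemma th_deriv {σ : Type} [Fintype σ] (u : σ → ℂ → ℂ) (W : ℂ[X]) (A : σ → ℂ[X]) (z : ℂ) (hz : W.eval z ≠ 0)
    (hu : ∀ i, HasDerivAt (u i) ((A i).eval z / W.eval z) z) (P : MvPolynomial σ ℂ[X]) :
    HasDerivAt (fun z => th u z P) (th u z (DD W A P) / W.eval z) z := by
  classical
  induction P using MvPolynomial.induction_on with
  | C p =>
    simp only [th_C, DD, dz_C]
    simp only [MvPolynomial.pderiv_C, mul_zero, Finset.sum_const_zero, add_zero, map_mul, th_C]
    rw [mul_div_cancel_left₀ _ hz]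
    exact p.hasDerivAt z
  | add P Q hP hQ =>
    have : DD W A (P + Q) = DD W A P + DD W A Q := by
      simp only [DD, dz_add, map_add, mul_add, Finset.sum_add_distrib]; ring
    simp only [this, map_add, add_div]
    exact hP.add hQ
  | mul_X P i hP =>
    have := DD_mul_X W A P i
    simp only [this, map_mul, map_add, th_X, th_C]
    refine (hP.mul (hu i)).congr_deriv ?_
    rw [add_div]; ring

lemma alg_indep {σ : Type} [Fintype σ] (u : σ → ℂ → ℂ) (W : ℂ[X]) (A : σ → ℂ[X]) (z0 : ℂ) (R : ℝ) (hR : 0 < R)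
    (hz : ∀ z ∈ ball z0 R, W.eval z ≠ 0)
    (hu : ∀ i, ∀ z ∈ ball z0 R, HasDerivAt (u i) ((A i).eval z / W.eval z) z)
    (hA : ∀ (c : σ → ℂ) (p r : ℂ[X]), p ≠ 0 → W * (p * derivative r - derivative p * r) = p ^ 2 * ∑ i, C (c i) * A i → c = 0)
    (P : MvPolynomial σ ℂ[X]) (hP : ∀ z ∈ ball z0 R, th u z P = 0) : P = 0 := by
  have hW : W ≠ 0 := by
    rintro rfl
    exact hz z0 (mem_ball_self hR) (by simp)
  refine stable_ideal W hW A (⨅ z ∈ ball z0 R, RingHom.ker (th u z)) ?_ ?_ hA P ?_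
  · intro P hP
    simp only [Ideal.mem_iInf, RingHom.mem_ker] at hP ⊢
    intro z hzz
    have h1 := th_deriv u W A z (hz z hzz) (fun i => hu i z hzz) P
    have h2 : (fun z => th u z P) =ᶠ[nhds z] fun _ => 0 := by
      filter_upwards [isOpen_ball.mem_nhds hzz] with w hw
      exact hP w hw
    have h3 := h1.congr_of_eventuallyEq h2.symm
    have h4 := h3.unique (hasDerivAt_const z 0)
    exact (div_eq_zero_iff.1 h4).resolve_right (hz z hzz)
  · intro p hp
    simp only [Ideal.mem_iInf, RingHom.mem_ker, th_C] at hp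
    apply eq_zero_of_infinite_isRoot
    refine Set.Infinite.mono (s := ball z0 R) (fun z hz => hp z hz) ?_
    exact infinite_of_mem_nhds z0 (ball_mem_nhds z0 hR)
  · simpa only [Ideal.mem_iInf, RingHom.mem_ker] using hP

end BMZ

end PartAlg2

section PartLogs

open Polynomial

namespace BMZ
open Metric

variable {m : ℕ} {f g : Fin m → ℤ[X]}

noncomputable def Data.qc (D : Data m f g) (j : Fin D.s) : ℂ[X] := (D.q j).map (Int.castRingHom ℂ)

lemma Data.qc_eval (D : Data m f g) (j : Fin D.s) (z : ℂ) : (D.qc j).eval z = ev z (D.q j) := by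
  rw [Data.qc, eval_map, ev_apply]

noncomputable def Data.W (D : Data m f g) : ℂ[X] := ∏ j, D.qc j

noncomputable def Data.A (D : Data m f g) (k : Fin m → ℤ) : ℂ[X] :=
  ∑ j, C (D.e k j : ℂ) * (derivative (D.qc j) * ∏ l ∈ Finset.univ.erase j, D.qc l)

lemma Data.A_div (D : Data m f g) (k : Fin m → ℤ) (z : ℂ) (hz : ∀ j, (D.qc j).eval z ≠ 0) :
    (D.A k).eval z / D.W.eval z = ∑ j, (D.e k j : ℂ) * ((derivative (D.qc j)).eval z / (D.qc j).eval z) := by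
  rw [Data.A, Data.W, eval_finsetSum, Finset.sum_div]
  refine Finset.sum_congr rfl fun j _ => ?_
  rw [← Finset.mul_prod_erase _ _ (Finset.mem_univ j), eval_mul, eval_mul, eval_mul, eval_C]
  have h1 : eval z (∏ l ∈ Finset.univ.erase j, D.qc l) ≠ 0 := by
    rw [eval_prod]; exact Finset.prod_ne_zero_iff.2 fun l _ => hz l
  have h2 := hz j
  field_simp

lemma Data.hA (D : Data m f g) (a b : Fin m → ℤ) (hab : LinearIndependent ℤ ![a, b]) (t : ℂ) (ht : t ≠ 0)
    (c : Fin 2 → ℂ) (p r : ℂ[X]) (hp : p ≠ 0)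
    (h : D.W * (p * derivative r - derivative p * r) = p ^ 2 * ∑ i, C (c i) * (![C t * D.A a, C t * D.A b] : Fin 2 → ℂ[X]) i) : c = 0 := by
  have key : ∀ j, c 0 * D.e a j + c 1 * D.e b j = 0 := by
    intro j
    obtain ⟨β, hβ⟩ := Complex.exists_root (f := D.qc j) (by
      rw [← natDegree_pos_iff_degree_pos, Data.qc, natDegree_map_eq_of_injective (RingHom.injective_int _)]
      exact D.deg_pos j)
    have hβ' : (D.qc j).eval β = 0 := hβ
    obtain ⟨h0, hh0⟩ := dvd_iff_isRoot.2 hβ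
    have hl : ∀ l ∈ Finset.univ.erase j, (D.qc l).eval β ≠ 0 := by
      intro l hl h1
      obtain ⟨R, hR, A, B, hAB⟩ := D.bez j l (Finset.ne_of_mem_erase hl).symm
      have h2 := congrArg (ev β) hAB
      rw [map_add, map_mul, map_mul, ev_C, ← D.qc_eval, ← D.qc_eval, h1, hβ'] at h2
      simp at h2
      exact hR (by exact_mod_cast h2.symm)
    have hl' : eval β (∏ l ∈ Finset.univ.erase j, D.qc l) ≠ 0 := by
      rw [eval_prod]; exact Finset.prod_ne_zero_iff.2 hl
    have hd : (derivative (D.qc j)).eval β ≠ 0 := by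
      have hs : (D.qc j).Separable := D.sep j
      rw [separable_def] at hs
      obtain ⟨A, B, hAB⟩ := hs
      intro h1
      have h2 := congrArg (eval β) hAB
      simp [h1, hβ'] at h2
    have hd' : h0.eval β = (derivative (D.qc j)).eval β := by
      rw [hh0, derivative_mul]; simp
    have hAe : ∀ k, (D.A k).eval β = D.e k j * ((derivative (D.qc j)).eval β * eval β (∏ l ∈ Finset.univ.erase j, D.qc l)) := by
      intro k
      rw [Data.A, eval_finsetSum, Finset.sum_eq_single j]
      · simp
      · intro l _ hlj
        rw [eval_mul, eval_mul, eval_prod, Finset.prod_eq_zero (Finset.mem_erase.2 ⟨hlj.symm, Finset.mem_univ _⟩) hβ']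
        simp
      · simp
    have := pole_arg (h0 * ∏ l ∈ Finset.univ.erase j, D.qc l) p r
      (∑ i, C (c i) * (![C t * D.A a, C t * D.A b] : Fin 2 → ℂ[X]) i) β hp
      (by rw [eval_mul, hd']; exact mul_ne_zero hd hl') (by
        rw [← h, Data.W, ← Finset.mul_prod_erase _ _ (Finset.mem_univ j), hh0]; ring)
    rw [Fin.sum_univ_two] at this
    simp only [Matrix.cons_val_zero, Matrix.cons_val_one, eval_add, eval_mul, eval_C, hAe] at this
    have h3 : t * ((derivative (D.qc j)).eval β * eval β (∏ l ∈ Finset.univ.erase j, D.qc l)) *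
        (c 0 * D.e a j + c 1 * D.e b j) = 0 := by linear_combination this
    exact (mul_eq_zero.1 h3).resolve_left (mul_ne_zero ht (mul_ne_zero hd hl'))
  have h4 := D.linIndep ℂ
  rw [Fintype.linearIndependent_iff] at h4
  have h5 := h4 (fun i => c 0 * a i + c 1 * b i) (by
    funext j
    have := key j
    simp only [Data.e] at this
    push_cast at this
    rw [Finset.mul_sum, Finset.mul_sum, ← Finset.sum_add_distrib] at this
    simp only [Finset.sum_apply, Pi.smul_apply, smul_eq_mul, Pi.zero_apply]
    rw [← this]
    refine Finset.sum_congr rfl fun i _ => ?_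
    push_cast; ring)
  have h6 : LinearIndependent ℂ (fun n : Fin 2 => fun i : Fin m => ((![a, b] n i : ℤ) : ℂ)) :=
    (linearIndependent_algebraMap_comp_iff (R := ℤ) (S := ℂ)).2 hab
  rw [Fintype.linearIndependent_iff] at h6
  funext n
  refine h6 c ?_ n
  funext i
  simpa [Fin.sum_univ_two] using h5 i

lemma exists_log (q : ℂ[X]) (z0 : ℂ) (R : ℝ) (hR : 0 < R) (hq : ∀ z ∈ ball z0 R, q.eval z ≠ 0) :
    ∃ L : ℂ → ℂ, (∀ z ∈ ball z0 R, HasDerivAt L ((derivative q).eval z / q.eval z) z) ∧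
      ∀ z ∈ ball z0 R, Complex.exp (L z) = q.eval z := by
  obtain ⟨L, hL⟩ := DifferentiableOn.isExactOn_ball (c := z0) (r := R)
    (f := fun z => (derivative q).eval z / q.eval z)
    (DifferentiableOn.div (derivative q).differentiable.differentiableOn q.differentiable.differentiableOn hq)
  have h0 := mem_ball_self hR (x := z0)
  set κ := Complex.log (q.eval z0) - L z0
  have hd : ∀ z ∈ ball z0 R, HasDerivAt (fun z => Complex.exp (-(κ + L z)) * q.eval z) 0 z := by
    intro z hz
    have h1 := (((hL z hz).const_add κ).neg.cexp).mul (q.hasDerivAt z)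
    refine h1.congr_deriv ?_
    have := hq z hz
    simp only [Pi.neg_apply]
    field_simp
    ring
  refine ⟨fun z => κ + L z, fun z hz => (hL z hz).const_add κ, fun z hz => ?_⟩
  have hconst := (convex_ball z0 R).is_const_of_fderivWithin_eq_zero (𝕜 := ℂ)
    (f := fun z => Complex.exp (-(κ + L z)) * q.eval z)
    (fun z hz => (hd z hz).differentiableAt.differentiableWithinAt)
    (fun z hz => by
      rw [fderivWithin_of_isOpen isOpen_ball hz]
      rw [(hd z hz).hasFDerivAt.fderiv]; ext; simp) hz h0
  have h1 : Complex.exp (-(κ + L z0)) * q.eval z0 = 1 := by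
    have : κ + L z0 = Complex.log (q.eval z0) := by ring
    rw [this, Complex.exp_neg, Complex.exp_log (hq z0 h0), inv_mul_cancel₀ (hq z0 h0)]
  rw [h1, Complex.exp_neg] at hconst
  field_simp [Complex.exp_ne_zero] at hconst
  exact hconst.symm

/-- branches of logarithms of the functions -/
lemma Data.logs (D : Data m f g) (z0 : ℂ) (R : ℝ) (hR : 0 < R) (hq : ∀ z ∈ ball z0 R, Good f g z) :
    ∃ l : Fin m → ℂ → ℂ, (∀ k : Fin m → ℤ, ∀ z ∈ ball z0 R, HasDerivAt (fun z => ∑ i, (k i : ℂ) * l i z) ((D.A k).eval z / D.W.eval z) z) ∧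
      (∀ i, DifferentiableOn ℂ (l i) (ball z0 R)) ∧
      ∀ k : Fin m → ℤ, ∀ z ∈ ball z0 R, Complex.exp (∑ i, (k i : ℂ) * l i z) = val f g z k := by
  have hq' : ∀ j, ∀ z ∈ ball z0 R, (D.qc j).eval z ≠ 0 := fun j z hz => by
    rw [D.qc_eval]; exact D.q_ev_ne (hq z hz) j
  choose L hL1 hL2 using fun j => exists_log (D.qc j) z0 R hR (hq' j)
  set l : Fin m → ℂ → ℂ := fun i z => Complex.log ((D.c i : ℂ) / D.c' i) + ∑ j, (((D.u i j : ℤ) - D.w i j : ℤ) : ℂ) * L j z with hl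
  have e : ∀ (k : Fin m → ℤ) z, ∑ i, (k i : ℂ) * l i z =
      ∑ i, (k i : ℂ) * Complex.log ((D.c i : ℂ) / D.c' i) + ∑ j, (D.e k j : ℂ) * L j z := by
    intro k z
    simp only [hl, mul_add, Finset.sum_add_distrib]
    congr 1
    simp only [Data.e, Finset.mul_sum]
    rw [Finset.sum_comm]
    refine Finset.sum_congr rfl fun j _ => ?_
    push_cast
    rw [Finset.sum_mul]
    refine Finset.sum_congr rfl fun i _ => by ring
  refine ⟨l, ?_, ?_, ?_⟩
  · intro k z hz
    simp only [e]
    rw [D.A_div k z (fun j => hq' j z hz)]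
    refine HasDerivAt.const_add _ ?_
    exact HasDerivAt.fun_sum fun j _ => (hL1 j z hz).const_mul _
  · intro i
    simp only [hl]
    refine (differentiableOn_const _).add ?_
    refine DifferentiableOn.fun_sum fun j _ => ?_
    exact (differentiableOn_const _).mul fun z hz => (hL1 j z hz).differentiableAt.differentiableWithinAt
  · intro k z hz
    rw [e, D.val_eq (fun j => D.q_ev_ne (hq z hz) j), Complex.exp_add, Complex.exp_sum, Complex.exp_sum]
    congr 1
    · refine Finset.prod_congr rfl fun i _ => ?_
      rw [Complex.exp_int_mul, Complex.exp_log]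
      exact div_ne_zero (by exact_mod_cast D.c_ne i) (by exact_mod_cast D.c'_ne i)
    · refine Finset.prod_congr rfl fun j _ => ?_
      rw [Complex.exp_int_mul, hL2 j z hz, D.qc_eval]

lemma Data.nonvanish (D : Data m f g) (z0 : ℂ) (R : ℝ) (hR : 0 < R) (hq : ∀ z ∈ ball z0 R, Good f g z)
    (l : Fin m → ℂ → ℂ) (hl : ∀ k : Fin m → ℤ, ∀ z ∈ ball z0 R, HasDerivAt (fun z => ∑ i, (k i : ℂ) * l i z) ((D.A k).eval z / D.W.eval z) z)
    (t : ℂ) (ht : t ≠ 0) (a b : Fin m → ℤ) (hab : LinearIndependent ℤ ![a, b]) (N : ℕ) (x : Fin N × Fin N → ℂ) (hx : x ≠ 0) :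
    ∃ z ∈ ball z0 R, ∑ p, x p * (t * ∑ i, (a i : ℂ) * l i z) ^ (p.1 : ℕ) * (t * ∑ i, (b i : ℂ) * l i z) ^ (p.2 : ℕ) ≠ 0 := by
  classical
  by_contra hcon
  push Not at hcon
  set u : Fin 2 → ℂ → ℂ := ![fun z => t * ∑ i, (a i : ℂ) * l i z, fun z => t * ∑ i, (b i : ℂ) * l i z] with hu
  let ex : Fin N × Fin N → (Fin 2 →₀ ℕ) := fun p => Finsupp.single 0 (p.1 : ℕ) + Finsupp.single 1 (p.2 : ℕ)
  have hex : Function.Injective ex := by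
    intro p p' h
    have h0 := DFunLike.congr_fun h 0
    have h1 := DFunLike.congr_fun h 1
    simp [ex] at h0 h1
    exact Prod.ext (Fin.ext h0) (Fin.ext h1)
  set P : MvPolynomial (Fin 2) ℂ[X] := ∑ p, MvPolynomial.monomial (ex p) (C (x p)) with hP
  have hP0 : P = 0 := by
    refine alg_indep u D.W ![C t * D.A a, C t * D.A b] z0 R hR ?_ ?_ (D.hA a b hab t ht) P ?_
    · intro z hz
      rw [Data.W, eval_prod]
      refine Finset.prod_ne_zero_iff.2 fun j _ => ?_
      rw [D.qc_eval]; exact D.q_ev_ne (hq z hz) j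
    · intro i z hz
      have hk : ∀ k : Fin m → ℤ, HasDerivAt (fun z => t * ∑ i, (k i : ℂ) * l i z) ((C t * D.A k).eval z / D.W.eval z) z := by
        intro k
        rw [eval_mul, eval_C, mul_div_assoc]
        exact (hl k z hz).const_mul t
      fin_cases i
      · exact hk a
      · exact hk b
    · intro z hz
      rw [← hcon z hz, hP, map_sum]
      refine Finset.sum_congr rfl fun p _ => ?_
      have : MvPolynomial.monomial (ex p) (C (x p)) = MvPolynomial.C (C (x p)) * MvPolynomial.X 0 ^ (p.1 : ℕ) * MvPolynomial.X 1 ^ (p.2 : ℕ) := by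
        rw [MvPolynomial.X_pow_eq_monomial, MvPolynomial.X_pow_eq_monomial, MvPolynomial.C_mul_monomial, MvPolynomial.monomial_mul]
        simp [ex]
      rw [this, map_mul, map_mul, map_pow, map_pow, th_C, th_X, th_X, eval_C]
      simp [hu]
  apply hx
  funext p
  have := congrArg (MvPolynomial.coeff (ex p)) hP0
  rw [hP, MvPolynomial.coeff_sum] at this
  simp only [MvPolynomial.coeff_monomial, hex.eq_iff] at this
  simpa using this

end BMZ

end PartLogs

section PartCluster

open Polynomial

namespace BMZ
open Metric

section
attribute [local instance] Matrix.seminormedAddCommGroup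

lemma siegel {α β : Type} [Fintype α] [Fintype β] (hc : Fintype.card β = 2 * Fintype.card α) (h0 : 0 < Fintype.card α)
    (A : α → β → ℤ) (B : ℝ) (hB : 1 ≤ B) (hA : ∀ i j, |(A i j : ℝ)| ≤ B) :
    ∃ t : β → ℤ, t ≠ 0 ∧ (∀ i, ∑ j, A i j * t j = 0) ∧ ∀ j, |(t j : ℝ)| ≤ Fintype.card β * B := by
  obtain ⟨t, h1, h2, h3⟩ := Int.Matrix.exists_ne_zero_int_vec_norm_le (Matrix.of A) (by omega) h0
  refine ⟨t, h1, fun i => congrFun h2 i, fun j => ?_⟩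
  have e : (Fintype.card α : ℝ) / ((Fintype.card β : ℝ) - Fintype.card α) = 1 := by
    rw [hc]; push_cast
    have : (0:ℝ) < Fintype.card α := by exact_mod_cast h0
    rw [div_eq_one_iff_eq] <;> linarith
  rw [e, Real.rpow_one] at h3
  have h4 : ‖t j‖ ≤ ‖t‖ := norm_le_pi_norm t j
  rw [Int.norm_eq_abs] at h4
  refine (h4.trans h3).trans ?_
  gcongr
  refine max_le hB ?_
  rw [Matrix.norm_le_iff (by linarith)]
  intro i j
  rw [Int.norm_eq_abs]
  exact hA i j

end

lemma cluster (z0 : ℂ) (r : ℝ) (hr : 0 < r) (E : ℕ) (hE : 0 < E) (n0 : ℕ) (u v : ℂ → ℂ)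
    (hu : DifferentiableOn ℂ u (ball z0 (8 * r))) (hv : DifferentiableOn ℂ v (ball z0 (8 * r)))
    (hn0 : ∀ x : Fin (16 * E) × Fin (16 * E) → ℂ, x ≠ 0 → ∀ S : Finset ℂ, (∀ s ∈ S, s ∈ closedBall z0 r) →
      (∀ s ∈ S, ∑ p, x p * u s ^ (p.1 : ℕ) * v s ^ (p.2 : ℕ) = 0) → S.card ≤ n0)
    (P : ℕ) (hP : (16 * E) ^ 4 ≤ P) (hub : ∀ z ∈ closedBall z0 (4 * r), ‖u z‖ ≤ (P:ℝ) ^ E)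
    (hvb : ∀ z ∈ closedBall z0 (4 * r), ‖v z‖ ≤ (P:ℝ) ^ E) (S : Finset ℂ) (hS : ∀ s ∈ S, s ∈ closedBall z0 r)
    (hSd : ∀ s ∈ S, ∀ t ∈ S, ‖s - t‖ ≤ r / P) (hui : ∀ s ∈ S, ∃ n : ℤ, u s = n) (hvi : ∀ s ∈ S, ∃ n : ℤ, v s = n) :
    S.card ≤ n0 + 128 * E ^ 2 := by
  classical
  by_contra hcon
  push Not at hcon
  obtain ⟨S0, hS0, hcard⟩ := Finset.exists_subset_card_eq (s := S) (n := 128 * E ^ 2) (by omega)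
  choose! U hU using hui
  choose! V hV using hvi
  have hP1 : (1:ℝ) ≤ P := by
    have : 0 < (16 * E) ^ 4 := by positivity
    exact_mod_cast this.trans_le hP
  have hmon : ∀ (p : Fin (16 * E) × Fin (16 * E)) (x y : ℝ), 0 ≤ x → 0 ≤ y → x ≤ (P:ℝ) ^ E → y ≤ (P:ℝ) ^ E → x ^ (p.1:ℕ) * y ^ (p.2 : ℕ) ≤ (P:ℝ) ^ (32 * E ^ 2) := by
    intro p x y hx hy hx1 hy1
    calc x ^ (p.1:ℕ) * y ^ (p.2 : ℕ) ≤ ((P:ℝ) ^ E) ^ (p.1 : ℕ) * ((P:ℝ) ^ E) ^ (p.2 : ℕ) := by gcongr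
      _ ≤ ((P:ℝ) ^ E) ^ (16 * E) * ((P:ℝ) ^ E) ^ (16 * E) := by
        have h1 : (1:ℝ) ≤ (P:ℝ) ^ E := one_le_pow₀ hP1
        have := p.1.2.le
        have := p.2.2.le
        gcongr <;> assumption
      _ = _ := by rw [← pow_mul, ← pow_add]; ring_nf
  have hcard' : Fintype.card S0 = 128 * E ^ 2 := by simp [hcard]
  have hS4 : ∀ s ∈ S, s ∈ closedBall z0 (4 * r) := fun s hs => closedBall_subset_closedBall (by linarith) (hS s hs)
  obtain ⟨x, hx0, hx1, hx2⟩ := siegel (α := S0) (β := Fin (16 * E) × Fin (16 * E)) (by rw [hcard']; simp; ring)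
    (by rw [hcard']; positivity) (fun s p => U s ^ (p.1 : ℕ) * V s ^ (p.2 : ℕ)) ((P:ℝ) ^ (32 * E ^ 2)) (one_le_pow₀ hP1) (by
      intro s p
      have hs := hS0 s.2
      push_cast
      rw [abs_mul, abs_pow, abs_pow]
      refine hmon p _ _ (abs_nonneg _) (abs_nonneg _) ?_ ?_
      · have := hub s (hS4 s hs)
        rwa [hU s hs, Complex.norm_intCast] at this
      · have := hvb s (hS4 s hs)
        rwa [hV s hs, Complex.norm_intCast] at this)
  set G : ℂ → ℂ := fun z => ∑ p, (x p : ℂ) * u z ^ (p.1 : ℕ) * v z ^ (p.2 : ℕ) with hG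
  have hGd : DifferentiableOn ℂ G (ball z0 (8 * r)) := by
    refine DifferentiableOn.fun_sum fun p _ => ?_
    exact ((differentiableOn_const _).mul (hu.pow _)).mul (hv.pow _)
  have hGi : ∀ s ∈ S, G s = ((∑ p : Fin (16 * E) × Fin (16 * E), U s ^ (p.1 : ℕ) * V s ^ (p.2 : ℕ) * x p : ℤ) : ℂ) := by
    intro s hs
    simp only [hG, hU s hs, hV s hs]
    push_cast
    exact Finset.sum_congr rfl fun p _ => by ring
  have hG0 : ∀ s ∈ S0, G s = 0 := by
    intro s hs
    rw [hGi s (hS0 hs), hx1 ⟨s, hs⟩]; simp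
  have hcb : ((Fintype.card (Fin (16 * E) × Fin (16 * E)) : ℕ) : ℝ) = (16 * E) ^ 2 := by
    simp; ring
  rw [hcb] at hx2
  have hGM : ∀ z ∈ closedBall z0 (4 * r), ‖G z‖ ≤ (P:ℝ) ^ (1 + 64 * E ^ 2) := by
    intro z hz
    refine (norm_sum_le _ _).trans ?_
    calc _ ≤ ∑ p : Fin (16 * E) × Fin (16 * E), ((16 * E : ℝ) ^ 2 * (P:ℝ) ^ (32 * E ^ 2)) * (P:ℝ) ^ (32 * E ^ 2) := by
          refine Finset.sum_le_sum fun p _ => ?_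
          rw [mul_assoc, norm_mul, norm_mul, norm_pow, norm_pow, Complex.norm_intCast]
          exact mul_le_mul (hx2 p) (hmon p _ _ (norm_nonneg _) (norm_nonneg _) (hub z hz) (hvb z hz)) (by positivity) (by positivity)
      _ = ((16 * E : ℝ)) ^ 4 * (P:ℝ) ^ (64 * E ^ 2) := by
          rw [Finset.sum_const, nsmul_eq_mul, Finset.card_univ, hcb]
          ring
      _ ≤ P * (P:ℝ) ^ (64 * E ^ 2) := by
          gcongr
          exact_mod_cast hP
      _ = _ := by rw [pow_add, pow_one]
  have hGS : ∀ s ∈ S, G s = 0 := by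
    intro s hs
    have h1 := schwarz z0 r hr G hGd S0 (fun s hs => hS s (hS0 hs)) hG0 _ hGM s (hS s hs)
    have h2 : ∏ t ∈ S0, ‖s - t‖ ≤ (r / P) ^ S0.card := by
      rw [← Finset.prod_const]
      exact Finset.prod_le_prod (fun _ _ => norm_nonneg _) fun t ht => hSd s hs t (hS0 ht)
    have h3 : ‖G s‖ < 1 := by
      have hPp : (0:ℝ) < P := by linarith
      calc ‖G s‖ ≤ (r / P) ^ S0.card * ((P:ℝ) ^ (1 + 64 * E ^ 2) / (3 * r) ^ S0.card) := h1.trans (by gcongr)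
        _ = (P:ℝ) ^ (1 + 64 * E ^ 2) / (3 * (P:ℝ)) ^ S0.card := by
          rw [div_pow, mul_pow, mul_pow]; field_simp
        _ < 1 := by
          rw [div_lt_one (by positivity), hcard]
          calc (P:ℝ) ^ (1 + 64 * E ^ 2) ≤ (P:ℝ) ^ (128 * E ^ 2) := by
                apply pow_le_pow_right₀ hP1
                nlinarith
            _ < (3 * (P:ℝ)) ^ (128 * E ^ 2) := by
                apply pow_lt_pow_left₀ (by linarith) (by linarith)
                positivity
    rw [hGi s hs] at h3 ⊢
    rw [Complex.norm_intCast] at h3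
    have h4 : |∑ p : Fin (16 * E) × Fin (16 * E), U s ^ (p.1 : ℕ) * V s ^ (p.2 : ℕ) * x p| < 1 := by exact_mod_cast h3
    rw [Int.abs_lt_one_iff] at h4
    rw [h4]; simp
  have := hn0 (fun p => (x p : ℂ)) (by
    intro h
    apply hx0
    funext p
    have := congrFun h p; simpa using this) S hS hGS
  omega

lemma grid (z0 : ℂ) (r : ℝ) (hr : 0 < r) (P : ℕ) (hP : 0 < P) (n : ℕ) (Z : Finset ℂ) (hZ : ∀ s ∈ Z, s ∈ closedBall z0 r)
    (h : ∀ S ⊆ Z, (∀ s ∈ S, ∀ t ∈ S, ‖s - t‖ ≤ r / P) → S.card ≤ n) : Z.card ≤ n * (5 * P) ^ 2 := by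
  classical
  have hP' : (0:ℝ) < P := by exact_mod_cast hP
  set F : ℂ → ℤ × ℤ := fun z => (⌊2 * P / r * (z - z0).re⌋, ⌊2 * P / r * (z - z0).im⌋) with hF
  have hmap : ∀ z ∈ Z, F z ∈ (Finset.Icc (-(2 * P : ℤ)) (2 * P)) ×ˢ (Finset.Icc (-(2 * P : ℤ)) (2 * P)) := by
    intro z hz
    have h1 := hZ z hz
    rw [mem_closedBall, dist_eq_norm] at h1
    have key : ∀ y : ℝ, |y| ≤ ‖z - z0‖ → ⌊2 * P / r * y⌋ ∈ Finset.Icc (-(2 * P : ℤ)) (2 * P) := by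
      intro y hy
      have h2 := abs_le.1 (hy.trans h1)
      rw [Finset.mem_Icc]
      constructor
      · rw [Int.le_floor]
        push_cast
        rw [div_mul_eq_mul_div, le_div_iff₀ hr]
        nlinarith
      · have : (⌊2 * P / r * y⌋ : ℝ) ≤ 2 * P := by
          refine (Int.floor_le _).trans ?_
          rw [div_mul_eq_mul_div, div_le_iff₀ hr]
          nlinarith
        exact_mod_cast this
    rw [Finset.mem_product]
    exact ⟨key _ (Complex.abs_re_le_norm _), key _ (Complex.abs_im_le_norm _)⟩
  have h2 := Finset.card_le_mul_card_image_of_maps_to hmap n (fun b _ => by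
    refine h _ (Finset.filter_subset _ _) ?_
    intro s hs t ht
    rw [Finset.mem_filter] at hs ht
    have e : F s = F t := hs.2.trans ht.2.symm
    simp only [hF, Prod.mk.injEq] at e
    have key : ∀ x y : ℝ, ⌊2 * P / r * x⌋ = ⌊2 * P / r * y⌋ → |x - y| ≤ r / (2 * P) := by
      intro x y hxy
      have := Int.abs_sub_lt_one_of_floor_eq_floor hxy
      rw [← mul_sub, abs_mul, abs_of_pos (by positivity)] at this
      rw [le_div_iff₀ (by positivity)]
      rw [div_mul_eq_mul_div, div_lt_one hr] at this
      linarith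
    have h3 := key _ _ e.1
    have h4 := key _ _ e.2
    have h5 := Complex.norm_le_abs_re_add_abs_im (s - t)
    simp only [Complex.sub_re, Complex.sub_im, sub_sub_sub_cancel_right] at h3 h4 h5
    have : r / P = r / (2 * P) + r / (2 * P) := by field_simp; ring
    linarith)
  refine h2.trans ?_
  rw [Finset.card_product, Int.card_Icc]
  gcongr
  rw [← sq]
  have : (2 * (P:ℤ) + 1 - -(2 * P)).toNat = 4 * P + 1 := by omega
  rw [this]
  gcongr
  omega

end BMZ

end PartCluster

section PartLocal

open Polynomial

namespace BMZ
open Metric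

/-- functions differentiable on a set -/
def diffAlg (U : Set ℂ) : Subalgebra ℂ (ℂ → ℂ) where
  carrier := {g | DifferentiableOn ℂ g U}
  mul_mem' := fun ha hb => DifferentiableOn.mul ha hb
  add_mem' := fun ha hb => DifferentiableOn.add ha hb
  algebraMap_mem' := fun c => differentiableOn_const (c := c)

lemma exists_space {m : ℕ} (U : Set ℂ) (l : Fin m → ℂ → ℂ) (hl : ∀ i, DifferentiableOn ℂ (l i) U) (N : ℕ) :
    ∃ V : Submodule ℂ (ℂ → ℂ), V.FG ∧ (∀ g ∈ V, DifferentiableOn ℂ g U) ∧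
      ∀ (t : ℂ) (a b : Fin m → ℤ) (x : Fin N × Fin N → ℂ),
        (fun z => ∑ p, x p * (t * ∑ i, (a i : ℂ) * l i z) ^ (p.1 : ℕ) * (t * ∑ i, (b i : ℂ) * l i z) ^ (p.2 : ℕ)) ∈ V := by
  set E : Submodule ℂ (ℂ → ℂ) := Submodule.span ℂ (insert 1 (Set.range l)) with hE
  have hEfg : E.FG := Submodule.fg_span ((Set.finite_range l).insert 1)
  have h1 : (1 : Submodule ℂ (ℂ → ℂ)) ≤ E := by
    rw [Submodule.one_le]
    exact Submodule.subset_span (Set.mem_insert _ _)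
  have hES : E ≤ Subalgebra.toSubmodule (diffAlg U) := by
    rw [hE, Submodule.span_le]
    rintro g (rfl | ⟨i, rfl⟩)
    · exact (diffAlg U).one_mem
    · exact hl i
  have hpow : ∀ n, E ^ n ≤ Subalgebra.toSubmodule (diffAlg U) := by
    intro n
    induction n with
    | zero =>
      rw [pow_zero, Submodule.one_le]
      exact (diffAlg U).one_mem
    | succ n ih =>
      rw [pow_succ, Submodule.mul_le]
      intro x hx y hy
      exact (diffAlg U).mul_mem (ih hx) (hES hy)
  have hmem : ∀ (t : ℂ) (a : Fin m → ℤ), (fun z => t * ∑ i, (a i : ℂ) * l i z) ∈ E := by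
    intro t a
    have : (fun z => t * ∑ i, (a i : ℂ) * l i z) = t • ∑ i, (a i : ℂ) • l i := by
      funext z; simp
    rw [this]
    exact E.smul_mem _ (E.sum_mem fun i _ => E.smul_mem _ (Submodule.subset_span (Set.mem_insert_of_mem _ ⟨i, rfl⟩)))
  refine ⟨E ^ (N + N), hEfg.pow _, fun g hg => hpow _ hg, fun t a b x => ?_⟩
  have : (fun z => ∑ p, x p * (t * ∑ i, (a i : ℂ) * l i z) ^ (p.1 : ℕ) * (t * ∑ i, (b i : ℂ) * l i z) ^ (p.2 : ℕ)) =
      ∑ p, x p • ((fun z => t * ∑ i, (a i : ℂ) * l i z) ^ (p.1 : ℕ) * (fun z => t * ∑ i, (b i : ℂ) * l i z) ^ (p.2 : ℕ)) := by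
    funext z; simp [mul_assoc]
  rw [this]
  refine Submodule.sum_mem _ fun p _ => Submodule.smul_mem _ _ ?_
  have h2 := Submodule.mul_mem_mul (Submodule.pow_mem_pow E (hmem t a) (p.1:ℕ)) (Submodule.pow_mem_pow E (hmem t b) (p.2:ℕ))
  rw [← pow_add] at h2
  refine pow_le_pow_right' h1 ?_ h2
  have := p.1.2; have := p.2.2; omega

variable {m : ℕ} {f g : Fin m → ℤ[X]}

lemma exists_root4 (d : ℕ) (hd : 0 < d) : ∃ P : ℕ, 0 < P ∧ P ^ 4 ≤ d ∧ d ≤ 16 * P ^ 4 := by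
  set s := Nat.sqrt d with hs
  have h1 : s * s ≤ d := Nat.sqrt_le d
  have h2 : d < (s + 1) * (s + 1) := Nat.lt_succ_sqrt d
  have h3 : Nat.sqrt s * Nat.sqrt s ≤ s := Nat.sqrt_le s
  have h4 : s < (Nat.sqrt s + 1) * (Nat.sqrt s + 1) := Nat.lt_succ_sqrt s
  have hs0 : 0 < s := Nat.sqrt_pos.2 hd
  have hP0 : 0 < Nat.sqrt s := Nat.sqrt_pos.2 hs0
  set P := Nat.sqrt s
  refine ⟨P, hP0, ?_, ?_⟩
  · calc P ^ 4 = (P * P) * (P * P) := by ring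
      _ ≤ s * s := Nat.mul_le_mul h3 h3
      _ ≤ d := h1
  · have h5 : s + 1 ≤ 4 * P ^ 2 := by nlinarith
    calc d ≤ (s + 1) * (s + 1) := h2.le
      _ ≤ (4 * P ^ 2) * (4 * P ^ 2) := Nat.mul_le_mul h5 h5
      _ = _ := by ring

lemma Data.local_count (D : Data m f g) (z0 : ℂ) (r : ℝ) (hr : 0 < r) (hq : ∀ z ∈ ball z0 (8 * r), Good f g z) (Cc κ : ℕ) :
    ∃ C1 d0 : ℕ, ∀ d ≥ d0, ∀ a b : Fin m → ℤ, LinearIndependent ℤ ![a, b] → (∀ i, |a i| ≤ Cc * d ^ κ) → (∀ i, |b i| ≤ Cc * d ^ κ) →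
      ∀ Z : Finset ℂ, (∀ z ∈ Z, z ∈ closedBall z0 r ∧ val f g z a = 1 ∧ val f g z b = 1) → Z.card ^ 2 ≤ C1 * d := by
  obtain ⟨l, hl1, hl2, hl3⟩ := D.logs z0 (8 * r) (by linarith) hq
  have hbd : ∀ i, ∃ M : ℕ, ∀ z ∈ closedBall z0 (4 * r), ‖l i z‖ ≤ M := by
    intro i
    obtain ⟨M, hM⟩ := (isCompact_closedBall z0 (4 * r)).exists_bound_of_continuousOn ((hl2 i).continuousOn.mono (closedBall_subset_ball (by linarith)))
    obtain ⟨n, hn⟩ := exists_nat_ge M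
    exact ⟨n, fun z hz => (hM z hz).trans hn⟩
  choose M hM using hbd
  set t : ℂ := (2 * Real.pi * Complex.I)⁻¹ with ht
  have ht0 : t ≠ 0 := inv_ne_zero Complex.two_pi_I_ne_zero
  have htn : ‖t‖ ≤ 1 := by
    rw [ht, norm_inv]
    apply inv_le_one_of_one_le₀
    simp only [norm_mul, Complex.norm_I, Complex.norm_real, Complex.norm_ofNat, Real.norm_eq_abs, abs_of_pos Real.pi_pos]
    linarith [Real.pi_gt_three]
  set E : ℕ := 4 * κ + 1 with hE
  obtain ⟨V, hV1, hV2, hV3⟩ := exists_space (ball z0 (8 * r)) l hl2 (16 * E)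
  obtain ⟨n0, hn0⟩ := zero_estimate z0 r hr V hV1 hV2
  set A : ℕ := ∑ i, Cc * 16 ^ κ * M i with hA
  set P0 : ℕ := (16 * E) ^ 4 + A + 1 with hP0
  refine ⟨((n0 + 128 * E ^ 2) * 25) ^ 2, 16 * P0 ^ 4 + 1, ?_⟩
  intro d hd a b hab ha hb Z hZ
  obtain ⟨P, hPp, hP1, hP2⟩ := exists_root4 d (by omega)
  have hPP : P0 ≤ P := by
    by_contra h
    have : P ^ 4 ≤ P0 ^ 4 := Nat.pow_le_pow_left (by omega) 4
    omega
  have hub : ∀ a : Fin m → ℤ, (∀ i, |a i| ≤ Cc * d ^ κ) → ∀ z ∈ closedBall z0 (4 * r), ‖t * ∑ i, (a i : ℂ) * l i z‖ ≤ (P:ℝ) ^ E := by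
    intro a ha z hz
    calc ‖t * ∑ i, (a i : ℂ) * l i z‖ ≤ 1 * ∑ i, ((Cc * (16 * P ^ 4) ^ κ : ℕ) : ℝ) * M i := by
          rw [norm_mul]
          refine mul_le_mul htn ((norm_sum_le _ _).trans (Finset.sum_le_sum fun i _ => ?_)) (norm_nonneg _) zero_le_one
          rw [norm_mul, Complex.norm_intCast]
          refine mul_le_mul ?_ (hM i z hz) (norm_nonneg _) (by positivity)
          have h1 : |a i| ≤ ((Cc * (16 * P ^ 4) ^ κ : ℕ) : ℤ) := by
            refine (ha i).trans ?_
            have : Cc * d ^ κ ≤ Cc * (16 * P ^ 4) ^ κ := by gcongr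
            exact_mod_cast this
          exact_mod_cast h1
      _ = ((A * P ^ (4 * κ) : ℕ) : ℝ) := by
          rw [hA, one_mul, Finset.sum_mul]
          push_cast
          refine Finset.sum_congr rfl fun i _ => ?_
          rw [mul_pow, ← pow_mul]; ring
      _ ≤ ((P * P ^ (4 * κ) : ℕ) : ℝ) := by
          have : A ≤ P := by omega
          exact_mod_cast Nat.mul_le_mul_right _ this
      _ = _ := by rw [hE, pow_succ]; push_cast; ring
  have hintegral : ∀ a : Fin m → ℤ, ∀ z ∈ closedBall z0 r, val f g z a = 1 → ∃ n : ℤ, t * ∑ i, (a i : ℂ) * l i z = n := by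
    intro a z hz h
    have h1 := hl3 a z (closedBall_subset_ball (by linarith) hz)
    rw [h, Complex.exp_eq_one_iff] at h1
    obtain ⟨n, hn⟩ := h1
    refine ⟨n, ?_⟩
    rw [hn, ht]
    field_simp [Complex.two_pi_I_ne_zero]
  have hdiff : ∀ a : Fin m → ℤ, DifferentiableOn ℂ (fun z => t * ∑ i, (a i : ℂ) * l i z) (ball z0 (8 * r)) := fun a =>
    (DifferentiableOn.fun_sum fun i _ => (hl2 i).const_mul _).const_mul _
  have hcard := grid z0 r hr P hPp (n0 + 128 * E ^ 2) Z (fun s hs => (hZ s hs).1) (fun S hSZ hSd =>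
    cluster z0 r hr E (by omega) n0 (fun z => t * ∑ i, (a i : ℂ) * l i z) (fun z => t * ∑ i, (b i : ℂ) * l i z)
      (hdiff a) (hdiff b) (fun x hx S hS h => hn0 _ (hV3 t a b x) (D.nonvanish z0 (8 * r) (by linarith) hq l hl1 t ht0 a b hab _ x hx) S hS h)
      P (by omega) (hub a ha) (hub b hb) S (fun s hs => (hZ s (hSZ hs)).1) hSd
      (fun s hs => hintegral a s (hZ s (hSZ hs)).1 (hZ s (hSZ hs)).2.1) (fun s hs => hintegral b s (hZ s (hSZ hs)).1 (hZ s (hSZ hs)).2.2))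
  calc Z.card ^ 2 ≤ ((n0 + 128 * E ^ 2) * (5 * P) ^ 2) ^ 2 := Nat.pow_le_pow_left hcard 2
    _ = ((n0 + 128 * E ^ 2) * 25) ^ 2 * P ^ 4 := by ring
    _ ≤ _ := Nat.mul_le_mul_left _ hP1

end BMZ

end PartLocal

section PartPk

open Polynomial

namespace BMZ
variable {m : ℕ} {f g : Fin m → ℤ[X]}

/-- the polynomial of the relation `k` -/
noncomputable def PP (f g : Fin m → ℤ[X]) (k : Fin m → ℤ) : ℤ[X] :=
  (∏ i, f i ^ (k i).toNat) * (∏ i, g i ^ (-k i).toNat) - (∏ i, f i ^ (-k i).toNat) * (∏ i, g i ^ (k i).toNat)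

lemma prod_zpow_eq {ι F : Type*} [Fintype ι] [Field F] (x : ι → F) (hx : ∀ i, x i ≠ 0) (k : ι → ℤ) :
    ∏ i, x i ^ k i = (∏ i, x i ^ (k i).toNat) / ∏ i, x i ^ (-k i).toNat := by
  rw [← Finset.prod_div_distrib]
  refine Finset.prod_congr rfl fun i _ => ?_
  rw [← zpow_natCast, ← zpow_natCast, ← zpow_sub₀ (hx i)]
  congr 1; omega

lemma ev_PP {F : Type*} [Field F] {α : F} (h : Good f g α) (k : Fin m → ℤ) : ev α (PP f g k) = 0 ↔ val f g α k = 1 := by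
  have h1 := fun i => (h i).1
  have h2 := fun i => (h i).2
  have h3 := fun i => div_ne_zero (h1 i) (h2 i)
  rw [val, prod_zpow_eq _ h3]
  simp only [div_pow, Finset.prod_div_distrib, PP, map_sub, map_mul, map_prod, map_pow]
  have a1 : ∏ i, ev α (f i) ^ (-k i).toNat ≠ 0 := Finset.prod_ne_zero_iff.2 fun i _ => pow_ne_zero _ (h1 i)
  have a2 : ∏ i, ev α (g i) ^ (-k i).toNat ≠ 0 := Finset.prod_ne_zero_iff.2 fun i _ => pow_ne_zero _ (h2 i)
  have a3 : ∏ i, ev α (g i) ^ (k i).toNat ≠ 0 := Finset.prod_ne_zero_iff.2 fun i _ => pow_ne_zero _ (h2 i)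
  rw [sub_eq_zero, div_div_div_eq, div_eq_one_iff_eq (mul_ne_zero a3 a1)]
  rw [mul_comm (∏ i, ev α (g i) ^ (k i).toNat)]

/-- constants not vanishing -/
def Data.Nice (D : Data m f g) (F : Type*) [Field F] : Prop :=
  (∀ j, ((D.q j).leadingCoeff : F) ≠ 0) ∧ (∀ i, (D.c i : F) ≠ 0 ∧ (D.c' i : F) ≠ 0) ∧
    ∀ j l, j ≠ l → ∃ R : ℤ, (R : F) ≠ 0 ∧ ∃ A B : ℤ[X], A * D.q j + B * D.q l = C R

lemma Data.exists_nice (D : Data m f g) : ∃ M : ℤ, M ≠ 0 ∧ ∀ (F : Type) [Field F], (M : F) ≠ 0 → D.Nice F := by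
  classical
  have hbez : ∀ j l, ∃ R : ℤ, R ≠ 0 ∧ ∃ A B : ℤ[X], j ≠ l → A * D.q j + B * D.q l = C R := by
    intro j l
    by_cases h : j = l
    · exact ⟨1, one_ne_zero, 0, 0, fun h' => absurd h h'⟩
    · obtain ⟨R, hR, A, B, h⟩ := D.bez j l h
      exact ⟨R, hR, A, B, fun _ => h⟩
  choose R hR A B hAB using hbez
  refine ⟨(∏ j, (D.q j).leadingCoeff) * (∏ i, D.c i) * (∏ i, D.c' i) * ∏ j, ∏ l, R j l, ?_, ?_⟩
  · refine mul_ne_zero (mul_ne_zero (mul_ne_zero ?_ ?_) ?_) ?_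
    · exact Finset.prod_ne_zero_iff.2 fun j _ => leadingCoeff_ne_zero.2 (D.q_ne j)
    · exact Finset.prod_ne_zero_iff.2 fun j _ => D.c_ne j
    · exact Finset.prod_ne_zero_iff.2 fun j _ => D.c'_ne j
    · exact Finset.prod_ne_zero_iff.2 fun j _ => Finset.prod_ne_zero_iff.2 fun l _ => hR j l
  · intro F _ h
    push_cast at h
    simp only [mul_ne_zero_iff, Finset.prod_ne_zero_iff, Finset.mem_univ, true_implies] at h
    exact ⟨h.1.1.1, fun i => ⟨h.1.1.2 i, h.1.2 i⟩, fun j l hjl => ⟨R j l, h.2 j l, A j l, B j l, hAB j l hjl⟩⟩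

lemma ev_eq_eval_map {F : Type*} [Field F] (α : F) (P : ℤ[X]) : ev α P = (P.map (Int.castRingHom F)).eval α := by
  rw [ev_apply, eval_map]

lemma Data.PP_ne (D : Data m f g) (F : Type*) [Field F] [IsAlgClosed F] (hN : D.Nice F) (k : Fin m → ℤ) (hk : k ≠ 0) :
    (PP f g k).map (Int.castRingHom F) ≠ 0 := by
  classical
  intro h0
  obtain ⟨hlead, hc, hbez⟩ := hN
  obtain ⟨j, hj⟩ := D.e_ne hk
  have hinf : Infinite F := IsAlgClosed.instInfinite
  set N1 : ℤ[X] := C (∏ i, (D.c i) ^ (k i).toNat * (D.c' i) ^ (-k i).toNat) * ∏ l, D.q l ^ (D.e k l).toNat with hN1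
  set N2 : ℤ[X] := C (∏ i, (D.c i) ^ (-k i).toNat * (D.c' i) ^ (k i).toNat) * ∏ l, D.q l ^ (-D.e k l).toNat with hN2
  set H : ℤ[X] := (∏ l, D.q l) with hH
  have hqm : ∀ l, (D.q l).map (Int.castRingHom F) ≠ 0 := fun l h => by
    apply hlead l
    have := congrArg (fun p => coeff p (D.q l).natDegree) h
    simpa [coeff_map] using this
  have hHm : H.map (Int.castRingHom F) ≠ 0 := by
    rw [hH, Polynomial.map_prod]
    exact Finset.prod_ne_zero_iff.2 fun l _ => hqm l
  have hev : ∀ α : F, (∀ l, ev α (D.q l) ≠ 0) → ev α N1 = ev α N2 := by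
    intro α hq
    have hgood : Good f g α := by
      intro i
      rw [D.hf i, D.hg i]
      simp only [map_mul, map_prod, map_pow, ev_C]
      exact ⟨mul_ne_zero (hc i).1 (Finset.prod_ne_zero_iff.2 fun l _ => pow_ne_zero _ (hq l)),
        mul_ne_zero (hc i).2 (Finset.prod_ne_zero_iff.2 fun l _ => pow_ne_zero _ (hq l))⟩
    have h1 : val f g α k = 1 := by
      rw [← ev_PP hgood, ev_eq_eval_map, h0, eval_zero]
    rw [D.val_eq hq, prod_zpow_eq _ (fun i => div_ne_zero (hc i).1 (hc i).2), prod_zpow_eq _ hq] at h1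
    simp only [div_pow, Finset.prod_div_distrib] at h1
    have a1 : ∏ i, (D.c i : F) ^ (-k i).toNat ≠ 0 := Finset.prod_ne_zero_iff.2 fun i _ => pow_ne_zero _ (hc i).1
    have a2 : ∏ i, (D.c' i : F) ^ (-k i).toNat ≠ 0 := Finset.prod_ne_zero_iff.2 fun i _ => pow_ne_zero _ (hc i).2
    have a3 : ∏ i, (D.c' i : F) ^ (k i).toNat ≠ 0 := Finset.prod_ne_zero_iff.2 fun i _ => pow_ne_zero _ (hc i).2
    have a4 : ∏ l, ev α (D.q l) ^ (-D.e k l).toNat ≠ 0 := Finset.prod_ne_zero_iff.2 fun l _ => pow_ne_zero _ (hq l)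
    simp only [hN1, hN2, map_mul, map_prod, map_pow, ev_C, Finset.prod_mul_distrib]
    field_simp at h1
    linear_combination h1
  have heq : N1.map (Int.castRingHom F) = N2.map (Int.castRingHom F) := by
    have h2 : (N1.map (Int.castRingHom F) - N2.map (Int.castRingHom F)) * H.map (Int.castRingHom F) = 0 := by
      apply Polynomial.funext
      intro α
      rw [eval_mul, eval_sub, eval_zero, ← ev_eq_eval_map, ← ev_eq_eval_map, ← ev_eq_eval_map]
      by_cases hq : ∀ l, ev α (D.q l) ≠ 0
      · rw [hev α hq, sub_self, zero_mul]
      · push Not at hq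
        obtain ⟨l, hl⟩ := hq
        rw [hH, map_prod, Finset.prod_eq_zero (Finset.mem_univ l) hl, mul_zero]
    exact sub_eq_zero.1 ((mul_eq_zero.1 h2).resolve_right hHm)
  obtain ⟨β, hβ⟩ := IsAlgClosed.exists_root ((D.q j).map (Int.castRingHom F)) (by
    rw [degree_map_eq_of_leadingCoeff_ne_zero _ (by simpa using hlead j)]
    exact (natDegree_pos_iff_degree_pos.1 (D.deg_pos j)).ne')
  have hβ' : ev β (D.q j) = 0 := by rw [ev_eq_eval_map]; exact hβ
  have hβl : ∀ l, l ≠ j → ev β (D.q l) ≠ 0 := by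
    intro l hl h
    obtain ⟨R, hR, A, B, hAB⟩ := hbez l j hl
    apply hR
    rw [← ev_C β, ← hAB, map_add, map_mul, map_mul, h, hβ']
    simp
  have hfin : ev β N1 = ev β N2 := by rw [ev_eq_eval_map, heq, ← ev_eq_eval_map]
  have n1 : ∀ x y : Fin m → ℕ, (∏ i, (D.c i : F) ^ x i * (D.c' i : F) ^ y i) ≠ 0 := by
    intro x y
    exact Finset.prod_ne_zero_iff.2 fun i _ => mul_ne_zero (pow_ne_zero _ (hc i).1) (pow_ne_zero _ (hc i).2)
  have n2 : ∀ x : Fin D.s → ℕ, (∏ l, ev β (D.q l) ^ x l) = 0 ↔ x j ≠ 0 := by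
    intro x
    rw [Finset.prod_eq_zero_iff]
    constructor
    · rintro ⟨l, -, h⟩
      by_cases hlj : l = j
      · subst hlj
        intro hx
        rw [hx, pow_zero] at h
        exact one_ne_zero h
      · exact absurd h (pow_ne_zero _ (hβl l hlj))
    · intro h
      exact ⟨j, Finset.mem_univ _, by rw [hβ', zero_pow h]⟩
  simp only [hN1, hN2, map_mul, ev_C, map_prod, map_pow] at hfin
  rcases lt_or_gt_of_ne hj with h | h
  · have e1 := (n2 (fun l => (-D.e k l).toNat)).2 (by show (-D.e k j).toNat ≠ 0; omega)
    rw [e1, mul_zero] at hfin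
    have := (n2 (fun l => (D.e k l).toNat)).1 ((mul_eq_zero.1 hfin).resolve_left (n1 _ _))
    apply this
    show (D.e k j).toNat = 0
    omega
  · have e1 := (n2 (fun l => (D.e k l).toNat)).2 (by show (D.e k j).toNat ≠ 0; omega)
    rw [e1, mul_zero] at hfin
    have := (n2 (fun l => (-D.e k l).toNat)).1 ((mul_eq_zero.1 hfin.symm).resolve_left (n1 _ _))
    apply this
    show (-D.e k j).toNat = 0
    omega

lemma Data.PP_ne_zero (D : Data m f g) (k : Fin m → ℤ) (hk : k ≠ 0) : PP f g k ≠ 0 := by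
  intro h
  obtain ⟨M, hM, hM'⟩ := D.exists_nice
  exact D.PP_ne ℂ (hM' ℂ (by exact_mod_cast hM)) k hk (by rw [h, Polynomial.map_zero])

end BMZ

end PartPk

section PartDeg

open Polynomial

namespace BMZ
open Metric Height
variable {m : ℕ} {f g : Fin m → ℤ[X]}

lemma sum_emb {K : Type} [Field K] [NumberField K] (y : K) : ∑ φ : K →+* ℂ, Real.posLog ‖φ y‖ ≤ logHeight₁ y := by
  classical
  rw [NumberField.logHeight₁_eq]
  have h1 : 0 ≤ ∑ᶠ v : NumberField.FinitePlace K, Real.posLog (v y) := finsum_nonneg fun v => Real.posLog_nonneg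
  have h2 : ∑ φ : K →+* ℂ, Real.posLog ‖φ y‖ = ∑ v : NumberField.InfinitePlace K, v.mult * Real.posLog (v y) := by
    rw [← Finset.univ.sum_fiberwise (fun φ : K →+* ℂ => NumberField.InfinitePlace.mk φ)]
    refine Finset.sum_congr rfl fun w _ => ?_
    rw [← NumberField.InfinitePlace.card_filter_mk_eq, ← nsmul_eq_mul, ← Finset.sum_const]
    refine Finset.sum_congr rfl fun φ hφ => ?_
    rw [← (Finset.mem_filter.mp hφ).2, NumberField.InfinitePlace.apply]
  linarith

lemma few_emb {K : Type} [Field K] [NumberField K] (y : K) (B : ℝ) (hB : 0 < B) (h : logHeight₁ y ≤ B * Module.finrank ℚ K)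
    (S : Finset (K →+* ℂ)) (hS : ∀ φ ∈ S, Real.exp (4 * B) < ‖φ y‖) : 4 * S.card ≤ Module.finrank ℚ K := by
  have h1 : S.card * (4 * B) ≤ ∑ φ : K →+* ℂ, Real.posLog ‖φ y‖ := by
    calc (S.card * (4 * B) : ℝ) = ∑ φ ∈ S, 4 * B := by simp
      _ ≤ ∑ φ ∈ S, Real.posLog ‖φ y‖ := by
        refine Finset.sum_le_sum fun φ hφ => ?_
        refine le_trans ?_ (log_le_posLog _)
        rw [Real.le_log_iff_exp_le ((Real.exp_pos _).trans (hS φ hφ))]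
        exact (hS φ hφ).le
      _ ≤ _ := Finset.sum_le_sum_of_subset_of_nonneg (Finset.subset_univ _) fun _ _ _ => Real.posLog_nonneg
  have h2 := (h1.trans (sum_emb y)).trans h
  have h3 : ((4 * S.card : ℕ) : ℝ) ≤ Module.finrank ℚ K := by
    push_cast
    by_contra hc
    push Not at hc
    nlinarith
  exact_mod_cast h3

/-- number of conjugates in a compact set avoiding bad points -/
lemma half_emb (B0 B1 : ℝ) (hB0 : 0 < B0) (hB1 : 0 < B1) {K : Type} [Field K] [NumberField K] (γ η : K) (hη : η ≠ 0)
    (h0 : logHeight₁ γ ≤ B0 * Module.finrank ℚ K) (h1 : logHeight₁ η ≤ B1 * Module.finrank ℚ K) :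
    ∃ S : Finset (K →+* ℂ), (∀ φ ∈ S, ‖φ γ‖ ≤ Real.exp (4 * B0) ∧ Real.exp (-(4 * B1)) ≤ ‖φ η‖) ∧ Module.finrank ℚ K ≤ 2 * S.card := by
  classical
  refine ⟨Finset.univ.filter fun φ => ‖φ γ‖ ≤ Real.exp (4 * B0) ∧ Real.exp (-(4 * B1)) ≤ ‖φ η‖, fun φ hφ => (Finset.mem_filter.1 hφ).2, ?_⟩
  have e1 := few_emb γ B0 hB0 h0 (Finset.univ.filter fun φ => Real.exp (4 * B0) < ‖φ γ‖) (fun φ hφ => (Finset.mem_filter.1 hφ).2)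
  have e2 := few_emb η⁻¹ B1 hB1 (by rwa [logHeight₁_inv]) (Finset.univ.filter fun φ => ‖φ η‖ < Real.exp (-(4 * B1))) (fun φ hφ => by
    have := (Finset.mem_filter.1 hφ).2
    rw [map_inv₀, norm_inv]
    rw [lt_inv_comm₀ (Real.exp_pos _) (by simpa using hη), ← Real.exp_neg]
    exact this)
  have e3 : (Finset.univ : Finset (K →+* ℂ)) ⊆ (Finset.univ.filter fun φ => ‖φ γ‖ ≤ Real.exp (4 * B0) ∧ Real.exp (-(4 * B1)) ≤ ‖φ η‖) ∪
     ((Finset.univ.filter fun φ => Real.exp (4 * B0) < ‖φ γ‖) ∪ (Finset.univ.filter fun φ => ‖φ η‖ < Real.exp (-(4 * B1)))) := by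
    intro φ _
    simp only [Finset.mem_union, Finset.mem_filter, Finset.mem_univ, true_and]
    by_cases h : ‖φ γ‖ ≤ Real.exp (4 * B0)
    · by_cases h' : Real.exp (-(4 * B1)) ≤ ‖φ η‖
      · exact Or.inl ⟨h, h'⟩
      · exact Or.inr (Or.inr (not_le.1 h'))
    · exact Or.inr (Or.inl (not_le.1 h))
  have e4 := Finset.card_le_card e3
  have e5 := Finset.card_union_le (Finset.univ.filter fun φ : K →+* ℂ => ‖φ γ‖ ≤ Real.exp (4 * B0) ∧ Real.exp (-(4 * B1)) ≤ ‖φ η‖) ((Finset.univ.filter fun φ : K →+* ℂ => Real.exp (4 * B0) < ‖φ γ‖) ∪ (Finset.univ.filter fun φ : K →+* ℂ => ‖φ η‖ < Real.exp (-(4 * B1))))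
  have e6 := Finset.card_union_le (Finset.univ.filter fun φ : K →+* ℂ => Real.exp (4 * B0) < ‖φ γ‖) (Finset.univ.filter fun φ : K →+* ℂ => ‖φ η‖ < Real.exp (-(4 * B1)))
  rw [Finset.card_univ, NumberField.Embeddings.card K ℂ] at e4
  omega

/-- product of all the polynomials -/
noncomputable def QQ (f g : Fin m → ℤ[X]) : ℤ[X] := ∏ i, f i * g i

lemma good_iff {F : Type*} [Field F] (α : F) : Good f g α ↔ ev α (QQ f g) ≠ 0 := by
  simp [Good, QQ, map_prod, Finset.prod_ne_zero_iff]

/-- compact count -/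
lemma Data.compact_count (D : Data m f g) (Om : Set ℂ) (hOm : IsCompact Om) (hG : ∀ z ∈ Om, Good f g z) (Cc κ : ℕ) :
    ∃ C1 d0 : ℕ, ∀ d ≥ d0, ∀ a b : Fin m → ℤ, LinearIndependent ℤ ![a, b] → (∀ i, |a i| ≤ Cc * d ^ κ) → (∀ i, |b i| ≤ Cc * d ^ κ) →
      ∀ Z : Finset ℂ, (∀ z ∈ Z, z ∈ Om ∧ val f g z a = 1 ∧ val f g z b = 1) → Z.card ^ 2 ≤ C1 * d := by
  classical
  refine hOm.induction_on (p := fun Om => ∃ C1 d0 : ℕ, ∀ d ≥ d0, ∀ a b : Fin m → ℤ, LinearIndependent ℤ ![a, b] → (∀ i, |a i| ≤ Cc * d ^ κ) → (∀ i, |b i| ≤ Cc * d ^ κ) →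
      ∀ Z : Finset ℂ, (∀ z ∈ Z, z ∈ Om ∧ val f g z a = 1 ∧ val f g z b = 1) → Z.card ^ 2 ≤ C1 * d) ?_ ?_ ?_ ?_
  · refine ⟨0, 0, fun d _ a b _ _ _ Z hZ => ?_⟩
    rw [Finset.eq_empty_of_forall_notMem (s := Z) fun z hz => (hZ z hz).1]
    simp
  · rintro s t hst ⟨C1, d0, h⟩
    exact ⟨C1, d0, fun d hd a b hab ha hb Z hZ => h d hd a b hab ha hb Z fun z hz => ⟨hst (hZ z hz).1, (hZ z hz).2⟩⟩
  · rintro s t ⟨C1, d1, h1⟩ ⟨C2, d2, h2⟩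
    refine ⟨2 * C1 + 2 * C2, max d1 d2, fun d hd a b hab ha hb Z hZ => ?_⟩
    have e1 := h1 d (le_of_max_le_left hd) a b hab ha hb (Z.filter (· ∈ s)) fun z hz => by
      rw [Finset.mem_filter] at hz; exact ⟨hz.2, (hZ z hz.1).2⟩
    have e2 := h2 d (le_of_max_le_right hd) a b hab ha hb (Z.filter (· ∈ t)) fun z hz => by
      rw [Finset.mem_filter] at hz; exact ⟨hz.2, (hZ z hz.1).2⟩
    have e3 : Z.card ≤ (Z.filter (· ∈ s)).card + (Z.filter (· ∈ t)).card := by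
      refine le_trans (Finset.card_le_card ?_) (Finset.card_union_le _ _)
      intro z hz
      rcases (hZ z hz).1 with h | h
      · exact Finset.mem_union_left _ (Finset.mem_filter.2 ⟨hz, h⟩)
      · exact Finset.mem_union_right _ (Finset.mem_filter.2 ⟨hz, h⟩)
    set x := (Z.filter (· ∈ s)).card
    set y := (Z.filter (· ∈ t)).card
    calc Z.card ^ 2 ≤ (x + y) ^ 2 := Nat.pow_le_pow_left e3 2
      _ ≤ 2 * x ^ 2 + 2 * y ^ 2 := by
        zify; nlinarith [sq_nonneg ((x:ℤ) - y)]
      _ ≤ _ := by linarith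
  · intro z hz
    have hop : IsOpen {z : ℂ | Good f g z} := by
      have : {z : ℂ | Good f g z} = {z : ℂ | ((QQ f g).map (Int.castRingHom ℂ)).eval z ≠ 0} := by
        ext z; rw [Set.mem_ofPred_eq, good_iff, ev_eq_eval_map]; rfl
      rw [this]
      exact isOpen_ne_fun (Polynomial.continuous _) continuous_const
    obtain ⟨R, hR, hRb⟩ := Metric.isOpen_iff.1 hop z (hG z hz)
    refine ⟨closedBall z (R / 8), mem_nhdsWithin_of_mem_nhds (closedBall_mem_nhds z (by linarith)), ?_⟩
    exact D.local_count z (R / 8) (by linarith) (fun w hw => hRb (by convert hw using 2; ring)) Cc κ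

/-- The BMZ set. -/
def bmz (f g : Fin m → ℤ[X]) : Set ℂ :=
  {α | Good f g α ∧ ∃ k l : Fin m → ℤ, LinearIndependent ℤ ![k, l] ∧ val f g α k = 1 ∧ val f g α l = 1}

lemma Good.of_map {F G : Type*} [Field F] [Field G] (σ : F →+* G)
    {α : F} (h : Good f g (σ α)) : Good f g α := by
  rw [good_iff] at h ⊢
  intro h0
  apply h
  rw [← ev_map, h0, map_zero]

lemma Data.deg_bound_field (D : Data m f g) : ∃ N : ℕ, ∃ B : ℝ, ∀ (K : Type) [Field K] [NumberField K] (γ : K),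
    (Function.Injective fun φ : K →+* ℂ => φ γ) → Good f g γ → ∀ k l : Fin m → ℤ, LinearIndependent ℤ ![k, l] → val f g γ k = 1 → val f g γ l = 1 →
      Module.finrank ℚ K ≤ N ∧ logHeight₁ γ ≤ B := by
  classical
  obtain ⟨B0, hB0, hB⟩ := heightA D
  have hpoly : ∀ P : ℤ[X], ∃ B : ℕ, 0 < B ∧ ∀ (K : Type) [Field K] [NumberField K] (γ : K), logHeight₁ γ ≤ B0 * Module.finrank ℚ K →
      logHeight₁ (ev γ P) ≤ B * Module.finrank ℚ K := by
    intro P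
    obtain ⟨B, hB⟩ := exists_nat_gt (Real.log (1 + len P) + P.natDegree * B0)
    refine ⟨B + 1, by omega, fun K _ _ γ h => (heightPoly P γ).trans ?_⟩
    have hd : (0:ℝ) ≤ Module.finrank ℚ K := by positivity
    have h1 : (P.natDegree : ℝ) * logHeight₁ γ ≤ P.natDegree * (B0 * Module.finrank ℚ K) := by gcongr
    push_cast
    nlinarith
  choose Bp hBp0 hBp using hpoly
  set Bx : ℕ := (∑ i, (Bp (f i) + Bp (g i))) + 1 with hBx
  set R : ℝ := Real.exp (4 * (B0 + 1))
  set Om : Set ℂ := closedBall 0 R ∩ {z | Real.exp (-(4 * (Bp (QQ f g) : ℝ))) ≤ ‖((QQ f g).map (Int.castRingHom ℂ)).eval z‖} with hOm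
  have hOmc : IsCompact Om := (isCompact_closedBall 0 R).inter_right (isClosed_le continuous_const (Polynomial.continuous _).norm)
  obtain ⟨C1, d0, hcount⟩ := D.compact_count Om hOmc (fun z hz => by
    rw [good_iff, ev_eq_eval_map]
    intro h0
    have := hz.2
    rw [Set.mem_ofPred_eq, h0, norm_zero] at this
    exact absurd this (not_le.2 (Real.exp_pos _))) (4 * (48 * m * Bx) ^ m) (3 * m + 2)
  refine ⟨max d0 (4 * C1), B0 * (max d0 (4 * C1) : ℕ), ?_⟩
  intro K _ _ γ hinj hgood k l hkl hk hl
  have hk0 : k ≠ 0 := by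
    have := hkl.ne_zero 0
    simpa using this
  have hγ := hB K γ hgood k hk0 hk
  have key : Module.finrank ℚ K ≤ max d0 (4 * C1) := by
    by_contra hcon
    push Not at hcon
    rw [max_lt_iff] at hcon
    obtain ⟨a, b, hab, ha1, hb1, ha, hb⟩ := two_rels (fun i => ev γ (f i) / ev γ (g i)) (fun i => div_ne_zero (hgood i).1 (hgood i).2) Bx (by omega)
      (fun i => by
        have h1 := hBp (f i) K γ hγ
        have h2 := hBp (g i) K γ hγ
        rw [div_eq_mul_inv]
        refine (logHeight₁_mul_le _ _).trans ?_
        rw [logHeight₁_inv]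
        have h3 : Bp (f i) + Bp (g i) ≤ Bx := by
          have := Finset.single_le_sum (f := fun i => Bp (f i) + Bp (g i)) (fun _ _ => Nat.zero_le _) (Finset.mem_univ i)
          omega
        have h3' : ((Bp (f i) : ℝ) + Bp (g i)) ≤ Bx := by exact_mod_cast h3
        have hd : (0:ℝ) ≤ Module.finrank ℚ K := by positivity
        nlinarith) k l hkl hk hl
    obtain ⟨S, hS, hScard⟩ := half_emb (B0 + 1) (Bp (QQ f g)) (by linarith) (by exact_mod_cast hBp0 _) γ (ev γ (QQ f g)) ((good_iff γ).1 hgood)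
      (hγ.trans (by gcongr; linarith)) (hBp _ K γ hγ)
    have h4 := hcount (Module.finrank ℚ K) hcon.1.le a b hab (by intro i; exact_mod_cast ha i) (by intro i; exact_mod_cast hb i) (S.image fun φ => φ γ) (by
      intro z hz
      rw [Finset.mem_image] at hz
      obtain ⟨φ, hφ, rfl⟩ := hz
      refine ⟨⟨?_, ?_⟩, ?_, ?_⟩
      · rw [mem_closedBall, dist_zero_right]; exact (hS φ hφ).1
      · rw [Set.mem_ofPred_eq, ← ev_eq_eval_map, ← ev_map]; exact (hS φ hφ).2
      · rw [← val_map, val, ha1, map_one]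
      · rw [← val_map, val, hb1, map_one])
    rw [Finset.card_image_of_injective _ hinj] at h4
    have h5 : Module.finrank ℚ K ^ 2 ≤ (4 * C1) * Module.finrank ℚ K := by
      calc Module.finrank ℚ K ^ 2 ≤ (2 * S.card) ^ 2 := Nat.pow_le_pow_left hScard 2
        _ = 4 * S.card ^ 2 := by ring
        _ ≤ 4 * (C1 * Module.finrank ℚ K) := by omega
        _ = _ := by ring
    rw [sq] at h5
    have := Nat.le_of_mul_le_mul_right h5 (Module.finrank_pos (R := ℚ) (M := K))
    omega
  refine ⟨key, hγ.trans ?_⟩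
  gcongr

end BMZ

end PartDeg

section PartFin

open Polynomial

namespace BMZ
open Metric Height
variable {m : ℕ} {f g : Fin m → ℤ[X]}

lemma northcott (N : ℕ) (B : ℝ) : ∃ S : Set ℂ, S.Finite ∧ ∀ (K : Type) [Field K] [NumberField K] (γ : K),
    Module.finrank ℚ K ≤ N → logHeight₁ γ ≤ B → ∀ φ : K →+* ℂ, φ γ ∈ S := by
  classical
  obtain ⟨H, hH⟩ := exists_nat_ge (Real.exp B)
  obtain ⟨M, hM⟩ := exists_nat_ge (∑ d ∈ Finset.range (N + 1), max ((H:ℝ) * H) 1 ^ d * (d.choose (d / 2) : ℕ))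
  set U : Set ℚ := (fun n : ℤ => (n : ℚ)) '' (Set.Icc (-(M:ℤ)) M) with hU
  have hUf : U.Finite := (Set.finite_Icc _ _).image _
  have h1 := bUnion_roots_finite (algebraMap ℚ ℂ) N hUf
  set S0 : Set ℂ := ⋃ (f : ℚ[X]) (_ : f.natDegree ≤ N ∧ ∀ i, f.coeff i ∈ U), ((f.map (algebraMap ℚ ℂ)).roots.toFinset : Set ℂ) with hS0
  refine ⟨⋃ n ∈ Finset.range (H + 1), (fun z : ℂ => z / n) '' S0, ?_, ?_⟩
  · exact Set.Finite.biUnion (Finset.finite_toSet _) fun n _ => h1.image _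
  · intro K _ _ γ hd hB φ
    obtain ⟨n, hn, hle, hi⟩ := NumberField.exists_nat_le_mulHeight₁ γ
    have hmul : mulHeight₁ γ ≤ H := by
      refine le_trans ?_ hH
      rw [← Real.log_le_iff_le_exp]
      · exact hB
      · exact lt_of_lt_of_le (by exact_mod_cast Nat.pos_of_ne_zero hn) hle
    have hnH : (n:ℝ) ≤ H := hle.trans hmul
    have hnH' : n ≤ H := by exact_mod_cast hnH
    rw [Set.mem_iUnion₂]
    refine ⟨n, Finset.mem_range.2 (by omega), φ (n * γ), ?_, ?_⟩
    · rw [hS0, Set.mem_iUnion₂]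
      refine ⟨minpoly ℚ ((n:K) * γ), ⟨(minpoly.natDegree_le _).trans hd, fun i => ?_⟩, ?_⟩
      · rw [minpoly.isIntegrallyClosed_eq_field_fractions' ℚ hi, coeff_map]
        refine ⟨(minpoly ℤ ((n:K) * γ)).coeff i, ?_, by simp⟩
        have h2 := NumberField.Embeddings.coeff_bdd_of_norm_le (A := ℂ) (B := (H:ℝ) * H) (x := (n:K) * γ) (fun ψ => by
          rw [map_mul, map_natCast, norm_mul, Complex.norm_natCast]
          refine mul_le_mul hnH ?_ (norm_nonneg _) (by positivity)
          have h3 := norm_le_height ψ γ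
          by_cases h0 : ‖ψ γ‖ = 0
          · rw [h0]; positivity
          · refine le_trans ?_ hH
            rw [← Real.log_le_iff_le_exp (lt_of_le_of_ne (norm_nonneg _) (Ne.symm h0))]
            exact ((log_le_posLog _).trans h3).trans hB) i
        rw [minpoly.isIntegrallyClosed_eq_field_fractions' ℚ hi, coeff_map] at h2
        have h4 := Finset.single_le_sum (f := fun d => max ((H:ℝ) * H) 1 ^ d * (d.choose (d / 2) : ℕ)) (s := Finset.range (N + 1)) (fun _ _ => by positivity)
          (Finset.mem_range.2 (Nat.lt_succ_of_le hd))
        have h5 := (h2.trans h4).trans hM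
        have h6 : |(minpoly ℤ ((n:K) * γ)).coeff i| ≤ (M:ℤ) := by
          have : ‖(algebraMap ℤ ℚ) ((minpoly ℤ ((n:K) * γ)).coeff i)‖ = ((|(minpoly ℤ ((n:K) * γ)).coeff i| : ℤ) : ℝ) := by
            simp [Int.norm_eq_abs]
          rw [this] at h5
          exact_mod_cast h5
        exact abs_le.1 h6
      · rw [Finset.mem_coe, Multiset.mem_toFinset, mem_roots', IsRoot.def]
        have hq : IsIntegral ℚ ((n:K) * γ) := hi.tower_top
        refine ⟨Polynomial.map_ne_zero (minpoly.ne_zero hq), ?_⟩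
        rw [eval_map]
        have : φ (aeval ((n:K) * γ) (minpoly ℚ ((n:K) * γ))) = 0 := by rw [minpoly.aeval, map_zero]
        rw [aeval_def, hom_eval₂] at this
        rw [← this]
        congr 1
        exact RingHom.ext_rat _ _
    · rw [map_mul, map_natCast]
      field_simp

lemma Data.bmz_finite (D : Data m f g) : (bmz f g).Finite := by
  obtain ⟨N, B, hNB⟩ := D.deg_bound_field
  obtain ⟨S, hS, hS'⟩ := northcott N B
  refine hS.subset ?_
  rintro α ⟨hgood, k, l, hkl, hk, hl⟩
  have hk0 : k ≠ 0 := by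
    have := hkl.ne_zero 0
    simpa using this
  have halg : IsIntegral ℚ α := by
    rw [← isAlgebraic_iff_isIntegral]
    refine ⟨(PP f g k).map (Int.castRingHom ℚ), ?_, ?_⟩
    · rw [Ne, Polynomial.map_eq_zero_iff (Int.castRingHom ℚ).injective_int]
      exact D.PP_ne_zero k hk0
    · rw [aeval_def, eval₂_map]
      have := (ev_PP hgood k).2 hk
      rw [ev_apply] at this
      rw [← this]
      congr 1
  have hfd : FiniteDimensional ℚ (IntermediateField.adjoin ℚ {α}) := IntermediateField.adjoin.finiteDimensional halg
  have hnf : NumberField (IntermediateField.adjoin ℚ {α}) := { to_charZero := inferInstance, to_finiteDimensional := hfd }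
  set γ : IntermediateField.adjoin ℚ {α} := IntermediateField.AdjoinSimple.gen ℚ α with hγ
  have e : (algebraMap (IntermediateField.adjoin ℚ {α}) ℂ) γ = α := IntermediateField.AdjoinSimple.algebraMap_gen ℚ α
  have hinj : Function.Injective fun φ : IntermediateField.adjoin ℚ {α} →+* ℂ => φ γ := by
    intro φ ψ h
    have : φ.toRatAlgHom = ψ.toRatAlgHom := by
      apply IntermediateField.adjoin_algHom_ext
      rintro x rfl
      exact h
    ext x
    exact DFunLike.congr_fun this x
  have hinv : ∀ k : Fin m → ℤ, val f g α k = 1 → val f g γ k = 1 := by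
    intro k hk
    apply (algebraMap (IntermediateField.adjoin ℚ {α}) ℂ).injective
    rw [val_map, e, hk, map_one]
  have h1 := hNB (IntermediateField.adjoin ℚ {α}) γ hinj (Good.of_map (algebraMap (IntermediateField.adjoin ℚ {α}) ℂ) (by rwa [e])) k l hkl (hinv k hk) (hinv l hl)
  have := hS' _ γ h1.1 h1.2 (algebraMap (IntermediateField.adjoin ℚ {α}) ℂ)
  rwa [e] at this

end BMZ

end PartFin

section PartRes

open Polynomial

namespace BMZ

lemma card_range_dvd {ι : Type} [Fintype ι] [DecidableEq ι] (A : Matrix ι ι ℤ) (hA : A.det ≠ 0)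
    {G : Type*} [AddCommGroup G] (φ : (ι → ℤ) →+ G) (h : ∀ v, φ (A.mulVec v) = 0) :
    Nat.card φ.range ∣ A.det.natAbs := by
  have hinj : Function.Injective (Matrix.toLin' A) := by
    intro v w hvw
    rw [Matrix.toLin'_apply, Matrix.toLin'_apply] at hvw
    have := Matrix.eq_zero_of_mulVec_eq_zero hA (v := v - w) (by rw [Matrix.mulVec_sub, hvw, sub_self])
    exact sub_eq_zero.1 this
  let e := LinearEquiv.ofInjective (Matrix.toLin' A) hinj
  have h1 := Submodule.natAbs_det_equiv (LinearMap.range (Matrix.toLin' A)) e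
  have h2 : ((LinearMap.range (Matrix.toLin' A)).subtype ∘ₗ
      AddMonoidHom.toIntLinearMap ((e : (ι → ℤ) ≃ₗ[ℤ] _) : (ι → ℤ) →+ LinearMap.range (Matrix.toLin' A))) = Matrix.toLin' A := by
    ext v
    rfl
  rw [h2, LinearMap.det_toLin'] at h1
  rw [h1]
  have h3 : (LinearMap.range (Matrix.toLin' A)).toAddSubgroup ≤ φ.ker := by
    rintro _ ⟨v, rfl⟩
    exact h v
  have h4 := AddSubgroup.index_dvd_of_le h3
  rw [AddSubgroup.index_ker] at h4
  exact h4

lemma sum_shift {R : Type*} [AddCommMonoid R] (m n j : ℕ) (hj : j < m) (F : ℕ → R) :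
    ∑ i : Fin (m + n), (if (i : ℕ) ∈ Set.Icc j (j + n) then F (i - j) else 0) = ∑ t ∈ Finset.range (n + 1), F t := by
  classical
  rw [Fin.sum_univ_eq_sum_range (fun i => if i ∈ Set.Icc j (j + n) then F (i - j) else 0)]
  rw [← Finset.sum_filter]
  symm
  apply Finset.sum_bij (fun t _ => t + j)
  · intro t ht
    simp only [Finset.mem_range, Finset.mem_filter, Set.mem_Icc] at ht ⊢
    omega
  · intro a _ b _ h
    simpa using h
  · intro b hb
    simp only [Finset.mem_range, Finset.mem_filter, Set.mem_Icc] at hb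
    exact ⟨b - j, by simp only [Finset.mem_range]; omega, by omega⟩
  · intro t _
    simp

lemma sum_shift' {R : Type*} [AddCommMonoid R] (m n j : ℕ) (hj : j < n) (F : ℕ → R) :
    ∑ i : Fin (m + n), (if (i : ℕ) ∈ Set.Icc j (j + m) then F (i - j) else 0) = ∑ t ∈ Finset.range (m + 1), F t := by
  rw [← sum_shift n m j hj F, Fin.sum_univ_eq_sum_range (fun i => if i ∈ Set.Icc j (j + m) then F (i - j) else 0),
    Fin.sum_univ_eq_sum_range (fun i => if i ∈ Set.Icc j (j + m) then F (i - j) else 0), add_comm]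

lemma sylvester_col {F : Type*} [Field F] (P Q : ℤ[X]) (α : F) (hP : ev α P = 0) (hQ : ev α Q = 0)
    (j : Fin (P.natDegree + Q.natDegree)) :
    ∑ i : Fin (P.natDegree + Q.natDegree), ((sylvester P Q P.natDegree Q.natDegree i j : ℤ) : F) * α ^ (i : ℕ) = 0 := by
  rw [ev_apply, eval₂_eq_sum_range] at hP hQ
  induction j using Fin.addCases with
  | left j =>
    have := sum_shift P.natDegree Q.natDegree j j.2 (fun t => ((Q.coeff t : ℤ) : F) * α ^ (t + j))
    calc _ = _ := ?_
      _ = _ := this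
      _ = (∑ t ∈ Finset.range (Q.natDegree + 1), (Int.castRingHom F) (Q.coeff t) * α ^ t) * α ^ (j : ℕ) := ?_
      _ = 0 := by rw [hQ, zero_mul]
    · apply Finset.sum_congr rfl
      intro i _
      simp only [sylvester, Matrix.of_apply, Fin.addCases_left]
      split_ifs with h
      · rw [Nat.sub_add_cancel h.1]
      · simp
    · rw [Finset.sum_mul]
      apply Finset.sum_congr rfl
      intro i _
      rw [pow_add, mul_assoc]; rfl
  | right j =>
    have := sum_shift' P.natDegree Q.natDegree j j.2 (fun t => ((P.coeff t : ℤ) : F) * α ^ (t + j))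
    calc _ = _ := ?_
      _ = _ := this
      _ = (∑ t ∈ Finset.range (P.natDegree + 1), (Int.castRingHom F) (P.coeff t) * α ^ t) * α ^ (j : ℕ) := ?_
      _ = 0 := by rw [hP, zero_mul]
    · apply Finset.sum_congr rfl
      intro i _
      simp only [sylvester, Matrix.of_apply, Fin.addCases_right]
      split_ifs with h
      · rw [Nat.sub_add_cancel h.1]
      · simp
    · rw [Finset.sum_mul]
      apply Finset.sum_congr rfl
      intro i _
      rw [pow_add, mul_assoc]; rfl

lemma sylvester_colsum_left (P Q : ℤ[X]) (j : Fin P.natDegree) :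
    ∑ i : Fin (P.natDegree + Q.natDegree), |((sylvester P Q P.natDegree Q.natDegree i (Fin.castAdd _ j) : ℤ) : ℝ)| = len Q := by
  rw [len, ← sum_shift P.natDegree Q.natDegree j j.2]
  apply Finset.sum_congr rfl
  intro i _
  simp only [sylvester, Matrix.of_apply, Fin.addCases_left]
  split_ifs <;> simp

lemma sylvester_colsum_right (P Q : ℤ[X]) (j : Fin Q.natDegree) :
    ∑ i : Fin (P.natDegree + Q.natDegree), |((sylvester P Q P.natDegree Q.natDegree i (Fin.natAdd _ j) : ℤ) : ℝ)| = len P := by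
  rw [len, ← sum_shift' P.natDegree Q.natDegree j j.2]
  apply Finset.sum_congr rfl
  intro i _
  simp only [sylvester, Matrix.of_apply, Fin.addCases_right]
  split_ifs <;> simp

lemma abs_det_le {ι : Type*} [Fintype ι] [DecidableEq ι] (A : Matrix ι ι ℤ) :
    |(A.det : ℝ)| ≤ ∏ j, ∑ i, |(A i j : ℝ)| := by
  rw [Matrix.det_apply, Int.cast_sum]
  refine (Finset.abs_sum_le_sum_abs _ _).trans ?_
  calc _ ≤ ∑ σ : Equiv.Perm ι, ∏ j, |(A (σ j) j : ℝ)| := by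
        apply Finset.sum_le_sum
        intro σ _
        rw [← Finset.abs_prod]
        rcases Int.units_eq_one_or (Equiv.Perm.sign σ) with h | h <;> simp [h]
    _ = ∑ τ ∈ Finset.univ.map ⟨fun σ : Equiv.Perm ι => (σ : ι → ι), DFunLike.coe_injective⟩, ∏ j, |(A (τ j) j : ℝ)| := by
        rw [Finset.sum_map]; rfl
    _ ≤ ∑ τ : ι → ι, ∏ j, |(A (τ j) j : ℝ)| := by
        apply Finset.sum_le_sum_of_subset_of_nonneg (Finset.subset_univ _)
        intros
        exact Finset.prod_nonneg fun _ _ => abs_nonneg _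
    _ = _ := by
        rw [Finset.prod_univ_sum, Fintype.piFinset_univ]

lemma abs_res_le (P Q : ℤ[X]) : |((resultant P Q : ℤ) : ℝ)| ≤ len Q ^ P.natDegree * len P ^ Q.natDegree := by
  rw [resultant]
  refine (abs_det_le _).trans ?_
  rw [Fin.prod_univ_add]
  simp only [sylvester_colsum_left, sylvester_colsum_right]
  simp

lemma exists_irr_factor {F : Type*} [Field F] (P : ℤ[X]) (hP : P ≠ 0) (z : F) (hz : ev z P = 0) :
    ∃ r : ℤ[X], Irreducible r ∧ r ∣ P ∧ ev z r = 0 := by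
  obtain ⟨s, hs, hu⟩ := WfDvdMonoid.exists_factors P hP
  have h1 : ev z s.prod = 0 := by
    obtain ⟨u, hu⟩ := hu
    rw [← hu, map_mul] at hz
    rcases mul_eq_zero.1 hz with h | h
    · exact h
    · exact absurd h (u.isUnit.map (ev z)).ne_zero
  rw [map_multiset_prod, Multiset.prod_eq_zero_iff, Multiset.mem_map] at h1
  obtain ⟨r, hr, hr0⟩ := h1
  exact ⟨r, hs r hr, (Multiset.dvd_prod hr).trans hu.dvd, hr0⟩

lemma irr_dvd (r Q : ℤ[X]) (hr : Irreducible r) (hd : r.natDegree ≠ 0) (z : ℂ) (h1 : ev z r = 0) (h2 : ev z Q = 0) :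
    r ∣ Q := by
  have pr := hr.isPrimitive hd
  have ir := (IsPrimitive.Int.irreducible_iff_irreducible_map_cast pr).1 hr
  rw [IsPrimitive.Int.dvd_iff_map_cast_dvd_map_cast r Q pr]
  by_contra hcon
  rw [← ir.coprime_iff_not_dvd] at hcon
  obtain ⟨a, b, hab⟩ := hcon
  have h3 : ∀ R : ℤ[X], eval₂ (algebraMap ℚ ℂ) z (R.map (Int.castRingHom ℚ)) = ev z R := by
    intro R
    rw [eval₂_map, ev_apply]
    congr 1
  have h4 := congrArg (eval₂ (algebraMap ℚ ℂ) z) hab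
  rw [eval₂_add, eval₂_mul, eval₂_mul, h3, h3, h1, h2] at h4
  simp at h4

lemma res_ne_zero (P Q : ℤ[X]) (hP : P ≠ 0) (h : IsRelPrime P Q) : resultant P Q ≠ 0 := by
  intro h0
  have h1 := resultant_map_map P Q P.natDegree Q.natDegree (Int.castRingHom ℚ)
  rw [h0, map_zero] at h1
  have hinj := (Int.castRingHom ℚ).injective_int
  have h2 : resultant (P.map (Int.castRingHom ℚ)) (Q.map (Int.castRingHom ℚ)) = 0 := by
    rw [natDegree_map_eq_of_injective hinj, natDegree_map_eq_of_injective hinj]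
    exact h1
  rw [resultant_eq_zero_iff] at h2
  apply h2.2
  apply isCoprime_of_irreducible_dvd
  · rintro ⟨h3, -⟩
    exact hP ((Polynomial.map_eq_zero_iff hinj).1 h3)
  rintro w hw ⟨a, ha⟩ ⟨b, hb⟩
  have hwd : (w.map (algebraMap ℚ ℂ)).degree ≠ 0 := by
    rw [degree_map]
    exact (degree_pos_of_irreducible hw).ne'
  obtain ⟨z, hz⟩ := IsAlgClosed.exists_root _ hwd
  rw [IsRoot, eval_map] at hz
  have h3 : ∀ R : ℤ[X], eval₂ (algebraMap ℚ ℂ) z (R.map (Int.castRingHom ℚ)) = ev z R := by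
    intro R
    rw [eval₂_map, ev_apply]
    congr 1
  have hPz : ev z P = 0 := by rw [← h3, ha, eval₂_mul, hz, zero_mul]
  have hQz : ev z Q = 0 := by rw [← h3, hb, eval₂_mul, hz, zero_mul]
  obtain ⟨r, hr, hrP, hrz⟩ := exists_irr_factor P hP z hPz
  have hd : r.natDegree ≠ 0 := by
    intro hd
    rw [natDegree_eq_zero] at hd
    obtain ⟨c, rfl⟩ := hd
    rw [ev_C] at hrz
    have : c = 0 := by exact_mod_cast hrz
    exact hr.ne_zero (by rw [this, C_0])
  exact hr.not_isUnit (h hrP (irr_dvd r Q hr hd z hrz hQz))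

lemma card_eq_pow_of_smul {p : ℕ} [Fact p.Prime] (G : Type*) [AddCommGroup G] [Finite G] (h : ∀ x : G, p • x = 0) :
    ∃ r, Nat.card G = p ^ r := by
  let inst : Module (ZMod p) G := AddCommGroup.zmodModule h
  exact ⟨_, (FiniteField.pow_finrank_eq_natCard p G).symm⟩

lemma card_le_val {p : ℕ} [Fact p.Prime] {F : Type*} [Field F] [CharP F p] (P Q : ℤ[X]) (hr : resultant P Q ≠ 0)
    (hP : P.map (Int.castRingHom F) ≠ 0) (S : Finset F) (hS : ∀ α ∈ S, ev α P = 0 ∧ ev α Q = 0) :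
    S.card ≤ padicValNat p (resultant P Q).natAbs := by
  classical
  have hp : p.Prime := Fact.out
  let N := P.natDegree + Q.natDegree
  have hcard : S.card ≤ N := by
    have h1 : S ⊆ (P.map (Int.castRingHom F)).roots.toFinset := by
      intro α hα
      rw [Multiset.mem_toFinset, mem_roots hP, IsRoot, ← ev_eq_eval_map]
      exact (hS α hα).1
    calc S.card ≤ _ := Finset.card_le_card h1
      _ ≤ _ := Multiset.toFinset_card_le _
      _ ≤ _ := card_roots' _
      _ ≤ P.natDegree := natDegree_map_le
      _ ≤ N := Nat.le_add_right _ _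
  let φ : (Fin N → ℤ) →+ (S → F) :=
    { toFun := fun v s => ∑ i, (v i : F) * (s : F) ^ (i : ℕ)
      map_zero' := by ext; simp
      map_add' := by intro v w; ext s; simp [add_mul, Finset.sum_add_distrib] }
  have hφ : ∀ v s, φ v s = ∑ i, (v i : F) * (s : F) ^ (i : ℕ) := fun _ _ => rfl
  have hker : ∀ v, φ ((sylvester P Q P.natDegree Q.natDegree).mulVec v) = 0 := by
    intro v
    ext s
    rw [hφ]
    simp only [Matrix.mulVec, dotProduct, Int.cast_sum, Int.cast_mul, Finset.sum_mul, Pi.zero_apply]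
    rw [Finset.sum_comm]
    apply Finset.sum_eq_zero
    intro j _
    have := sylvester_col P Q (s : F) (hS s s.2).1 (hS s s.2).2 j
    calc _ = (∑ i : Fin (P.natDegree + Q.natDegree), ((sylvester P Q P.natDegree Q.natDegree i j : ℤ) : F) * (s : F) ^ (i : ℕ)) * (v j : F) := by
          rw [Finset.sum_mul]
          apply Finset.sum_congr rfl
          intros; ring
      _ = 0 := by rw [this, zero_mul]
  have hdvd := card_range_dvd _ hr φ hker
  have hmod : ∀ x : φ.range, p • x = 0 := by
    intro x
    ext s
    simp
  have hR0 : (resultant P Q).natAbs ≠ 0 := by simpa using hr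
  have hcp : Nat.card φ.range ≠ 0 := fun h => by
    rw [h] at hdvd
    exact hR0 (Nat.eq_zero_of_zero_dvd hdvd)
  have hfin : Finite φ.range := Nat.finite_of_card_ne_zero hcp
  obtain ⟨r, hpow⟩ := card_eq_pow_of_smul (p := p) φ.range hmod
  -- injectivity
  let ψ : (Fin S.card → Fin p) → φ.range := fun a =>
    ⟨φ (fun i => if h : (i : ℕ) < S.card then ((a ⟨i, h⟩ : ℕ) : ℤ) else 0), ⟨_, rfl⟩⟩
  have hψ : Function.Injective ψ := by
    intro a b hab
    have hab' : ∀ s : S, ∑ i : Fin S.card, (((a i : ℕ) : F) - ((b i : ℕ) : F)) * (s : F) ^ (i : ℕ) = 0 := by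
      intro s
      have h1 := congrFun (congrArg Subtype.val hab) s
      have h2 : ∀ a : Fin S.card → Fin p, (ψ a).1 s = ∑ i : Fin S.card, ((a i : ℕ) : F) * (s : F) ^ (i : ℕ) := by
        intro a
        change ∑ i : Fin N, (((if h : (i : ℕ) < S.card then ((a ⟨i, h⟩ : ℕ) : ℤ) else 0 : ℤ)) : F) * (s : F) ^ (i : ℕ) = _
        rw [Fin.sum_univ_eq_sum_range (fun i => (((if h : (i : ℕ) < S.card then ((a ⟨i, h⟩ : ℕ) : ℤ) else 0 : ℤ)) : F) * (s : F) ^ (i : ℕ)) N,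
          ← Finset.sum_subset (Finset.range_subset_range.2 hcard), ← Fin.sum_univ_eq_sum_range]
        · simp
        · intro i _ hi
          rw [Finset.mem_range] at hi
          simp [hi]
      rw [h2, h2] at h1
      simp only [sub_mul, Finset.sum_sub_distrib]
      rw [h1, sub_self]
    let R : F[X] := ∑ i : Fin S.card, C (((a i : ℕ) : F) - ((b i : ℕ) : F)) * X ^ (i : ℕ)
    have hR : R = 0 := by
      apply Polynomial.eq_zero_of_degree_lt_of_eval_finset_eq_zero S
      · exact degree_sum_fin_lt _
      · intro x hx
        rw [← hab' ⟨x, hx⟩]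
        simp [R, eval_finsetSum]
    funext i
    have h3 : R.coeff i = ((a i : ℕ) : F) - ((b i : ℕ) : F) := by
      simp only [R, finsetSum_coeff, coeff_C_mul, coeff_X_pow]
      rw [Finset.sum_eq_single i]
      · simp
      · intro j _ hj
        rw [if_neg (fun h => hj (Fin.ext h.symm)), mul_zero]
      · simp
    rw [hR, coeff_zero] at h3
    have h4 : ((a i : ℕ) : F) = ((b i : ℕ) : F) := (sub_eq_zero.1 h3.symm)
    rw [CharP.natCast_eq_natCast F p] at h4
    exact Fin.ext (Nat.ModEq.eq_of_lt_of_lt h4 (a i).2 (b i).2)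
  have hle : p ^ S.card ≤ p ^ r := by
    rw [← hpow]
    have := Nat.card_le_card_of_injective ψ hψ
    simpa using this
  have hle' : S.card ≤ r := (Nat.pow_le_pow_iff_right hp.one_lt).1 hle
  rw [hpow] at hdvd
  exact (padicValNat_dvd_iff_le hR0).1 ((pow_dvd_pow p hle').trans hdvd)

end BMZ

end PartRes

section PartBd

open Polynomial

namespace BMZ

variable {m : ℕ} {f g : Fin m → ℤ[X]}

lemma len_eq (P : ℤ[X]) (N : ℕ) (h : P.natDegree < N) : len P = ∑ i ∈ Finset.range N, |(P.coeff i : ℝ)| := by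
  rw [len]
  apply Finset.sum_subset (Finset.range_subset_range.2 h)
  intro i _ hi
  rw [Finset.mem_range] at hi
  rw [coeff_eq_zero_of_natDegree_lt (by omega)]
  simp

lemma len_add (P Q : ℤ[X]) : len (P + Q) ≤ len P + len Q := by
  let N := P.natDegree + Q.natDegree + (P + Q).natDegree + 1
  rw [len_eq P N (by omega), len_eq Q N (by omega), len_eq (P + Q) N (by omega), ← Finset.sum_add_distrib]
  apply Finset.sum_le_sum
  intro i _
  rw [coeff_add, Int.cast_add]
  exact abs_add_le _ _

lemma len_neg (P : ℤ[X]) : len (-P) = len P := by simp [len]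

lemma len_sum {ι : Type*} (s : Finset ι) (P : ι → ℤ[X]) : len (∑ i ∈ s, P i) ≤ ∑ i ∈ s, len (P i) := by
  classical
  induction s using Finset.induction_on with
  | empty => simp [len]
  | insert i s hi ih =>
    rw [Finset.sum_insert hi, Finset.sum_insert hi]
    exact (len_add _ _).trans (by gcongr)

lemma len_mono_mul (c : ℤ) (i : ℕ) (Q : ℤ[X]) : len (C c * X ^ i * Q) ≤ |(c : ℝ)| * len Q := by
  let N := (C c * X ^ i * Q).natDegree + Q.natDegree + 1
  rw [len_eq (C c * X ^ i * Q) (i + N) (by omega), len_eq Q N (by omega), Finset.mul_sum, Finset.sum_range_add]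
  have h1 : ∑ t ∈ Finset.range i, |(((C c * X ^ i * Q).coeff t : ℤ) : ℝ)| = 0 := by
    apply Finset.sum_eq_zero
    intro t ht
    rw [Finset.mem_range] at ht
    rw [mul_assoc, coeff_C_mul, coeff_X_pow_mul', if_neg (by omega)]
    simp
  rw [h1, zero_add]
  apply le_of_eq
  apply Finset.sum_congr rfl
  intro t _
  rw [mul_assoc, coeff_C_mul, coeff_X_pow_mul', if_pos (by omega)]
  simp [abs_mul]

lemma len_mul (P Q : ℤ[X]) : len (P * Q) ≤ len P * len Q := by
  conv_lhs => rw [P.as_sum_range_C_mul_X_pow, Finset.sum_mul]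
  refine (len_sum _ _).trans ?_
  rw [len, Finset.sum_mul]
  apply Finset.sum_le_sum
  intro i _
  exact len_mono_mul _ _ _

lemma len_one : len 1 = 1 := by simp [len]

lemma one_le_len (P : ℤ[X]) (hP : P ≠ 0) : 1 ≤ len P := by
  have h1 : |((P.coeff P.natDegree : ℤ) : ℝ)| ≤ len P :=
    Finset.single_le_sum (f := fun i => |((P.coeff i : ℤ) : ℝ)|) (fun _ _ => abs_nonneg _)
      (Finset.mem_range.2 (Nat.lt_succ_self _))
  refine le_trans ?_ h1
  have : P.coeff P.natDegree ≠ 0 := by simpa using hP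
  exact_mod_cast Int.one_le_abs this

lemma len_pow (P : ℤ[X]) (n : ℕ) : len (P ^ n) ≤ len P ^ n := by
  induction n with
  | zero => simp [len_one]
  | succ n ih =>
    rw [pow_succ, pow_succ]
    exact (len_mul _ _).trans (mul_le_mul_of_nonneg_right ih (len_nonneg _))

lemma len_prod_pow (h : Fin m → ℤ[X]) (hh : ∀ i, h i ≠ 0) (K : ℕ) (a : Fin m → ℕ) (ha : ∀ i, a i ≤ K) :
    len (∏ i, h i ^ a i) ≤ (∏ i, len (h i)) ^ K := by
  classical
  rw [← Finset.prod_pow]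
  have : ∀ s : Finset (Fin m), len (∏ i ∈ s, h i ^ a i) ≤ ∏ i ∈ s, len (h i) ^ K := by
    intro s
    induction s using Finset.induction_on with
    | empty => simp [len_one]
    | insert i s hi ih =>
      rw [Finset.prod_insert hi, Finset.prod_insert hi]
      refine (len_mul _ _).trans (mul_le_mul ?_ ih (len_nonneg _) (pow_nonneg (len_nonneg _) _))
      exact (len_pow _ _).trans (pow_le_pow_right₀ (one_le_len _ (hh i)) (ha i))
  exact this _

lemma deg_prod_pow (h : Fin m → ℤ[X]) (K : ℕ) (a : Fin m → ℕ) (ha : ∀ i, a i ≤ K) :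
    (∏ i, h i ^ a i).natDegree ≤ (∑ i, (h i).natDegree) * K := by
  refine (natDegree_prod_le _ _).trans ?_
  rw [Finset.sum_mul]
  apply Finset.sum_le_sum
  intro i _
  refine natDegree_pow_le.trans ?_
  rw [mul_comm]
  gcongr
  exact ha i

lemma toNat_le_of_abs {x : ℤ} {K : ℕ} (h : |x| ≤ K) : x.toNat ≤ K ∧ (-x).toNat ≤ K := by
  rw [abs_le] at h
  omega

lemma PP_deg (K : ℕ) (k : Fin m → ℤ) (hk : ∀ i, |k i| ≤ (K : ℤ)) :
    (PP f g k).natDegree ≤ (∑ i, (f i).natDegree + ∑ i, (g i).natDegree) * K := by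
  have h1 := fun i => (toNat_le_of_abs (hk i)).1
  have h2 := fun i => (toNat_le_of_abs (hk i)).2
  rw [PP, add_mul]
  refine (natDegree_sub_le _ _).trans (max_le ?_ ?_)
  · exact natDegree_mul_le.trans (add_le_add (deg_prod_pow _ _ _ h1) (deg_prod_pow _ _ _ h2))
  · exact natDegree_mul_le.trans (add_le_add (deg_prod_pow _ _ _ h2) (deg_prod_pow _ _ _ h1))

lemma PP_len (hf : ∀ i, f i ≠ 0) (hg : ∀ i, g i ≠ 0) (K : ℕ) (hK : 1 ≤ K) (k : Fin m → ℤ) (hk : ∀ i, |k i| ≤ (K : ℤ)) :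
    len (PP f g k) ≤ (2 * ((∏ i, len (f i)) * ∏ i, len (g i))) ^ K := by
  have h1 := fun i => (toNat_le_of_abs (hk i)).1
  have h2 := fun i => (toNat_le_of_abs (hk i)).2
  have hF : 0 ≤ (∏ i, len (f i)) ^ K := pow_nonneg (Finset.prod_nonneg fun _ _ => len_nonneg _) _
  have hG : 0 ≤ (∏ i, len (g i)) ^ K := pow_nonneg (Finset.prod_nonneg fun _ _ => len_nonneg _) _
  have a1 : ∀ A B C D : ℤ[X], len (A * B - C * D) ≤ len A * len B + len C * len D := by
    intro A B C D
    rw [sub_eq_add_neg]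
    refine (len_add _ _).trans ?_
    rw [len_neg]
    exact add_le_add (len_mul _ _) (len_mul _ _)
  rw [PP]
  refine (a1 _ _ _ _).trans ?_
  calc _ ≤ (∏ i, len (f i)) ^ K * (∏ i, len (g i)) ^ K + (∏ i, len (f i)) ^ K * (∏ i, len (g i)) ^ K :=
        add_le_add (mul_le_mul (len_prod_pow _ hf _ _ h1) (len_prod_pow _ hg _ _ h2) (len_nonneg _) hF)
          (mul_le_mul (len_prod_pow _ hf _ _ h2) (len_prod_pow _ hg _ _ h1) (len_nonneg _) hF)
    _ = 2 ^ 1 * ((∏ i, len (f i)) ^ K * (∏ i, len (g i)) ^ K) := by ring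
    _ ≤ 2 ^ K * ((∏ i, len (f i)) ^ K * (∏ i, len (g i)) ^ K) := by
        gcongr
        norm_num
    _ = _ := by rw [mul_pow, mul_pow]

lemma len_factor (P Q : ℤ[X]) (h : P * Q ≠ 0) : len P ≤ 2 ^ P.natDegree * len (P * Q) := by
  have hQ : Q ≠ 0 := right_ne_zero_of_mul h
  have h1 := one_le_mahlerMeasure_of_ne_zero hQ
  have hinj := (Int.castRingHom ℂ).injective_int
  have h2 : ((P * Q).map (Int.castRingHom ℂ)).mahlerMeasure ≤ len (P * Q) := by
    refine (mahlerMeasure_le_sum_norm_coeff _).trans ?_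
    rw [sum_over_range _ (by simp), natDegree_map_eq_of_injective hinj, len]
    apply Finset.sum_le_sum
    intro i _
    rw [coeff_map]
    simp
  rw [Polynomial.map_mul] at h2
  have h3 := fun n => norm_coeff_le_choose_mul_mahlerMeasure_of_one_le_mahlerMeasure n (P.map (Int.castRingHom ℂ)) _ h1
  calc len P ≤ ∑ i ∈ Finset.range (P.natDegree + 1), (P.natDegree.choose i : ℝ) * len (P * Q) := by
        apply Finset.sum_le_sum
        intro i _
        have := h3 i
        rw [coeff_map, natDegree_map_eq_of_injective hinj] at this
        simp only [eq_intCast, Complex.norm_intCast] at this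
        exact this.trans (by gcongr)
    _ = _ := by
        rw [← Finset.sum_mul, ← Nat.cast_sum, Nat.sum_range_choose]
        simp

lemma one_le_prod_len (h : Fin m → ℤ[X]) (hh : ∀ i, h i ≠ 0) : 1 ≤ ∏ i, len (h i) := by
  calc (1:ℝ) = ∏ _i : Fin m, (1:ℝ) := by simp
    _ ≤ _ := Finset.prod_le_prod (fun _ _ => zero_le_one) fun i _ => one_le_len _ (hh i)

/-- Bound for the resultant of the cofactors. -/
lemma res_bound (hf : ∀ i, f i ≠ 0) (hg : ∀ i, g i ≠ 0) : ∃ c : ℝ, 0 ≤ c ∧ ∀ (K L : ℕ), 1 ≤ K → 1 ≤ L →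
    ∀ (k l : Fin m → ℤ), (∀ i, |k i| ≤ (K : ℤ)) → (∀ i, |l i| ≤ (L : ℤ)) →
    ∀ P Q E : ℤ[X], PP f g k ≠ 0 → PP f g l ≠ 0 → PP f g k = E * P → PP f g l = E * Q →
    resultant P Q ≠ 0 → Real.log ((resultant P Q).natAbs : ℝ) ≤ c * (K * L) := by
  let Cd := ∑ i, (f i).natDegree + ∑ i, (g i).natDegree
  let Λ := (∏ i, len (f i)) * ∏ i, len (g i)
  have hΛ : 1 ≤ Λ := by
    have h1 : 1 ≤ ∏ i, len (f i) := one_le_prod_len f hf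
    have h2 : 1 ≤ ∏ i, len (g i) := one_le_prod_len g hg
    exact one_le_mul_of_one_le_of_one_le h1 h2
  let B := 2 ^ Cd * (2 * Λ)
  have hB : 1 ≤ B := one_le_mul_of_one_le_of_one_le (one_le_pow₀ (by norm_num)) (by linarith)
  have key : ∀ (K : ℕ), 1 ≤ K → ∀ k : Fin m → ℤ, (∀ i, |k i| ≤ (K : ℤ)) → ∀ P E : ℤ[X], PP f g k ≠ 0 → PP f g k = E * P →
      P.natDegree ≤ Cd * K ∧ len P ≤ B ^ K := by
    intro K hK k hk P E h0 hE
    have hd : P.natDegree ≤ Cd * K := by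
      refine le_trans ?_ (PP_deg (f := f) (g := g) K k hk)
      exact natDegree_le_of_dvd ⟨E, by rw [hE, mul_comm]⟩ h0
    refine ⟨hd, ?_⟩
    rw [mul_comm] at hE
    have h1 := len_factor P E (hE ▸ h0)
    rw [← hE] at h1
    refine h1.trans ?_
    have h2 := PP_len hf hg K hK k hk
    calc _ ≤ (2:ℝ) ^ (Cd * K) * (2 * Λ) ^ K := by
          apply mul_le_mul _ h2 (len_nonneg _) (by positivity)
          exact pow_le_pow_right₀ (by norm_num) hd
      _ = B ^ K := by rw [pow_mul, ← mul_pow]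
  refine ⟨2 * Cd * Real.log B, by have := Real.log_nonneg hB; positivity, ?_⟩
  intro K L hK hL k l hk hl P Q E hP0 hQ0 hP hQ hr
  obtain ⟨d1, l1⟩ := key K hK k hk P E hP0 hP
  obtain ⟨d2, l2⟩ := key L hL l hl Q E hQ0 hQ
  have hB0 : (0:ℝ) ≤ B := by linarith
  have h1 : ((resultant P Q).natAbs : ℝ) ≤ B ^ (2 * Cd * (K * L)) := by
    rw [Nat.cast_natAbs, Int.cast_abs]
    refine (abs_res_le P Q).trans ?_
    calc _ ≤ (B ^ L) ^ (Cd * K) * (B ^ K) ^ (Cd * L) := by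
          apply mul_le_mul
          · exact (pow_le_pow_left₀ (len_nonneg _) l2 _).trans (pow_le_pow_right₀ (one_le_pow₀ hB) d1)
          · exact (pow_le_pow_left₀ (len_nonneg _) l1 _).trans (pow_le_pow_right₀ (one_le_pow₀ hB) d2)
          · exact pow_nonneg (len_nonneg _) _
          · positivity
      _ = _ := by rw [← pow_mul, ← pow_mul, ← pow_add]; congr 1; ring
  have h2 : (0:ℝ) < ((resultant P Q).natAbs : ℝ) := by exact_mod_cast Int.natAbs_pos.2 hr
  calc _ ≤ _ := Real.log_le_log h2 h1
    _ = _ := by rw [Real.log_pow]; push_cast; ring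

end BMZ

end PartBd

section PartMain

open Polynomial

namespace BMZ

variable {m : ℕ} {f g : Fin m → ℤ[X]}

lemma exists_cofactors (A B : ℤ[X]) : ∃ E P Q : ℤ[X], A = E * P ∧ B = E * Q ∧ IsRelPrime P Q := by
  classical
  let _ : NormalizedGCDMonoid ℤ[X] := Classical.choice inferInstance
  obtain ⟨P, Q, h1, h2, h3⟩ := extract_gcd A B
  exact ⟨gcd A B, P, Q, h1, h2, (gcd_isUnit_iff_isRelPrime).1 h3⟩

lemma left_ne_zero_of_indep {k l : Fin m → ℤ} (h : LinearIndependent ℤ ![k, l]) : k ≠ 0 ∧ l ≠ 0 :=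
  ⟨h.ne_zero 0, h.ne_zero 1⟩

/-- the polynomial absorbing the characteristic zero part -/
lemma Data.exists_W (D : Data m f g) : ∃ W : ℤ[X],
    (∀ (F : Type) [Field F] [IsAlgClosed F], D.Nice F → W.map (Int.castRingHom F) ≠ 0) ∧
    ∀ (F : Type) [Field F] [IsAlgClosed F], D.Nice F → ∀ (α : F), Good f g α → ∀ (k l : Fin m → ℤ),
      LinearIndependent ℤ ![k, l] → ∀ E P Q : ℤ[X], PP f g k = E * P → PP f g l = E * Q → ev α E = 0 → ev α W = 0 := by
  classical
  have hex : ∀ z : ℂ, ∃ k : Fin m → ℤ, z ∈ bmz f g → k ≠ 0 ∧ val f g z k = 1 := by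
    intro z
    by_cases hz : z ∈ bmz f g
    · obtain ⟨_, k, l, hkl, hk, _⟩ := hz
      exact ⟨k, fun _ => ⟨(left_ne_zero_of_indep hkl).1, hk⟩⟩
    · exact ⟨0, fun h => absurd h hz⟩
  choose kz hkz using hex
  let Z := D.bmz_finite.toFinset
  have hZ : ∀ z, z ∈ Z ↔ z ∈ bmz f g := fun z => Set.Finite.mem_toFinset _
  refine ⟨∏ z ∈ Z, PP f g (kz z), ?_, ?_⟩
  · intro F _ _ hN
    rw [Polynomial.map_prod, Finset.prod_ne_zero_iff]
    intro z hz
    exact D.PP_ne F hN _ (hkz z ((hZ z).1 hz)).1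
  · intro F _ _ hN α hα k l hkl E P Q hP hQ hE
    obtain ⟨hk0, hl0⟩ := left_ne_zero_of_indep hkl
    have hPk := D.PP_ne_zero k hk0
    have hE0 : E ≠ 0 := by
      rintro rfl
      exact hPk (by rw [hP, zero_mul])
    obtain ⟨r, hr, ⟨s, hs⟩, hrα⟩ := exists_irr_factor E hE0 α hE
    have hd : r.natDegree ≠ 0 := by
      intro hd
      rw [natDegree_eq_zero] at hd
      obtain ⟨c, rfl⟩ := hd
      rw [ev_C] at hrα
      apply D.PP_ne F hN k hk0
      rw [hP, hs]
      have h0 : (C c : ℤ[X]).map (Int.castRingHom F) = 0 := by rw [map_C, eq_intCast, hrα, C_0]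
      rw [Polynomial.map_mul, Polynomial.map_mul, h0, zero_mul, zero_mul]
    have hdz : (r.map (Int.castRingHom ℂ)).degree ≠ 0 := by
      rw [degree_map_eq_of_injective (Int.castRingHom ℂ).injective_int]
      intro h
      exact hd (natDegree_eq_of_degree_eq_some h)
    obtain ⟨z, hz⟩ := IsAlgClosed.exists_root _ hdz
    rw [IsRoot, ← ev_eq_eval_map] at hz
    have hgz : Good f g z := by
      rw [good_iff]
      intro hq
      obtain ⟨t, ht⟩ := irr_dvd r _ hr hd z hz hq
      rw [good_iff, ht, map_mul, hrα, zero_mul] at hα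
      exact hα rfl
    have hzb : z ∈ bmz f g := by
      refine ⟨hgz, k, l, hkl, ?_, ?_⟩
      · rw [← ev_PP hgz, hP, hs, map_mul, map_mul, hz, zero_mul, zero_mul]
      · rw [← ev_PP hgz, hQ, hs, map_mul, map_mul, hz, zero_mul, zero_mul]
    have hPz : ev z (PP f g (kz z)) = 0 := (ev_PP hgz _).2 (hkz z hzb).2
    obtain ⟨t, ht⟩ := irr_dvd r _ hr hd z hz hPz
    rw [map_prod]
    apply Finset.prod_eq_zero ((hZ z).2 hzb)
    rw [ht, map_mul, hrα, zero_mul]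

lemma padicVal_prod {p : ℕ} [Fact p.Prime] {ι : Type*} (s : Finset ι) (n : ι → ℕ) (h : ∀ i ∈ s, n i ≠ 0) :
    padicValNat p (∏ i ∈ s, n i) = ∑ i ∈ s, padicValNat p (n i) := by
  classical
  induction s using Finset.induction_on with
  | empty => simp
  | insert i s hi ih =>
    rw [Finset.prod_insert hi, Finset.sum_insert hi, padicValNat.mul (h i (Finset.mem_insert_self _ _))
      (Finset.prod_ne_zero_iff.2 fun j hj => h j (Finset.mem_insert_of_mem hj)),
      ih fun j hj => h j (Finset.mem_insert_of_mem hj)]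

lemma box_card (m K : ℕ) (hK : 1 ≤ K) :
    ((Fintype.piFinset fun _ : Fin m => Finset.Icc (-(K:ℤ)) K).card : ℝ) ≤ (3 * (K:ℝ)) ^ m := by
  rw [Fintype.card_piFinset]
  simp only [Int.card_Icc, Finset.prod_const, Finset.card_univ, Fintype.card_fin]
  push_cast
  gcongr
  have : ((K:ℤ) + 1 - -(K:ℤ)).toNat ≤ 3 * K := by omega
  exact_mod_cast this

lemma mem_box {K : ℕ} {k : Fin m → ℤ} : k ∈ (Fintype.piFinset fun _ : Fin m => Finset.Icc (-(K:ℤ)) K) ↔ ∀ i, |k i| ≤ (K:ℤ) := by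
  simp [Fintype.mem_piFinset, abs_le]

end BMZ

open BMZ in
theorem stmt_14' (m : ℕ) (hm : 0 < m) (f g : Fin m → Polynomial ℤ)
    (hf : ∀ i, f i ≠ 0) (hg : ∀ i, g i ≠ 0) (D : Data m f g) :
    ∃ c₁ c₂ c₃ : ℝ, ∀ K L : ℕ, 1 ≤ K → 1 ≤ L →
      ∃ T : ℕ, 0 < T ∧ Real.log (T : ℝ) ≤ c₁ * ((K : ℝ) * (L : ℝ)) ^ (m + 1) ∧
        ∀ (p : ℕ) (_ : Fact p.Prime), c₂ < (p : ℝ) →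
          ({α : AlgebraicClosure (ZMod p) | Good f g α ∧ ∃ k l : Fin m → ℤ, LinearIndependent ℤ ![k, l] ∧
      (∀ i, |k i| ≤ (K : ℤ)) ∧ (∀ i, |l i| ≤ (L : ℤ)) ∧ val f g α k = 1 ∧ val f g α l = 1}).Finite ∧
            (({α : AlgebraicClosure (ZMod p) | Good f g α ∧ ∃ k l : Fin m → ℤ, LinearIndependent ℤ ![k, l] ∧
      (∀ i, |k i| ≤ (K : ℤ)) ∧ (∀ i, |l i| ≤ (L : ℤ)) ∧ val f g α k = 1 ∧ val f g α l = 1}).ncard : ℝ) ≤ (padicValNat p T : ℝ) + c₃ := by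
  classical
  obtain ⟨c, hc, hres⟩ := res_bound hf hg
  obtain ⟨M, hM, hnice⟩ := D.exists_nice
  obtain ⟨W, hW, hWα⟩ := D.exists_W
  have hcof : ∀ kl : (Fin m → ℤ) × (Fin m → ℤ), ∃ E P Q : ℤ[X], PP f g kl.1 = E * P ∧ PP f g kl.2 = E * Q ∧ IsRelPrime P Q :=
    fun kl => exists_cofactors _ _
  choose E P Q hP hQ hPQ using hcof
  refine ⟨c * 9 ^ m, |(M : ℝ)|, W.natDegree, ?_⟩
  intro K L hK hL
  let box : ℕ → Finset (Fin m → ℤ) := fun K => Fintype.piFinset fun _ : Fin m => Finset.Icc (-(K:ℤ)) K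
  let I := (box K ×ˢ box L).filter (fun kl => LinearIndependent ℤ ![kl.1, kl.2])
  have hI : ∀ kl, kl ∈ I ↔ ((∀ i, |kl.1 i| ≤ (K:ℤ)) ∧ (∀ i, |kl.2 i| ≤ (L:ℤ))) ∧ LinearIndependent ℤ ![kl.1, kl.2] := by
    intro kl
    rw [Finset.mem_filter, Finset.mem_product, mem_box, mem_box]
  have hr0 : ∀ kl ∈ I, resultant (P kl) (Q kl) ≠ 0 := by
    intro kl hkl
    apply res_ne_zero _ _ _ (hPQ kl)
    intro h0
    apply D.PP_ne_zero kl.1 (left_ne_zero_of_indep ((hI kl).1 hkl).2).1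
    rw [hP kl, h0, mul_zero]
  have hn0 : ∀ kl ∈ I, (resultant (P kl) (Q kl)).natAbs ≠ 0 := fun kl hkl => by simpa using hr0 kl hkl
  refine ⟨∏ kl ∈ I, (resultant (P kl) (Q kl)).natAbs, ?_, ?_, ?_⟩
  · exact Finset.prod_pos fun kl hkl => Nat.pos_of_ne_zero (hn0 kl hkl)
  · push_cast only [Nat.cast_prod]
    rw [Real.log_prod (fun kl hkl => by exact_mod_cast hn0 kl hkl)]
    have hcard : (I.card : ℝ) ≤ (3 * (K:ℝ)) ^ m * (3 * (L:ℝ)) ^ m := by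
      calc (I.card : ℝ) ≤ ((box K ×ˢ box L).card : ℝ) := by exact_mod_cast Finset.card_filter_le _ _
        _ = ((box K).card : ℝ) * (box L).card := by rw [Finset.card_product]; push_cast; ring
        _ ≤ _ := mul_le_mul (box_card m K hK) (box_card m L hL) (by positivity) (by positivity)
    calc _ ≤ ∑ kl ∈ I, c * ((K:ℝ) * L) := by
          apply Finset.sum_le_sum
          intro kl hkl
          obtain ⟨⟨h1, h2⟩, h3⟩ := (hI kl).1 hkl
          exact hres K L hK hL kl.1 kl.2 h1 h2 _ _ _ (D.PP_ne_zero _ (left_ne_zero_of_indep h3).1)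
            (D.PP_ne_zero _ (left_ne_zero_of_indep h3).2) (hP kl) (hQ kl) (hr0 kl hkl)
      _ = I.card * (c * ((K:ℝ) * L)) := by rw [Finset.sum_const, nsmul_eq_mul]
      _ ≤ ((3 * (K:ℝ)) ^ m * (3 * (L:ℝ)) ^ m) * (c * ((K:ℝ) * L)) := by gcongr
      _ = _ := by
        rw [← mul_pow, pow_succ, show 3 * (K:ℝ) * (3 * L) = 9 * (K * L) by ring, mul_pow]; ring
  · intro p hp hMp
    let F := AlgebraicClosure (ZMod p)
    have hchar : CharP F p := charP_of_injective_algebraMap (algebraMap (ZMod p) F).injective p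
    have hN : D.Nice F := by
      apply hnice
      intro h
      rw [CharP.intCast_eq_zero_iff F p] at h
      have h1 := Int.le_of_dvd (abs_pos.2 hM) ((dvd_abs _ _).2 h)
      have h2 : (p:ℝ) ≤ |(M:ℝ)| := by exact_mod_cast h1
      linarith
    let S : (Fin m → ℤ) × (Fin m → ℤ) → Finset F := fun kl =>
      ((P kl).map (Int.castRingHom F)).roots.toFinset ∩ ((Q kl).map (Int.castRingHom F)).roots.toFinset
    have hPne : ∀ kl ∈ I, (P kl).map (Int.castRingHom F) ≠ 0 ∧ (Q kl).map (Int.castRingHom F) ≠ 0 := by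
      intro kl hkl
      obtain ⟨⟨h1, h2⟩, h3⟩ := (hI kl).1 hkl
      obtain ⟨h4, h5⟩ := left_ne_zero_of_indep h3
      constructor
      · intro h
        apply D.PP_ne F hN _ h4
        rw [hP, Polynomial.map_mul, h, mul_zero]
      · intro h
        apply D.PP_ne F hN _ h5
        rw [hQ, Polynomial.map_mul, h, mul_zero]
    have hS : ∀ kl ∈ I, ∀ α, α ∈ S kl ↔ ev α (P kl) = 0 ∧ ev α (Q kl) = 0 := by
      intro kl hkl α
      simp only [S, Finset.mem_inter, Multiset.mem_toFinset]
      rw [mem_roots (hPne kl hkl).1, mem_roots (hPne kl hkl).2, IsRoot, IsRoot, ← ev_eq_eval_map, ← ev_eq_eval_map]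
    let WR : Finset F := (W.map (Int.castRingHom F)).roots.toFinset
    let U : Finset F := I.biUnion S ∪ WR
    have hsub : {α : F | Good f g α ∧ ∃ k l : Fin m → ℤ, LinearIndependent ℤ ![k, l] ∧
      (∀ i, |k i| ≤ (K : ℤ)) ∧ (∀ i, |l i| ≤ (L : ℤ)) ∧ val f g α k = 1 ∧ val f g α l = 1} ⊆ (U : Set F) := by
      rintro α ⟨hα, k, l, hkl, hk, hl, vk, vl⟩
      rw [Finset.mem_coe, Finset.mem_union]
      have hmem : (k, l) ∈ I := (hI (k, l)).2 ⟨⟨hk, hl⟩, hkl⟩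
      have e1 := (ev_PP hα k).2 vk
      have e2 := (ev_PP hα l).2 vl
      by_cases hE : ev α (E (k, l)) = 0
      · right
        rw [Multiset.mem_toFinset, mem_roots (hW F hN), IsRoot, ← ev_eq_eval_map]
        exact hWα F hN α hα k l hkl _ _ _ (hP (k, l)) (hQ (k, l)) hE
      · left
        rw [Finset.mem_biUnion]
        refine ⟨(k, l), hmem, (hS _ hmem α).2 ⟨?_, ?_⟩⟩
        · rw [hP (k, l), map_mul] at e1
          exact (mul_eq_zero.1 e1).resolve_left hE
        · rw [hQ (k, l), map_mul] at e2
          exact (mul_eq_zero.1 e2).resolve_left hE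
    refine ⟨U.finite_toSet.subset hsub, ?_⟩
    have hval : padicValNat p (∏ kl ∈ I, (resultant (P kl) (Q kl)).natAbs) = ∑ kl ∈ I, padicValNat p (resultant (P kl) (Q kl)).natAbs := by
      exact padicVal_prod _ _ hn0
    have hU : U.card ≤ padicValNat p (∏ kl ∈ I, (resultant (P kl) (Q kl)).natAbs) + W.natDegree := by
      rw [hval]
      refine (Finset.card_union_le _ _).trans (add_le_add ?_ ?_)
      · refine Finset.card_biUnion_le.trans (Finset.sum_le_sum fun kl hkl => ?_)
        exact card_le_val _ _ (hr0 kl hkl) (hPne kl hkl).1 (S kl) fun α hα => (hS kl hkl α).1 hα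
      · exact (Multiset.toFinset_card_le _).trans ((card_roots' _).trans natDegree_map_le)
    have h1 := Set.ncard_le_ncard hsub U.finite_toSet
    rw [Set.ncard_coe_finset] at h1
    exact_mod_cast h1.trans hU

end PartMain

theorem stmt_14 (m : ℕ) (hm : 0 < m) (f g : Fin m → Polynomial ℤ)
    (hf : ∀ i, f i ≠ 0) (hg : ∀ i, g i ≠ 0) (hcop : ∀ i, IsRelPrime (f i) (g i))
    -- `φᵢ = fᵢ/gᵢ ∈ ℚ(X)` are multiplicatively independent modulo constants
    (hindepc : ∀ k : Fin m → ℤ,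
      (∃ q : ℚ, q ≠ 0 ∧
        (∏ i, (algebraMap (Polynomial ℚ) (RatFunc ℚ) ((f i).map (Int.castRingHom ℚ)) /
          algebraMap (Polynomial ℚ) (RatFunc ℚ) ((g i).map (Int.castRingHom ℚ))) ^ (k i)) =
        RatFunc.C q) → k = 0) :
    ∃ c₁ c₂ c₃ : ℝ, ∀ K L : ℕ, 1 ≤ K → 1 ≤ L →
      ∃ T : ℕ, 0 < T ∧ Real.log (T : ℝ) ≤ c₁ * ((K : ℝ) * (L : ℝ)) ^ (m + 1) ∧
        ∀ (p : ℕ) (_ : Fact p.Prime), c₂ < (p : ℝ) →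
          (depSet m f g K L p).Finite ∧
            ((depSet m f g K L p).ncard : ℝ) ≤ (padicValNat p T : ℝ) + c₃ := by
  obtain ⟨D⟩ := BMZ.exists_data m f g hf hg hindepc
  exact stmt_14' m hm f g hf hg D
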